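/- arXiv:math/0001049 — 2 statements merged into one kernel-verified Lean document; each statement's English description precedes it below -/
import Mathlib

section
/- Let K be a field, S a positive normal affine semigroup with gp(S) = ℤ^r, support forms σ_1,…,σ_s and R = K[S]. Let a ∈ ℤ^s be such that the class [a] is a torsion element of ℤ^s/σ(ℤ^r), i.e. ma ∈ σ(ℤ^r) for some integer m ≥ 1. Then the divisorial ideal D(a) = K·T(a) is a Cohen–Macaulay R-module. -/
set_option synthInstance.maxHeartbeats 1000000
set_option maxHeartbeats 1000000

open scoped BigOperators

noncomputable section

/-- Pairing of an integral linear form (given by its coefficient vector `f`) with `x`. -/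
def lin {r : ℕ} (f x : Fin r → ℤ) : ℤ := ∑ k, f k * x k

lemma lin_zero {r : ℕ} (f : Fin r → ℤ) : lin f 0 = 0 := by simp [lin]

lemma lin_add {r : ℕ} (f x y : Fin r → ℤ) : lin f (x + y) = lin f x + lin f y := by
  simp [lin, mul_add, Finset.sum_add_distrib]

/-- A family of integral linear forms, bundled as an additive homomorphism `ℤ^r → ℤ^s`. -/
def formsHom {r s : ℕ} (σ : Fin s → Fin r → ℤ) : (Fin r → ℤ) →+ (Fin s → ℤ) where
  toFun x i := lin (σ i) x
  map_zero' := by funext i; simp [lin_zero]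
  map_add' x y := by funext i; simp [lin_add]

/-- The subgroup `σ(ℤ^r) ⊆ ℤ^s`. -/
def formsRange {r s : ℕ} (σ : Fin s → Fin r → ℤ) : AddSubgroup (Fin s → ℤ) :=
  (formsHom σ).range

/-- The divisor class group `Cl(R) = ℤ^s / σ(ℤ^r)`. -/
abbrev classGroup {r s : ℕ} (σ : Fin s → Fin r → ℤ) : Type :=
  (Fin s → ℤ) ⧸ formsRange σ

/-- The set of solutions of the inhomogeneous system of inequalities `σ_i(x) ≥ a_i`. -/
def Tset {r s : ℕ} (σ : Fin s → Fin r → ℤ) (a : Fin s → ℤ) : Set (Fin r → ℤ) :=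
  {x | ∀ i, a i ≤ lin (σ i) x}

/-- The monomial of exponent `x` in the group algebra `K[ℤ^r]`. -/
def mono (K : Type*) [Field K] {r : ℕ} (x : Fin r → ℤ) : AddMonoidAlgebra K (Fin r → ℤ) :=
  AddMonoidAlgebra.single x 1

/-- The affine semigroup ring `K[S]`, as a subalgebra of `K[ℤ^r]`. -/
def semigroupRing (K : Type*) [Field K] {r : ℕ} (S : AddSubmonoid (Fin r → ℤ)) :
    Subalgebra K (AddMonoidAlgebra K (Fin r → ℤ)) :=
  Algebra.adjoin K {f | ∃ x ∈ S, f = mono K x}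

/-- The monomial (fractional) ideal of `K[S]` with monomial basis `T ⊆ ℤ^r`, as a
`K[S]`-submodule of `K[ℤ^r]`.  (When `S + T ⊆ T`, its underlying set is the `K`-span
of the monomials with exponents in `T`.) -/
def monIdeal (K : Type*) [Field K] {r : ℕ} (S : AddSubmonoid (Fin r → ℤ))
    (T : Set (Fin r → ℤ)) :
    Submodule ↥(semigroupRing K S) (AddMonoidAlgebra K (Fin r → ℤ)) :=
  Submodule.span _ {f | ∃ x ∈ T, f = mono K x}

/-- The maximal ideal of `K[S]` generated by all nonunit monomials. -/
def irrelevantIdeal (K : Type*) [Field K] {r : ℕ} (S : AddSubmonoid (Fin r → ℤ)) :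
    Ideal ↥(semigroupRing K S) :=
  Ideal.span {f | ∃ x ∈ S, x ≠ 0 ∧ (f : AddMonoidAlgebra K (Fin r → ℤ)) = mono K x}

/-- `M` is a Cohen–Macaulay module with respect to the ideal `I ⊆ R`: the length of a
maximal `M`-regular sequence contained in `I` equals the Krull dimension of `M`
(the Krull dimension of `R/ann(M)`). -/
def IsCohenMacaulayMod (R : Type*) [CommRing R] (I : Ideal R)
    (M : Type*) [AddCommGroup M] [Module R M] : Prop :=
  ∃ rs : List R, (∀ x ∈ rs, x ∈ I) ∧ RingTheory.Sequence.IsRegular M rs ∧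
    (∀ y ∈ I, ¬ RingTheory.Sequence.IsRegular M (rs ++ [y])) ∧
    (rs.length : WithBot ℕ∞) = ringKrullDim (R ⧸ Module.annihilator R M)

open Module in
theorem exists_basis_of_unitriangular {K M T Λ : Type*} [Field K] [AddCommGroup M] [Module K M]
    [LinearOrder Λ] (e : Basis T K M) (w : T → M) (h : T → Λ) (lt : T → T → Prop)
    (hwf : WellFounded lt) (hlt : ∀ y t, lt y t → h t < h y)
    (hw : ∀ t, w t - e t ∈ Submodule.span K (e '' {y | lt y t})) :
    ∃ β : Basis T K M, ∀ t, β t = w t := by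
  classical
  have hsp : ∀ t, e t ∈ Submodule.span K (Set.range w) := by
    intro t
    induction t using hwf.induction with
    | _ t ih =>
      have h1 : w t - e t ∈ Submodule.span K (Set.range w) := by
        refine Submodule.span_le.2 ?_ (hw t)
        rintro _ ⟨y, hy, rfl⟩
        exact ih y hy
      have := sub_mem (Submodule.subset_span ⟨t, rfl⟩ : w t ∈ Submodule.span K (Set.range w)) h1
      simpa using this
  have hcoef : ∀ t y, h y ≤ h t → e.repr (w t) y = if y = t then 1 else 0 := by
    intro t y hy
    have h0 : e.repr (w t - e t) y = 0 := by
      have h1 := hw t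
      rw [Basis.mem_span_image] at h1
      by_contra h2
      exact absurd (hlt _ _ (h1 (Finsupp.mem_support_iff.2 h2))) (not_lt.2 hy)
    rw [map_sub, Finsupp.sub_apply, sub_eq_zero] at h0
    rw [h0, Basis.repr_self, Finsupp.single_apply]
    simp [eq_comm]
  have hli : LinearIndependent K w := by
    rw [linearIndependent_iff]
    intro f hf
    by_contra hne
    obtain ⟨t, ht, hmin⟩ := Finset.exists_min_image f.support h
      (Finsupp.support_nonempty_iff.2 hne)
    have h1 : e.repr (Finsupp.linearCombination K w f) t = f t := by
      rw [Finsupp.linearCombination_apply, Finsupp.sum, map_sum, Finsupp.finsetSum_apply,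
        Finset.sum_eq_single t]
      · simp [hcoef t t le_rfl]
      · intro y hy hyt
        rw [map_smul, Finsupp.smul_apply, hcoef y t (hmin y hy), if_neg (Ne.symm hyt), smul_zero]
      · intro h; exact absurd ht h
    rw [hf] at h1
    simp only [map_zero, Finsupp.coe_zero, Pi.zero_apply] at h1
    exact Finsupp.mem_support_iff.1 ht h1.symm
  refine ⟨Basis.mk hli ?_, fun t => Basis.mk_apply _ _ t⟩
  rw [← e.span_eq]
  exact Submodule.span_le.2 (by rintro _ ⟨t, rfl⟩; exact hsp t)

/-- The monomial in the elements `θ j` with exponent vector `n`. -/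
def monomialEval {R : Type*} [CommRing R] {r : ℕ} (θ : Fin r → R)
    (n : Fin r →₀ ℕ) : R :=
  n.prod fun j k => θ j ^ k

theorem monomialEval_add {R : Type*} [CommRing R] {r : ℕ} (θ : Fin r → R) (m n : Fin r →₀ ℕ) :
    monomialEval θ (m + n) = monomialEval θ m * monomialEval θ n := by
  simp [monomialEval, Finsupp.prod_add_index', pow_add]

theorem monomialEval_single {R : Type*} [CommRing R] {r : ℕ} (θ : Fin r → R) (j : Fin r) (k : ℕ) :
    monomialEval θ (Finsupp.single j k) = θ j ^ k := by
  simp [monomialEval]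

theorem monomialEval_zero {R : Type*} [CommRing R] {r : ℕ} (θ : Fin r → R) :
    monomialEval θ 0 = 1 := by
  simp [monomialEval]

open Module in
theorem monomialEval_smul_sub_mem {K R M T : Type*} [Field K] [CommRing R] [Algebra K R]
    [AddCommGroup M] [Module K M] [Module R M] [IsScalarTower K R M] {r : ℕ}
    (e : Basis T K M) (θ : Fin r → R) (act : (Fin r →₀ ℕ) → T → T) (lt : T → T → Prop)
    (htrans : ∀ x y z, lt x y → lt y z → lt x z)
    (hact0 : ∀ t, act 0 t = t) (hact : ∀ m n t, act (m + n) t = act m (act n t))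
    (hmono : ∀ n y t, lt y t → lt (act n y) (act n t))
    (hθ : ∀ j t, θ j • e t - e (act (Finsupp.single j 1) t) ∈
      Submodule.span K (e '' {y | lt y (act (Finsupp.single j 1) t)}))
    (n : Fin r →₀ ℕ) (t : T) :
    monomialEval θ n • e t - e (act n t) ∈ Submodule.span K (e '' {y | lt y (act n t)}) := by
  have hspan : ∀ x y, lt x y → Submodule.span K (e '' {z | lt z x}) ≤
      Submodule.span K (e '' {z | lt z y}) := fun x y hxy =>
    Submodule.span_mono (Set.image_mono fun z hz => htrans _ _ _ hz hxy)
  have hadd : ∀ m n : Fin r →₀ ℕ,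
      (∀ t, monomialEval θ m • e t - e (act m t) ∈ Submodule.span K (e '' {y | lt y (act m t)})) →
      (∀ t, monomialEval θ n • e t - e (act n t) ∈ Submodule.span K (e '' {y | lt y (act n t)})) →
      ∀ t, monomialEval θ (m + n) • e t - e (act (m + n) t) ∈
        Submodule.span K (e '' {y | lt y (act (m + n) t)}) := by
    intro m n hm hn t
    have h1 : ∀ x ∈ Submodule.span K (e '' {y | lt y (act n t)}),
        monomialEval θ m • x ∈ Submodule.span K (e '' {y | lt y (act m (act n t))}) := by
      intro x hx
      induction hx using Submodule.span_induction with
      | mem x hx =>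
        obtain ⟨y, hy, rfl⟩ := hx
        have h2 := hspan _ _ (hmono m _ _ hy) (hm y)
        have h3 : e (act m y) ∈ Submodule.span K (e '' {y | lt y (act m (act n t))}) :=
          Submodule.subset_span ⟨_, hmono m _ _ hy, rfl⟩
        simpa using add_mem h2 h3
      | zero => simp
      | add x y _ _ hx hy => rw [smul_add]; exact add_mem hx hy
      | smul a x _ hx => rw [smul_comm]; exact Submodule.smul_mem _ _ hx
    have h2 := add_mem (h1 _ (hn t)) (hm (act n t))
    rw [hact, monomialEval_add, mul_smul]
    simpa [smul_sub] using h2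
  have hzero : ∀ t, monomialEval θ 0 • e t - e (act 0 t) ∈
      Submodule.span K (e '' {y | lt y (act 0 t)}) := by
    intro t; simp [monomialEval_zero, hact0]
  revert t
  induction n using Finsupp.induction_linear with
  | zero => exact hzero
  | add m n hm hn => exact hadd m n hm hn
  | single j k =>
    induction k with
    | zero => simpa using hzero
    | succ k ih =>
      rw [Finsupp.single_add]
      refine hadd _ _ ih fun t => ?_
      simpa [monomialEval_single] using hθ j t

open Module in
theorem repr_smul_eq_mapDomain {K R M B : Type*} [Field K] [CommRing R] [Algebra K R]
    [AddCommGroup M] [Module K M] [Module R M] [IsScalarTower K R M] {r : ℕ}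
    (β : Basis (B × (Fin r →₀ ℕ)) K M) (θ : Fin r → R)
    (hβ : ∀ j b n, θ j • β (b, n) = β (b, n + Finsupp.single j 1)) (j : Fin r) (m : M) :
    β.repr (θ j • m) =
      (β.repr m).mapDomain fun x => (x.1, x.2 + Finsupp.single j 1) := by
  have h : β.repr.toLinearMap ∘ₗ (Algebra.lsmul K K M (θ j)) =
      Finsupp.lmapDomain K K (fun x : B × (Fin r →₀ ℕ) => (x.1, x.2 + Finsupp.single j 1)) ∘ₗ
        β.repr.toLinearMap := by
    refine β.ext fun x => ?_
    obtain ⟨b, n⟩ := x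
    simp [hβ]
  simpa using LinearMap.congr_fun h m

open Module in
theorem repr_smul_add_single {K R M B : Type*} [Field K] [CommRing R] [Algebra K R]
    [AddCommGroup M] [Module K M] [Module R M] [IsScalarTower K R M] {r : ℕ}
    (β : Basis (B × (Fin r →₀ ℕ)) K M) (θ : Fin r → R)
    (hβ : ∀ j b n, θ j • β (b, n) = β (b, n + Finsupp.single j 1)) (j : Fin r) (m : M)
    (b : B) (n : Fin r →₀ ℕ) :
    β.repr (θ j • m) (b, n + Finsupp.single j 1) = β.repr m (b, n) := by
  rw [repr_smul_eq_mapDomain β θ hβ]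
  refine Finsupp.mapDomain_apply (f := fun x : B × (Fin r →₀ ℕ) =>
    (x.1, x.2 + Finsupp.single j 1)) ?_ (β.repr m) (b, n)
  rintro ⟨b, n⟩ ⟨b', n'⟩ h
  simpa using h

open Module in
theorem mem_ofList_take_smul_top_iff {K R M B : Type*} [Field K] [CommRing R] [Algebra K R]
    [AddCommGroup M] [Module K M] [Module R M] [IsScalarTower K R M] {r : ℕ}
    (β : Basis (B × (Fin r →₀ ℕ)) K M) (θ : Fin r → R)
    (hβ : ∀ j b n, θ j • β (b, n) = β (b, n + Finsupp.single j 1)) (k : ℕ) (m : M) :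
    m ∈ (Ideal.ofList ((List.ofFn θ).take k) • ⊤ : Submodule R M) ↔
      ∀ b n, β.repr m (b, n) ≠ 0 → ∃ j : Fin r, j.1 < k ∧ n j ≠ 0 := by
  have hmem : ∀ x, x ∈ (List.ofFn θ).take k ↔ ∃ j : Fin r, j.1 < k ∧ θ j = x := by
    intro x
    simp only [List.mem_take_iff_getElem, List.getElem_ofFn, List.length_ofFn]
    constructor
    · rintro ⟨i, hi, rfl⟩
      exact ⟨⟨i, by omega⟩, by simp; omega, rfl⟩
    · rintro ⟨j, hj, rfl⟩
      exact ⟨j.1, by have := j.2; omega, rfl⟩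
  constructor
  · intro hm
    suffices h : ∀ c ∈ Ideal.ofList ((List.ofFn θ).take k), ∀ m : M, ∀ b n,
        β.repr (c • m) (b, n) ≠ 0 → ∃ j : Fin r, j.1 < k ∧ n j ≠ 0 by
      refine Submodule.smul_induction_on hm (fun c hc m _ => h c hc m) ?_
      intro x y hx hy b n hxy
      rw [map_add, Finsupp.add_apply] at hxy
      by_cases h0 : β.repr x (b, n) = 0
      · exact hy b n (by simpa [h0] using hxy)
      · exact hx b n h0
    intro c hc
    refine Submodule.span_induction (p := fun c _ => ∀ m : M, ∀ b n,
        β.repr (c • m) (b, n) ≠ 0 → ∃ j : Fin r, j.1 < k ∧ n j ≠ 0) ?_ ?_ ?_ ?_ hc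
    · intro x hx m b n hne
      obtain ⟨j, hj, rfl⟩ := (hmem x).1 hx
      refine ⟨j, hj, fun h0 => hne ?_⟩
      rw [repr_smul_eq_mapDomain β θ hβ]
      refine Finsupp.mapDomain_of_notMem_range _ _ ?_
      rintro ⟨⟨b', n'⟩, h⟩
      have := congrArg (fun x : B × (Fin r →₀ ℕ) => x.2 j) h
      simp [h0] at this
    · intro m b n h; simp at h
    · intro x y _ _ hx hy m b n hxy
      rw [add_smul, map_add, Finsupp.add_apply] at hxy
      by_cases h0 : β.repr (x • m) (b, n) = 0
      · exact hy m b n (by simpa [h0] using hxy)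
      · exact hx m b n h0
    · intro c x _ hx m b n h
      refine hx (c • m) b n ?_
      rwa [smul_eq_mul, mul_comm, mul_smul] at h
  · intro h
    rw [← β.linearCombination_repr m, Finsupp.linearCombination_apply]
    refine Submodule.sum_mem _ fun x hx => ?_
    obtain ⟨b, n⟩ := x
    obtain ⟨j, hj, hn⟩ := h b n (Finsupp.mem_support_iff.1 hx)
    refine Submodule.smul_of_tower_mem _ _ ?_
    have h1 : n = (n - Finsupp.single j 1) + Finsupp.single j 1 := by
      refine (tsub_add_cancel_of_le ?_).symm
      simpa [Nat.one_le_iff_ne_zero] using hn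
    rw [h1, ← hβ]
    exact Submodule.smul_mem_smul (Ideal.subset_span ((hmem _).2 ⟨j, hj, rfl⟩)) trivial

open Module in
theorem isRegular_ofFn_of_basis {K R M B : Type*} [Field K] [CommRing R] [Algebra K R]
    [AddCommGroup M] [Module K M] [Module R M] [IsScalarTower K R M] {r : ℕ} [Nonempty B]
    (β : Basis (B × (Fin r →₀ ℕ)) K M) (θ : Fin r → R)
    (hβ : ∀ j b n, θ j • β (b, n) = β (b, n + Finsupp.single j 1)) :
    RingTheory.Sequence.IsRegular M (List.ofFn θ) := by
  refine ⟨⟨fun i hi => ?_⟩, fun htop => ?_⟩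
  · have hi' : i < r := by simpa using hi
    rw [isSMulRegular_iff_right_eq_zero_of_smul]
    intro q hq
    obtain ⟨m, rfl⟩ := Submodule.mkQ_surjective _ q
    rw [← map_smul, Submodule.mkQ_apply, Submodule.Quotient.mk_eq_zero] at hq
    rw [Submodule.mkQ_apply, Submodule.Quotient.mk_eq_zero]
    rw [mem_ofList_take_smul_top_iff β θ hβ] at hq ⊢
    intro b n hne
    obtain ⟨j, hj, hn⟩ := hq b (n + Finsupp.single ⟨i, hi'⟩ 1) (by
      rw [List.getElem_ofFn, repr_smul_add_single β θ hβ]; exact hne)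
    refine ⟨j, hj, ?_⟩
    have : (⟨i, hi'⟩ : Fin r) ≠ j := fun h => by simp [← h] at hj
    simpa [Finsupp.single_apply, this] using hn
  · obtain ⟨b⟩ := ‹Nonempty B›
    have h1 : β (b, 0) ∈ (Ideal.ofList ((List.ofFn θ).take r) • ⊤ : Submodule R M) := by
      rw [List.take_of_length_le (by simp), ← htop]; trivial
    obtain ⟨j, -, hj⟩ := (mem_ofList_take_smul_top_iff β θ hβ r _).1 h1 b 0 (by simp)
    simp at hj

open Module in
theorem not_isRegular_append_of_basis {K R M B : Type*} [Field K] [CommRing R] [Algebra K R]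
    [AddCommGroup M] [Module K M] [Module R M] [IsScalarTower K R M] {r : ℕ} [Finite B]
    (β : Basis (B × (Fin r →₀ ℕ)) K M) (θ : Fin r → R)
    (hβ : ∀ j b n, θ j • β (b, n) = β (b, n + Finsupp.single j 1)) (y : R) :
    ¬ RingTheory.Sequence.IsRegular M (List.ofFn θ ++ [y]) := by
  intro hreg
  set N : Submodule R M := Ideal.ofList (List.ofFn θ) • ⊤ with hN
  have hyreg : IsSMulRegular (M ⧸ N) y := by
    have := ((RingTheory.Sequence.isWeaklyRegular_append_iff M _ _).1 hreg.toIsWeaklyRegular).2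
    exact (RingTheory.Sequence.isWeaklyRegular_singleton_iff _ _).1 this
  have hfin : Module.Finite K (M ⧸ N) := by
    have hspan : Submodule.span K (Set.range fun b : B => N.mkQ (β (b, 0))) = ⊤ := by
      rw [eq_top_iff]
      rintro q -
      obtain ⟨m, rfl⟩ := Submodule.mkQ_surjective _ q
      rw [← β.linearCombination_repr m, Finsupp.linearCombination_apply, Finsupp.sum, map_sum]
      refine Submodule.sum_mem _ fun x _ => ?_
      obtain ⟨b, n⟩ := x
      rw [LinearMap.map_smul_of_tower]
      refine Submodule.smul_mem _ _ ?_
      by_cases hn : n = 0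
      · subst hn; exact Submodule.subset_span ⟨b, rfl⟩
      · have h0 : N.mkQ (β (b, n)) = 0 := by
          rw [Submodule.mkQ_apply, Submodule.Quotient.mk_eq_zero, hN,
            ← List.take_of_length_le (l := List.ofFn θ) (i := r) (by simp),
            mem_ofList_take_smul_top_iff β θ hβ]
          intro b' n' hne
          have : (b, n) = (b', n') := by
            by_contra h; exact hne (by simp [h])
          obtain ⟨-, rfl⟩ := Prod.mk.injEq .. ▸ this
          obtain ⟨j, hj⟩ := Finsupp.ne_iff.1 hn
          exact ⟨j, j.2, by simpa using hj⟩
        rw [h0]; exact zero_mem _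
    exact ⟨by rw [← hspan]; exact Submodule.fg_span (Set.finite_range _)⟩
  have hinj : Function.Injective (Algebra.lsmul K K (M ⧸ N) y) := hyreg
  have hsurj := LinearMap.injective_iff_surjective.1 hinj
  refine hreg.top_ne_smul (eq_top_iff.2 fun m _ => ?_).symm
  obtain ⟨q, hq⟩ := hsurj (N.mkQ m)
  obtain ⟨m', rfl⟩ := Submodule.mkQ_surjective _ q
  have h1 : m - y • m' ∈ N := by
    rw [← Submodule.Quotient.mk_eq_zero, Submodule.Quotient.mk_sub, sub_eq_zero]
    exact hq.symm
  rw [Ideal.ofList_append, Submodule.sup_smul]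
  rw [← sub_add_cancel m (y • m')]
  refine Submodule.add_mem_sup h1 (Submodule.smul_mem_smul ?_ trivial)
  exact Ideal.subset_span (by simp)

theorem ringKrullDim_eq_of_isIntegral_of_injective (A R : Type*) [CommRing A] [CommRing R]
    [Algebra A R] [Algebra.IsIntegral A R] (hinj : Function.Injective (algebraMap A R)) :
    ringKrullDim R = ringKrullDim A := by
  apply le_antisymm
  · refine Order.krullDim_le_of_strictMono (PrimeSpectrum.comap (algebraMap A R)) ?_
    intro P Q hPQ
    exact Ideal.IsIntegral.comap_lt_comap (R := A) hPQ
  · refine iSup_le fun l => ?_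
    obtain ⟨Q, -, hQ, hQl⟩ := Ideal.exists_ideal_over_prime_of_isIntegral (R := A) (S := R)
      l.head.asIdeal ⊥ (by
        rw [← RingHom.ker_eq_comap_bot, (RingHom.injective_iff_ker_eq_bot _).1 hinj]; exact bot_le)
    have : Q.LiesOver l.head.asIdeal := ⟨hQl.symm⟩
    obtain ⟨L, hL, -⟩ := Ideal.exists_ltSeries_of_hasGoingUp l Q
    exact le_iSup_of_le L (by rw [hL])

open Module in
theorem ringKrullDim_eq_of_basis {K R B : Type*} [Field K] [CommRing R] [Algebra K R]
    {r : ℕ} [Finite B] [Nonempty B]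
    (β : Basis (B × (Fin r →₀ ℕ)) K R) (θ : Fin r → R)
    (hβ : ∀ b n, β (b, n) = monomialEval θ n * β (b, 0)) :
    ringKrullDim R = r := by
  let _ : Algebra (MvPolynomial (Fin r) K) R := (MvPolynomial.aeval θ).toAlgebra
  have hmap : ∀ p : MvPolynomial (Fin r) K,
      algebraMap (MvPolynomial (Fin r) K) R p = MvPolynomial.aeval θ p := fun _ => rfl
  have hmon : ∀ n c, algebraMap (MvPolynomial (Fin r) K) R (MvPolynomial.monomial n c) =
      c • monomialEval θ n := by
    intro n c
    rw [hmap, MvPolynomial.aeval_monomial, Algebra.smul_def]; rfl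
  have hfin : Module.Finite (MvPolynomial (Fin r) K) R := by
    have hspan : Submodule.span (MvPolynomial (Fin r) K) (Set.range fun b : B => β (b, 0)) = ⊤ := by
      rw [eq_top_iff]
      rintro m -
      rw [← β.linearCombination_repr m, Finsupp.linearCombination_apply]
      refine Submodule.sum_mem _ fun x _ => ?_
      obtain ⟨b, n⟩ := x
      dsimp only
      rw [hβ, ← smul_mul_assoc, ← hmon, ← Algebra.smul_def]
      exact Submodule.smul_mem _ _ (Submodule.subset_span ⟨b, rfl⟩)
    exact ⟨by rw [← hspan]; exact Submodule.fg_span (Set.finite_range _)⟩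
  have hinj : Function.Injective (algebraMap (MvPolynomial (Fin r) K) R) := by
    rw [injective_iff_map_eq_zero]
    intro p hp
    obtain ⟨b⟩ := ‹Nonempty B›
    ext n
    have h1 : (algebraMap (MvPolynomial (Fin r) K) R p) * β (b, 0) =
        ∑ n ∈ p.support, p.coeff n • β (b, n) := by
      conv_lhs => rw [p.as_sum]
      rw [map_sum, Finset.sum_mul]
      refine Finset.sum_congr rfl fun n _ => ?_
      rw [hmon, hβ b n, smul_mul_assoc]
    rw [hp, zero_mul] at h1
    have h2 := (linearIndependent_iff'.1 (β.linearIndependent.comp (fun n => (b, n))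
      (Prod.mk_right_injective b))) p.support (fun n => p.coeff n) h1.symm n
    by_cases hn : n ∈ p.support
    · simpa using h2 hn
    · simpa [MvPolynomial.mem_support_iff] using hn
  rw [ringKrullDim_eq_of_isIntegral_of_injective (MvPolynomial (Fin r) K) R hinj,
    MvPolynomial.ringKrullDim_of_isNoetherianRing, ringKrullDim_eq_zero_of_field]
  simp

section Cone

variable {κ ι V : Type*} [Fintype κ] [AddCommGroup V] [Module ℚ V]

/-- The set of indices of the linear forms vanishing at `q`. -/
def zeroIndices (form : κ → V →ₗ[ℚ] ℚ) (q : V) : Finset κ :=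
  Finset.univ.filter fun i => form i q = 0

theorem mem_zeroIndices {form : κ → V →ₗ[ℚ] ℚ} {q : V} {i : κ} :
    i ∈ zeroIndices form q ↔ form i q = 0 := by
  simp [zeroIndices]

/-- A choice of a vector `ray I` in the relative interior of every nonzero face of the pointed cone
`{q | ∀ i, 0 ≤ form i q}`, together with a strictly monotone colouring of the faces by `Fin r`. -/
structure FaceSystem (κ ι V : Type*) [Fintype κ] [AddCommGroup V] [Module ℚ V] (r : ℕ) where
  /-- The linear forms cutting out the cone. -/
  form : κ → V →ₗ[ℚ] ℚ
  /-- The chosen relative interior vectors. -/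
  ray : ι → V
  /-- The colouring of the faces. -/
  color : ι → Fin r
  eq_zero : ∀ q, (∀ i, form i q = 0) → q = 0
  nonneg : ∀ i I, 0 ≤ form i (ray I)
  ne_zero : ∀ I, ray I ≠ 0
  inj : ∀ I J, zeroIndices form (ray I) = zeroIndices form (ray J) → I = J
  color_lt : ∀ I J, zeroIndices form (ray I) ⊂ zeroIndices form (ray J) → color I < color J
  exists_face : ∀ q, q ≠ 0 → (∀ i, 0 ≤ form i q) →
    ∃ I, zeroIndices form (ray I) = zeroIndices form q

namespace FaceSystem

variable {r : ℕ} (Φ : FaceSystem κ ι V r)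

/-- The set of indices of forms vanishing on the face `I`. -/
def zeros (I : ι) : Finset κ := zeroIndices Φ.form (Φ.ray I)

/-- A complete flag of faces. -/
structure IsFlag (F : Fin r → ι) : Prop where
  color_eq : ∀ j, Φ.color (F j) = j
  strictMono : ∀ j k, j < k → Φ.zeros (F j) ⊂ Φ.zeros (F k)

theorem exists_chain_sum [Fintype ι] (q : V) (hq : ∀ i, 0 ≤ Φ.form i q) :
    ∃ c : ι → ℚ, (∀ I, 0 ≤ c I) ∧ ∑ I, c I • Φ.ray I = q ∧
      (∀ I J, c I ≠ 0 → c J ≠ 0 → I ≠ J → Φ.zeros I ⊂ Φ.zeros J ∨ Φ.zeros J ⊂ Φ.zeros I) ∧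
      ∀ I, c I ≠ 0 → zeroIndices Φ.form q ⊆ Φ.zeros I := by
  classical
  induction hn : (zeroIndices Φ.form q)ᶜ.card using Nat.strong_induction_on generalizing q with
  | _ n ih =>
    by_cases h0 : q = 0
    · exact ⟨0, by simp, by simp [h0], by simp, by simp⟩
    obtain ⟨I, hI⟩ := Φ.exists_face q h0 hq
    have hne : (zeroIndices Φ.form q)ᶜ.Nonempty := by
      by_contra h
      rw [Finset.not_nonempty_iff_eq_empty, Finset.compl_eq_empty_iff] at h
      exact h0 (Φ.eq_zero q fun i => mem_zeroIndices.1 (h ▸ Finset.mem_univ i))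
    have hpos : ∀ i ∈ (zeroIndices Φ.form q)ᶜ, 0 < Φ.form i (Φ.ray I) := by
      intro i hi
      rw [← hI, Finset.mem_compl, mem_zeroIndices] at hi
      exact lt_of_le_of_ne (Φ.nonneg i I) (Ne.symm hi)
    obtain ⟨i₀, hi₀, hmin⟩ := Finset.exists_min_image (zeroIndices Φ.form q)ᶜ
      (fun i => Φ.form i q / Φ.form i (Φ.ray I)) hne
    set m := Φ.form i₀ q / Φ.form i₀ (Φ.ray I) with hm
    have hm0 : 0 ≤ m := div_nonneg (hq _) (Φ.nonneg _ _)
    have hform : ∀ i, Φ.form i (q - m • Φ.ray I) = Φ.form i q - m * Φ.form i (Φ.ray I) := by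
      intro i; simp
    have hzero : ∀ i ∈ zeroIndices Φ.form q, Φ.form i (q - m • Φ.ray I) = 0 := by
      intro i hi
      have h1 := hi
      rw [← hI] at h1
      rw [hform, mem_zeroIndices.1 hi, mem_zeroIndices.1 h1]; simp
    have hq' : ∀ i, 0 ≤ Φ.form i (q - m • Φ.ray I) := by
      intro i
      by_cases hi : i ∈ zeroIndices Φ.form q
      · rw [hzero i hi]
      · rw [hform, sub_nonneg]
        have hi' := Finset.mem_compl.2 hi
        exact (le_div_iff₀ (hpos i hi')).1 (hmin i hi')
    have hss : zeroIndices Φ.form q ⊂ zeroIndices Φ.form (q - m • Φ.ray I) := by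
      refine Finset.ssubset_iff_subset_ne.2
        ⟨fun i hi => mem_zeroIndices.2 (hzero i hi), fun h => ?_⟩
      refine Finset.mem_compl.1 hi₀ (h ▸ mem_zeroIndices.2 ?_)
      rw [hform, hm, div_mul_cancel₀ _ (hpos _ hi₀).ne', sub_self]
    obtain ⟨c, hc0, hcs, hcc, hcz⟩ := ih _ (by
      rw [← hn]
      exact Finset.card_lt_card (Finset.compl_ssubset_compl.2 hss)) _ hq' rfl
    have hIlt : ∀ J, c J ≠ 0 → Φ.zeros I ⊂ Φ.zeros J := by
      intro J hJ
      have h1 : Φ.zeros I = zeroIndices Φ.form q := hI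
      exact h1 ▸ lt_of_lt_of_le hss (hcz J hJ)
    have hcI : c I = 0 := by
      by_contra h; exact (hIlt I h).ne rfl
    have hsupp : ∀ J, Function.update c I m J ≠ 0 → J = I ∨ (c J ≠ 0) := by
      intro J hJ
      by_cases h : J = I
      · exact Or.inl h
      · right; rwa [Function.update_of_ne h] at hJ
    refine ⟨Function.update c I m, ?_, ?_, ?_, ?_⟩
    · intro J
      by_cases h : J = I
      · subst h; simpa using hm0
      · rw [Function.update_of_ne h]; exact hc0 J
    · have h1 : ∀ J, Function.update c I m J • Φ.ray J =
          c J • Φ.ray J + if J = I then m • Φ.ray I else 0 := by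
        intro J
        by_cases h : J = I
        · subst h; simp [hcI]
        · simp [h]
      simp [h1, Finset.sum_add_distrib, hcs]
    · intro J J' hJ hJ' hJJ
      rcases hsupp J hJ with rfl | h <;> rcases hsupp J' hJ' with rfl | h'
      · exact absurd rfl hJJ
      · exact Or.inl (hIlt _ h')
      · exact Or.inr (hIlt _ h)
      · exact hcc _ _ h h' hJJ
    · intro J hJ
      rcases hsupp J hJ with rfl | h
      · exact hI.ge
      · exact hss.subset.trans (hcz J h)

theorem exists_flag_sum [Fintype ι] (q : V) (hq : ∀ i, 0 ≤ Φ.form i q)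
    (hgen : ∀ X : Finset ι, X.card < r → q ∉ Submodule.span ℚ (Φ.ray '' X)) :
    ∃ F, Φ.IsFlag F ∧ ∃ c : Fin r → ℚ, (∀ j, 0 < c j) ∧ ∑ j, c j • Φ.ray (F j) = q := by
  classical
  obtain ⟨c, hc0, hcs, hcc, -⟩ := Φ.exists_chain_sum q hq
  set X := Finset.univ.filter fun I => c I ≠ 0 with hX
  have hsum : ∑ I ∈ X, c I • Φ.ray I = q := by
    rw [← hcs, hX]
    refine Finset.sum_filter_of_ne ?_
    intro I _ h h0
    exact h (by rw [h0, zero_smul])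
  have hcard : r ≤ X.card := by
    by_contra h
    refine hgen X (not_le.1 h) (hsum ▸ Submodule.sum_mem _ fun I hI => ?_)
    exact Submodule.smul_mem _ _ (Submodule.subset_span ⟨I, hI, rfl⟩)
  have hmem : ∀ I, I ∈ X ↔ c I ≠ 0 := by simp [hX]
  have hinj : Set.InjOn Φ.color X := by
    intro I hI J hJ h
    by_contra hne
    rcases hcc I J ((hmem I).1 hI) ((hmem J).1 hJ) hne with h' | h'
    · exact (Φ.color_lt _ _ h').ne h
    · exact (Φ.color_lt _ _ h').ne' h
  have himg : X.image Φ.color = Finset.univ := by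
    refine Finset.eq_univ_of_card _ (le_antisymm (Finset.card_le_univ _) ?_)
    rw [Finset.card_image_of_injOn hinj]; simpa using hcard
  have hex : ∀ j, ∃ I ∈ X, Φ.color I = j := fun j =>
    Finset.mem_image.1 (himg ▸ Finset.mem_univ j)
  choose F hFX hFc using hex
  refine ⟨F, ⟨hFc, ?_⟩, fun j => c (F j), ?_, ?_⟩
  · intro j k hjk
    rcases hcc (F j) (F k) ((hmem _).1 (hFX j)) ((hmem _).1 (hFX k)) (fun h => by
      have := congrArg Φ.color h
      rw [hFc, hFc] at this; exact hjk.ne this) with h | h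
    · exact h
    · have := Φ.color_lt _ _ h
      rw [hFc, hFc] at this
      exact absurd this hjk.not_gt
  · exact fun j => lt_of_le_of_ne (hc0 _) (Ne.symm ((hmem _).1 (hFX j)))
  · rw [← hsum]
    refine Finset.sum_nbij F (fun j _ => hFX j) ?_ ?_ (fun _ _ => rfl)
    · intro j _ k _ h
      rw [← hFc j, h, hFc]
    · intro I hI
      exact ⟨Φ.color I, Finset.mem_coe.2 (Finset.mem_univ _), hinj (hFX _) hI (hFc _)⟩

theorem flag_sum_eq_or_lt [Fintype ι] [DecidableEq ι] {F : Fin r → ι} (hF : Φ.IsFlag F)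
    {c : Fin r → ℚ} {d : ι → ℚ} (hd : ∀ I, 0 ≤ d I)
    (h : ∑ j, c j • Φ.ray (F j) = ∑ I, d I • Φ.ray I) :
    (∀ I, d I = if I = F (Φ.color I) then c (Φ.color I) else 0) ∨
      toLex (fun j => ∑ I with Φ.color I = j, d I) < toLex c := by
  classical
  by_cases hall : ∀ I, d I = if I = F (Φ.color I) then c (Φ.color I) else 0
  · exact Or.inl hall
  right
  have hex : ∃ j : Fin r, ¬ ∀ I, Φ.color I = j → d I = if I = F j then c j else 0 := by
    by_contra hcon
    push Not at hcon
    exact hall fun I => hcon _ I rfl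
  obtain ⟨j, hj, hmin⟩ := WellFounded.has_min (wellFounded_lt (α := Fin r))
    {j | ¬ ∀ I, Φ.color I = j → d I = if I = F j then c j else 0} hex
  have hlow : ∀ k, k < j → ∀ I, Φ.color I = k → d I = if I = F k then c k else 0 := by
    intro k hk
    by_contra hcon
    exact hmin k hcon hk
  have hcolor : ∀ k, ∀ g : ι → ℚ,
      (∑ I with Φ.color I = k, if I = F k then g I else 0) = g (F k) := by
    intro k g
    rw [Finset.sum_ite_eq' _ (F k)]
    simp [hF.color_eq]
  have hrest : ∀ i, ∑ k with j ≤ k, c k * Φ.form i (Φ.ray (F k)) =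
      ∑ I with j ≤ Φ.color I, d I * Φ.form i (Φ.ray I) := by
    intro i
    have h1 := congrArg (Φ.form i) h
    simp only [map_sum, map_smul, smul_eq_mul] at h1
    rw [← Finset.sum_filter_add_sum_filter_not _ (fun k => j ≤ k),
      ← Finset.sum_filter_add_sum_filter_not (s := (Finset.univ : Finset ι))
        (fun I => j ≤ Φ.color I)] at h1
    have h2 : ∑ k with ¬ j ≤ k, c k * Φ.form i (Φ.ray (F k)) =
        ∑ I with ¬ j ≤ Φ.color I, d I * Φ.form i (Φ.ray I) := by
      rw [← Finset.sum_fiberwise_of_maps_to (s := Finset.univ.filter fun I => ¬ j ≤ Φ.color I)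
        (t := Finset.univ.filter fun k => ¬ j ≤ k) (g := Φ.color) (by simp)]
      refine Finset.sum_congr rfl fun k hk => ?_
      have hk' : k < j := by simpa using hk
      rw [Finset.filter_filter, ← hcolor k fun I => c k * Φ.form i (Φ.ray I)]
      refine Finset.sum_congr ?_ fun I hI => ?_
      · ext I
        simp only [Finset.mem_filter, Finset.mem_univ, true_and]
        constructor
        · rintro rfl; exact ⟨not_le.2 hk', rfl⟩
        · exact fun h => h.2
      · rw [hlow k hk' I (by simp at hI; exact hI.2)]
        simp
    linarith
  have hsub : ∀ k, j ≤ k → Φ.zeros (F j) ⊆ Φ.zeros (F k) := by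
    intro k hk
    rcases hk.eq_or_lt with rfl | hk
    · exact subset_rfl
    · exact (hF.strictMono _ _ hk).subset
  have honly : ∀ I, Φ.color I = j → I ≠ F j → d I = 0 := by
    intro I hI hne
    by_contra hdI
    have hz : Φ.zeros (F j) ⊆ Φ.zeros I := by
      intro i hi
      have h1 := hrest i
      rw [Finset.sum_eq_zero (fun k hk => by
        have h2 := hsub k (by simpa using hk) hi
        rw [zeros, mem_zeroIndices] at h2
        rw [h2, mul_zero])] at h1
      have h3 := (Finset.sum_eq_zero_iff_of_nonneg (fun J _ =>
        mul_nonneg (hd J) (Φ.nonneg i J))).1 h1.symm I (by simp [hI])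
      exact mem_zeroIndices.2 ((mul_eq_zero.1 h3).resolve_left hdI)
    rcases hz.eq_or_ssubset with h1 | h1
    · exact hne (Φ.inj _ _ h1).symm
    · have := Φ.color_lt _ _ h1
      rw [hF.color_eq, hI] at this
      exact lt_irrefl _ this
  obtain ⟨i, hi, hik⟩ : ∃ i, i ∉ Φ.zeros (F j) ∧ ∀ k, j < k → i ∈ Φ.zeros (F k) := by
    by_cases hlast : j.1 + 1 < r
    · obtain ⟨i, hi, hi'⟩ := Finset.exists_of_ssubset
        (hF.strictMono j ⟨j.1 + 1, hlast⟩ (Fin.lt_def.2 (Nat.lt_succ_self _)))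
      refine ⟨i, hi', fun k hk => ?_⟩
      rcases (show (⟨j.1 + 1, hlast⟩ : Fin r) ≤ k from Fin.le_def.2 hk).eq_or_lt with h1 | h1
      · exact h1 ▸ hi
      · exact (hF.strictMono _ _ h1).subset hi
    · obtain ⟨i, hi⟩ : ∃ i, i ∉ Φ.zeros (F j) := by
        by_contra hcon
        push Not at hcon
        exact Φ.ne_zero (F j) (Φ.eq_zero _ fun i => mem_zeroIndices.1 (hcon i))
      refine ⟨i, hi, fun k hk => ?_⟩
      have := k.2
      have := Fin.lt_def.1 hk
      omega
  have hpos : 0 < Φ.form i (Φ.ray (F j)) :=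
    lt_of_le_of_ne (Φ.nonneg _ _) fun h => hi (mem_zeroIndices.2 h.symm)
  have hle : d (F j) ≤ c j := by
    have h1 := hrest i
    rw [Finset.sum_eq_single j] at h1
    · have h2 := Finset.single_le_sum (s := Finset.univ.filter fun I => j ≤ Φ.color I)
        (f := fun I => d I * Φ.form i (Φ.ray I)) (fun J _ => mul_nonneg (hd J) (Φ.nonneg i J))
        (show F j ∈ _ by simp [hF.color_eq])
      rw [← h1] at h2
      exact le_of_mul_le_mul_right h2 hpos
    · intro k hk hkj
      have := hik k (lt_of_le_of_ne (by simpa using hk) (Ne.symm hkj))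
      rw [zeros, mem_zeroIndices] at this
      rw [this, mul_zero]
    · intro h; simp at h
  have hlt : d (F j) < c j := by
    refine lt_of_le_of_ne hle fun heq => hj fun I hI => ?_
    by_cases hIF : I = F j
    · rw [if_pos hIF, hIF, heq]
    · rw [if_neg hIF, honly I hI hIF]
  refine ⟨j, fun k hk => ?_, ?_⟩
  · change ∑ I with Φ.color I = k, d I = c k
    rw [← hcolor k fun _ => c k]
    refine Finset.sum_congr rfl fun I hI => hlow k hk I (by simpa using hI)
  · change ∑ I with Φ.color I = j, d I < c j
    rwa [Finset.sum_eq_single (F j)]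
    · intro I hI hne
      exact honly I (by simpa using hI) hne
    · intro h; simp [hF.color_eq] at h

theorem flag_sum_unique [Fintype ι] {F G : Fin r → ι} (hF : Φ.IsFlag F) (hG : Φ.IsFlag G)
    {c d : Fin r → ℚ} (hc : ∀ j, 0 < c j) (hd : ∀ j, 0 ≤ d j)
    (h : ∑ j, c j • Φ.ray (F j) = ∑ j, d j • Φ.ray (G j)) : F = G ∧ c = d := by
  classical
  have key : ∀ {F : Fin r → ι}, Φ.IsFlag F → ∀ {c : Fin r → ℚ}, ∀ I,
      (∑ j, if F j = I then c j else 0) = if I = F (Φ.color I) then c (Φ.color I) else 0 := by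
    intro F hF c I
    rw [Finset.sum_eq_single (Φ.color I)]
    · simp [eq_comm]
    · intro j _ hj
      rw [if_neg]
      rintro rfl
      exact hj (hF.color_eq j).symm
    · simp
  have hsum : ∀ {F : Fin r → ι} {c : Fin r → ℚ}, Φ.IsFlag F → ∑ j, c j • Φ.ray (F j) =
      ∑ I, (if I = F (Φ.color I) then c (Φ.color I) else 0) • Φ.ray I := by
    intro F c hF
    simp_rw [← key hF, Finset.sum_smul]
    rw [Finset.sum_comm]
    simp [ite_smul]
  have hnn : ∀ {F : Fin r → ι} {c : Fin r → ℚ}, (∀ j, 0 ≤ c j) → ∀ I,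
      0 ≤ if I = F (Φ.color I) then c (Φ.color I) else 0 := by
    intro F c hc I
    split_ifs
    · exact hc _
    · exact le_rfl
  have hw : ∀ {F : Fin r → ι} {c : Fin r → ℚ}, Φ.IsFlag F →
      (fun j => ∑ I with Φ.color I = j, if I = F (Φ.color I) then c (Φ.color I) else 0) = c := by
    intro F c hF
    funext j
    rw [Finset.sum_eq_single (F j)]
    · simp [hF.color_eq]
    · intro I hI hne
      rw [if_neg]
      rw [(Finset.mem_filter.1 hI).2]; exact hne
    · intro h; simp [hF.color_eq] at h
  have h1 := Φ.flag_sum_eq_or_lt hF (hnn (F := G) hd) (h.trans (hsum hG))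
  have h2 := Φ.flag_sum_eq_or_lt hG (hnn (F := F) fun j => (hc j).le) (h.symm.trans (hsum hF))
  rw [hw hG] at h1
  rw [hw hF] at h2
  have h3 : ∀ I, (if I = G (Φ.color I) then d (Φ.color I) else 0) =
      if I = F (Φ.color I) then c (Φ.color I) else 0 := by
    rcases h1 with h1 | h1
    · exact h1
    · rcases h2 with h2 | h2
      · exact fun I => (h2 I).symm
      · exact absurd h1 h2.not_gt
  have h4 : ∀ j, F j = G j ∧ c j = d j := by
    intro j
    have h5 := h3 (F j)
    rw [hF.color_eq, if_pos rfl] at h5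
    by_cases hj : F j = G j
    · rw [if_pos hj] at h5; exact ⟨hj, h5.symm⟩
    · rw [if_neg hj] at h5; exact absurd h5 (hc j).ne
  exact ⟨funext fun j => (h4 j).1, funext fun j => (h4 j).2⟩

end FaceSystem

end Cone

/-- Combinatorial data on a set `T` of exponents that produces a `K[θ]`-basis of the span of `T`,
where `θ j` is the sum of the monomials with exponents `v I`, `color I = j`. -/
structure TriangularSystem {L ι : Type*} [AddCommGroup L] {r : ℕ} (T : Set L) (v : ι → L)
    (color : ι → Fin r) where
  /-- A totally ordered statistic that is strictly antitone for `lt`. -/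
  height : T → Lex (Fin r → ℚ)
  /-- The order on exponents. -/
  lt : T → T → Prop
  /-- The translation action of exponent vectors. -/
  act : (Fin r →₀ ℕ) → T → T
  /-- The exponents of the module generators. -/
  base : Set T
  /-- The decomposition of `T` into translates of `base`. -/
  expansion : base × (Fin r →₀ ℕ) ≃ T
  wf : WellFounded lt
  height_lt : ∀ y t, lt y t → height t < height y
  trans : ∀ x y z, lt x y → lt y z → lt x z
  act_zero : ∀ t, act 0 t = t
  act_add : ∀ m n t, act (m + n) t = act m (act n t)
  act_mono : ∀ n y t, lt y t → lt (act n y) (act n t)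
  base_finite : base.Finite
  base_nonempty : base.Nonempty
  expansion_apply : ∀ b n, expansion (b, n) = act n b
  exists_leading : ∀ j t, ∃ I₀, color I₀ = j ∧ (act (Finsupp.single j 1) t : L) = t + v I₀ ∧
    ∀ I, color I = j → I ≠ I₀ → ∀ y : T, (y : L) = t + v I → lt y (act (Finsupp.single j 1) t)

theorem FaceSystem.exists_triangularSystem {κ ι V L : Type*} [Fintype κ] [Fintype ι]
    [AddCommGroup V] [Module ℚ V] [AddCommGroup L] {r : ℕ} (Φ : FaceSystem κ ι V r)
    (emb : L →+ V) (v : ι → L) (hv : ∀ I, emb (v I) = Φ.ray I)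
    (T : Set L) (hTne : T.Nonempty) (p : V)
    (hT : ∀ z, z ∈ T ↔ ∀ i, 0 ≤ Φ.form i (emb z - p))
    (hgen : ∀ z ∈ T, ∀ X : Finset ι, X.card < r → emb z - p ∉ Submodule.span ℚ (Φ.ray '' X))
    (deg : V →ₗ[ℚ] ℚ) (d : ℚ) (hd : 0 ≤ d) (hdeg : ∀ I, deg (Φ.ray I) = d)
    (hfin : ∀ c : ℚ, {z ∈ T | deg (emb z) ≤ c}.Finite) :
    Nonempty (TriangularSystem T v Φ.color) := by
  classical
  choose F hF c hc hsum using fun t : T => Φ.exists_flag_sum (emb t - p) ((hT t).1 t.2) (hgen t t.2)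
  have huniq : ∀ (t : T) (G : Fin r → ι) (e : Fin r → ℚ), Φ.IsFlag G → (∀ j, 0 ≤ e j) →
      emb t - p = ∑ j, e j • Φ.ray (G j) → F t = G ∧ c t = e := fun t G e hG he h =>
    Φ.flag_sum_unique (hF t) hG (hc t) he ((hsum t).trans h)
  have hmemT : ∀ (z : L) (G : Fin r → ι) (e : Fin r → ℚ), (∀ j, 0 ≤ e j) →
      emb z - p = ∑ j, e j • Φ.ray (G j) → z ∈ T := by
    intro z G e he h
    rw [hT, h]
    intro i
    simp only [map_sum, map_smul, smul_eq_mul]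
    exact Finset.sum_nonneg fun j _ => mul_nonneg (he j) (Φ.nonneg _ _)
  have hembact : ∀ (n : Fin r →₀ ℕ) (t : T),
      emb ((t : L) + ∑ j, n j • v (F t j)) - p = ∑ j, (c t j + n j) • Φ.ray (F t j) := by
    intro n t
    simp only [map_add, map_sum, map_nsmul, hv, add_smul, Finset.sum_add_distrib, hsum,
      Nat.cast_smul_eq_nsmul]
    abel
  let act : (Fin r →₀ ℕ) → T → T := fun n t => ⟨t + ∑ j, n j • v (F t j),
    hmemT _ (F t) _ (fun j => add_nonneg (hc t j).le (Nat.cast_nonneg _)) (hembact n t)⟩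
  have hact : ∀ n t, (act n t : L) = t + ∑ j, n j • v (F t j) := fun _ _ => rfl
  have hactFc : ∀ n t, F (act n t) = F t ∧ c (act n t) = fun j => c t j + n j := fun n t =>
    huniq _ _ _ (hF t) (fun j => add_nonneg (hc t j).le (Nat.cast_nonneg _)) (hembact n t)
  have hdegt : ∀ t : T, deg (emb t) = deg p + d * ∑ j, c t j := by
    intro t
    have h1 := congrArg deg (hsum t)
    simp only [map_sum, map_sub, map_smul, hdeg, smul_eq_mul] at h1
    rw [Finset.mul_sum]
    simp_rw [mul_comm d]
    linarith
  let lt : T → T → Prop := fun y t => deg (emb y) = deg (emb t) ∧ toLex (c t) < toLex (c y)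
  let base : Set T := {t | ∀ j, c t j < 1}
  let red : T → L := fun t => t - ∑ j, ⌊c t j⌋₊ • v (F t j)
  have hred : ∀ t, emb (red t) - p = ∑ j, (c t j - ⌊c t j⌋₊) • Φ.ray (F t j) := by
    intro t
    simp only [red, map_sub, map_sum, map_nsmul, hv, sub_smul, Finset.sum_sub_distrib, hsum,
      Nat.cast_smul_eq_nsmul]
    abel
  have hfloor : ∀ t j, 0 ≤ c t j - ⌊c t j⌋₊ := fun t j =>
    sub_nonneg.2 (Nat.floor_le (hc t j).le)
  let redT : T → T := fun t => ⟨red t, hmemT _ (F t) _ (hfloor t) (hred t)⟩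
  have hredFc : ∀ t, F (redT t) = F t ∧ c (redT t) = fun j => c t j - ⌊c t j⌋₊ := fun t =>
    huniq _ _ _ (hF t) (hfloor t) (hred t)
  have hredbase : ∀ t, redT t ∈ base := by
    intro t j
    rw [(hredFc t).2]
    linarith [Nat.lt_floor_add_one (c t j)]
  have hactred : ∀ t, act (Finsupp.equivFunOnFinite.symm fun j => ⌊c t j⌋₊) (redT t) = t := by
    intro t
    apply Subtype.ext
    rw [hact, (hredFc t).1]
    simp [redT, red]
  have hfloor_act : ∀ (b : T) (hb : b ∈ base) (n : Fin r →₀ ℕ) (j : Fin r),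
      ⌊c (act n b) j⌋₊ = n j := by
    intro b hb n j
    rw [(hactFc n b).2, Nat.floor_add_natCast (hc b j).le, Nat.floor_eq_zero.2 (hb j), zero_add]
  let expansion : base × (Fin r →₀ ℕ) ≃ T :=
    { toFun := fun x => act x.2 x.1
      invFun := fun t => (⟨redT t, hredbase t⟩, Finsupp.equivFunOnFinite.symm fun j => ⌊c t j⌋₊)
      left_inv := by
        rintro ⟨⟨b, hb⟩, n⟩
        refine Prod.ext (Subtype.ext (Subtype.ext ?_)) ?_
        · change ((act n b : L) - ∑ j, ⌊c (act n b) j⌋₊ • v (F (act n b) j)) = b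
          rw [(hactFc n b).1, hact]
          simp_rw [hfloor_act b hb]
          abel
        · ext j
          simpa using hfloor_act b hb n j
      right_inv := hactred }
  have hltfin : ∀ t, {y | lt y t}.Finite := by
    intro t
    refine Set.Finite.of_finite_image (f := Subtype.val)
      ((hfin (deg (emb t))).subset ?_) Subtype.val_injective.injOn
    rintro _ ⟨y, hy, rfl⟩
    exact ⟨y.2, hy.1.le⟩
  have htrans : ∀ x y z, lt x y → lt y z → lt x z := fun x y z h1 h2 =>
    ⟨h1.1.trans h2.1, h2.2.trans h1.2⟩
  refine ⟨{ height := fun t => toLex (c t)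
            lt := lt
            act := act
            base := base
            expansion := expansion
            wf := ?_
            height_lt := fun y t h => h.2
            trans := htrans
            act_zero := ?_
            act_add := ?_
            act_mono := ?_
            base_finite := ?_
            base_nonempty := ?_
            expansion_apply := fun _ _ => rfl
            exists_leading := ?_ }⟩
  · refine Subrelation.wf (r := InvImage (· < ·) fun t => {y | lt y t}.ncard) ?_
      (InvImage.wf _ wellFounded_lt)
    intro y t hyt
    refine Set.ncard_lt_ncard ⟨fun x hx => htrans _ _ _ hx hyt, fun h => ?_⟩ (hltfin t)
    exact lt_irrefl _ (h (show y ∈ {y | lt y t} from hyt)).2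
  · intro t
    apply Subtype.ext
    simp [hact]
  · intro m n t
    apply Subtype.ext
    rw [hact, hact m, (hactFc n t).1, hact]
    simp [add_smul, Finset.sum_add_distrib]
    abel
  · intro n y t h
    refine ⟨?_, ?_⟩
    · rw [hdegt, hdegt, (hactFc n y).2, (hactFc n t).2]
      have := h.1
      rw [hdegt, hdegt] at this
      simp only [Finset.sum_add_distrib, mul_add]
      linarith
    · rw [(hactFc n y).2, (hactFc n t).2]
      obtain ⟨j, hj, hj'⟩ := h.2
      refine ⟨j, fun k hk => ?_, ?_⟩
      · have := hj k hk
        change c t k = c y k at this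
        change c t k + n k = c y k + n k
        rw [this]
      · change c t j < c y j at hj'
        change c t j + n j < c y j + n j
        linarith
  · refine Set.Finite.of_finite_image (f := Subtype.val)
      ((hfin (deg p + d * r)).subset ?_) Subtype.val_injective.injOn
    rintro _ ⟨y, hy, rfl⟩
    refine ⟨y.2, ?_⟩
    rw [hdegt]
    have : ∑ j, c y j ≤ r := by
      calc ∑ j, c y j ≤ ∑ _j : Fin r, (1 : ℚ) := Finset.sum_le_sum fun j _ => (hy j).le
        _ = r := by simp
    linarith [mul_le_mul_of_nonneg_left this hd]
  · obtain ⟨z, hz⟩ := hTne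
    exact ⟨_, hredbase ⟨z, hz⟩⟩
  · intro j t
    have hactj : (act (Finsupp.single j 1) t : L) = t + v (F t j) := by
      rw [hact, Finset.sum_eq_single j]
      · simp
      · intro k _ hk; simp [hk.symm]
      · simp
    refine ⟨F t j, (hF t).color_eq j, hactj, fun I hI hne y hy => ⟨?_, ?_⟩⟩
    · rw [hy, hactj, map_add, map_add, map_add, map_add, hv, hv, hdeg, hdeg]
    · rw [(hactFc _ t).2]
      have hsumy : ∑ k, c y k • Φ.ray (F y k) = ∑ J, ((if J = F t (Φ.color J) then
          c t (Φ.color J) else 0) + if J = I then 1 else 0) • Φ.ray J := by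
        simp only [add_smul, Finset.sum_add_distrib, ite_smul, one_smul, zero_smul,
          Finset.sum_ite_eq', Finset.mem_univ, if_true]
        rw [hsum, hy, map_add, hv, add_sub_right_comm, ← hsum t]
        congr 1
        rw [← Finset.sum_filter]
        refine Finset.sum_nbij (F t) ?_ ?_ ?_ ?_
        · intro k _; simp [(hF t).color_eq]
        · intro k _ l _ h
          rw [← (hF t).color_eq k, h, (hF t).color_eq]
        · intro J hJ
          exact ⟨Φ.color J, Finset.mem_coe.2 (Finset.mem_univ _), by simpa [eq_comm] using hJ⟩
        · intro k _; rw [(hF t).color_eq]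
      have hnn : ∀ J, 0 ≤ (if J = F t (Φ.color J) then c t (Φ.color J) else 0) +
          if J = I then (1 : ℚ) else 0 := by
        intro J
        have := (hc t (Φ.color J)).le
        split_ifs <;> linarith
      rcases Φ.flag_sum_eq_or_lt (hF y) hnn hsumy with h | h
      · exfalso
        have hpos : ∀ J, Φ.color J = j → (J = F t j ∨ J = I) → J = F y j := by
          intro J hJ hJ'
          by_contra hJy
          have h1 := h J
          rw [hJ, if_neg hJy] at h1
          have := hc t j
          rcases hJ' with h2 | h2
          · rw [if_pos h2] at h1
            split_ifs at h1 <;> linarith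
          · rw [if_pos h2] at h1
            split_ifs at h1 <;> linarith
        exact hne ((hpos I hI (Or.inr rfl)).trans
          (hpos (F t j) ((hF t).color_eq j) (Or.inl rfl)).symm)
      · convert h using 3 with k
        rw [Finset.sum_add_distrib]
        congr 1
        · rw [Finset.sum_eq_single (F t k)]
          · simp [(hF t).color_eq]
          · intro J hJ hne
            rw [if_neg]
            rw [(Finset.mem_filter.1 hJ).2]; exact hne
          · intro h; simp [(hF t).color_eq] at h
        · rw [Finset.sum_ite_eq', Finsupp.single_apply]
          simp [hI]

/-- The inclusion `ℤ^r → ℚ^r`. -/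
def ratVec {r : ℕ} : (Fin r → ℤ) →+ (Fin r → ℚ) where
  toFun x k := x k
  map_zero' := by funext k; simp
  map_add' x y := by funext k; simp

/-- The extension of an integral linear form to `ℚ^r`. -/
def ratForm {r : ℕ} (f : Fin r → ℤ) : (Fin r → ℚ) →ₗ[ℚ] ℚ where
  toFun x := ∑ k, (f k : ℚ) * x k
  map_add' x y := by simp [mul_add, Finset.sum_add_distrib]
  map_smul' c x := by simp [Finset.mul_sum, mul_left_comm]

theorem ratForm_ratVec {r : ℕ} (f x : Fin r → ℤ) : ratForm f (ratVec x) = lin f x := by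
  simp [ratForm, ratVec, lin]

theorem exists_nat_smul_eq_intCast {n : ℕ} (q : Fin n → ℚ) :
    ∃ N : ℕ, 0 < N ∧ ∃ z : Fin n → ℤ, ∀ k, (z k : ℚ) = N * q k := by
  obtain ⟨b, hb⟩ := IsLocalization.exist_integer_multiples_of_finite (nonZeroDivisors ℤ) q
  choose z hz using hb
  have hb0 : (b : ℤ) ≠ 0 := nonZeroDivisors.ne_zero b.2
  refine ⟨(b : ℤ).natAbs, Int.natAbs_pos.2 hb0, fun k => (b : ℤ).sign * z k, fun k => ?_⟩
  have h1 := hz k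
  simp only [zsmul_eq_mul, eq_intCast] at h1
  have h2 : ((b : ℤ).natAbs : ℚ) = ((b : ℤ).sign * b : ℤ) := by
    rw [Int.sign_mul_self_eq_natAbs, Int.cast_natCast]
  rw [h2, Int.cast_mul, Int.cast_mul, h1, mul_assoc]

theorem exists_nat_smul_eq_ratVec {r : ℕ} (q : Fin r → ℚ) :
    ∃ N : ℕ, 0 < N ∧ ∃ z : Fin r → ℤ, ratVec z = (N : ℚ) • q := by
  obtain ⟨N, hN, z, hz⟩ := exists_nat_smul_eq_intCast q
  exact ⟨N, hN, z, funext fun k => by simpa [ratVec] using hz k⟩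

theorem exists_ratForm_eq_smul {r : ℕ} (f : (Fin r → ℚ) →ₗ[ℚ] ℚ) :
    ∃ N : ℕ, 0 < N ∧ ∃ g : Fin r → ℤ, ratForm g = (N : ℚ) • f := by
  obtain ⟨N, hN, g, hg⟩ := exists_nat_smul_eq_intCast fun k => f (Pi.single k 1)
  refine ⟨N, hN, g, LinearMap.pi_ext' fun k => LinearMap.ext_ring ?_⟩
  simp [ratForm, Pi.single_apply, hg]

theorem exists_faceSystem {r s : ℕ} (σ : Fin s → Fin r → ℤ)
    (hσ : ∀ x : Fin r → ℤ, (∀ i, lin (σ i) x = 0) → x = 0) :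
    ∃ (ι : Type) (_ : Fintype ι) (Φ : FaceSystem (Fin s) ι (Fin r → ℚ) r)
      (v : ι → Fin r → ℤ) (d : ℚ), 0 ≤ d ∧ (∀ I, ratVec (v I) = Φ.ray I) ∧
      (∀ i, Φ.form i = ratForm (σ i)) ∧ ∀ I, (∑ i, ratForm (σ i)) (Φ.ray I) = d := by
  classical
  let form : Fin s → (Fin r → ℚ) →ₗ[ℚ] ℚ := fun i => ratForm (σ i)
  have heq : ∀ q, (∀ i, form i q = 0) → q = 0 := by
    intro q hq
    obtain ⟨N, hN, z, hz⟩ := exists_nat_smul_eq_ratVec q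
    have hz0 : z = 0 := hσ z fun i => by
      have h1 : form i (ratVec z) = 0 := by rw [hz, map_smul, hq, smul_zero]
      rw [ratForm_ratVec] at h1
      exact_mod_cast h1
    rw [hz0, map_zero] at hz
    exact (smul_eq_zero.1 hz.symm).resolve_left (by positivity)
  have hsmul : ∀ (c : ℚ), c ≠ 0 → ∀ q, zeroIndices form (c • q) = zeroIndices form q := by
    intro c hc q
    ext i
    simp [mem_zeroIndices, hc]
  let ι := {I : Finset (Fin s) // I ≠ Finset.univ ∧
    ∃ u : Fin r → ℤ, (∀ i, 0 ≤ lin (σ i) u) ∧ zeroIndices form (ratVec u) = I}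
  choose u hu0 huz using fun I : ι => I.2.2
  let len : ι → ℤ := fun I => ∑ i, lin (σ i) (u I)
  have hlen : ∀ I, 0 < len I := by
    intro I
    refine lt_of_le_of_ne (Finset.sum_nonneg fun i _ => hu0 I i) fun h => I.2.1 ?_
    have h1 := (Finset.sum_eq_zero_iff_of_nonneg fun i _ => hu0 I i).1 h.symm
    rw [← huz I, Finset.eq_univ_iff_forall]
    intro i
    rw [mem_zeroIndices]
    change ratForm (σ i) _ = 0
    rw [ratForm_ratVec, h1 i (Finset.mem_univ i), Int.cast_zero]
  let mul : ι → ℤ := fun I => ∏ J ∈ Finset.univ.erase I, len J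
  have hmul : ∀ I, 0 < mul I := fun I => Finset.prod_pos fun J _ => hlen J
  let v : ι → Fin r → ℤ := fun I => mul I • u I
  have hv : ∀ I, ratVec (v I) = (mul I : ℚ) • ratVec (u I) := by
    intro I
    rw [map_zsmul, Int.cast_smul_eq_zsmul]
  have hvz : ∀ I, zeroIndices form (ratVec (v I)) = I.1 := by
    intro I
    rw [hv, hsmul _ (by exact_mod_cast (hmul I).ne'), huz]
  have hvne : ∀ I, ratVec (v I) ≠ 0 := by
    intro I h
    refine I.2.1 ?_
    rw [← hvz I, h, Finset.eq_univ_iff_forall]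
    exact fun i => mem_zeroIndices.2 (map_zero _)
  let E : ι → Submodule ℚ (Fin r → ℚ) := fun I => ⨅ i ∈ I.1, LinearMap.ker (form i)
  have hE : ∀ I q, q ∈ E I ↔ ∀ i ∈ I.1, form i q = 0 := by
    intro I q; simp [E]
  have hvE : ∀ I, ratVec (v I) ∈ E I := by
    intro I
    rw [hE]
    intro i hi
    rw [← hvz I] at hi
    exact mem_zeroIndices.1 hi
  have hErank : ∀ I, 0 < Module.finrank ℚ (E I) := by
    intro I
    have : Nontrivial (E I) := ⟨⟨⟨_, hvE I⟩, 0, fun h => hvne I (congrArg Subtype.val h)⟩⟩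
    exact Module.finrank_pos
  have hErank' : ∀ I, Module.finrank ℚ (E I) ≤ r := by
    intro I
    simpa using Submodule.finrank_le (E I)
  have hElt : ∀ I J : ι, I.1 ⊂ J.1 → Module.finrank ℚ (E J) < Module.finrank ℚ (E I) := by
    intro I J hIJ
    refine Submodule.finrank_lt_finrank_of_lt (lt_of_le_of_ne ?_ ?_)
    · intro q hq
      rw [hE] at hq ⊢
      exact fun i hi => hq i (hIJ.subset hi)
    · intro h
      obtain ⟨j, hjJ, hjI⟩ := Finset.exists_of_ssubset hIJ
      have h1 := (hE J _).1 (h ▸ hvE I) j hjJ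
      exact hjI (hvz I ▸ mem_zeroIndices.2 h1)
  let Φ : FaceSystem (Fin s) ι (Fin r → ℚ) r :=
    { form := form
      ray := fun I => ratVec (v I)
      color := fun I => ⟨r - Module.finrank ℚ (E I), by have := hErank I; have := hErank' I; omega⟩
      eq_zero := heq
      nonneg := by
        intro i I
        rw [hv, map_smul, smul_eq_mul]
        change 0 ≤ _ * ratForm (σ i) _
        rw [ratForm_ratVec]
        exact mul_nonneg (by exact_mod_cast (hmul I).le) (by exact_mod_cast hu0 I i)
      ne_zero := hvne
      inj := by
        intro I J h
        rw [hvz, hvz] at h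
        exact Subtype.ext h
      color_lt := by
        intro I J h
        rw [hvz, hvz] at h
        have := hElt I J h
        have := hErank' I
        rw [Fin.lt_def]
        change r - _ < r - _
        omega
      exists_face := by
        intro q hq hq0
        obtain ⟨N, hN, z, hz⟩ := exists_nat_smul_eq_ratVec q
        have hN' : (N : ℚ) ≠ 0 := by positivity
        refine ⟨⟨zeroIndices form q, fun h => hq (heq q fun i => ?_), z, fun i => ?_, ?_⟩, hvz _⟩
        · exact mem_zeroIndices.1 (h ▸ Finset.mem_univ i)
        · have h1 : 0 ≤ form i (ratVec z) := by
            rw [hz, map_smul]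
            exact mul_nonneg (Nat.cast_nonneg _) (hq0 i)
          rw [ratForm_ratVec] at h1
          exact_mod_cast h1
        · rw [hz, hsmul _ hN'] }
  refine ⟨ι, inferInstance, Φ, v, ((∏ J, len J : ℤ) : ℚ), ?_, fun _ => rfl, fun _ => rfl,
    fun I => ?_⟩
  · exact_mod_cast Finset.prod_nonneg fun J _ => (hlen J).le
  · change (∑ i, ratForm (σ i)) (ratVec (v I)) = _
    rw [hv, map_smul, LinearMap.sum_apply]
    simp_rw [ratForm_ratVec]
    rw [smul_eq_mul, ← Finset.prod_erase_mul _ _ (Finset.mem_univ I)]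
    push_cast [mul, len]
    rfl

theorem exists_generic_shift {r s : ℕ} (σ : Fin s → Fin r → ℤ) (a : Fin s → ℤ)
    (v₀ : Fin r → ℤ) (hv₀ : ∀ i, 0 < lin (σ i) v₀)
    (m : ℕ) (hm : 0 < m) (x : Fin r → ℤ) (hx : m • a = formsHom σ x)
    {α : Type*} [Finite α] (W : α → Submodule ℚ (Fin r → ℚ)) (hW : ∀ j, W j ≠ ⊤) :
    ∃ p : Fin r → ℚ, (∀ z, z ∈ Tset σ a ↔ ∀ i, 0 ≤ ratForm (σ i) (ratVec z - p)) ∧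
      ∀ z j, ratVec z - p ∉ W j := by
  have hg : ∀ j, ∃ g : Fin r → ℤ, ratForm g ≠ 0 ∧ W j ≤ LinearMap.ker (ratForm g) := by
    intro j
    obtain ⟨f, hf, hWf⟩ := Submodule.exists_le_ker_of_lt_top (W j) (lt_top_iff_ne_top.2 (hW j))
    obtain ⟨N, hN, g, hg⟩ := exists_ratForm_eq_smul f
    have hN' : (N : ℚ) ≠ 0 := by positivity
    refine ⟨g, ?_, fun q hq => ?_⟩
    · rw [hg]; exact smul_ne_zero hN' hf
    · rw [LinearMap.mem_ker, hg, LinearMap.smul_apply, LinearMap.mem_ker.1 (hWf hq), smul_zero]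
  choose g hg0 hgW using hg
  obtain ⟨u, hu⟩ : ∃ u, ∀ j, ratForm (g j) u ≠ 0 := by
    have h1 := Subspace.biUnion_ne_univ_of_top_notMem (k := ℚ) (E := Fin r → ℚ)
      (s := (Set.finite_range fun j => LinearMap.ker (ratForm (g j))).toFinset) (by
        rw [Set.Finite.mem_toFinset]
        rintro ⟨j, hj⟩
        exact hg0 j (LinearMap.ker_eq_top.1 hj))
    obtain ⟨u, hu⟩ := (Set.ne_univ_iff_exists_notMem _).1 h1
    refine ⟨u, fun j hj => hu ?_⟩
    simp only [Set.mem_iUnion]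
    exact ⟨_, (Set.Finite.mem_toFinset _).2 ⟨j, rfl⟩, hj⟩
  have hlarge : ∀ c : ℚ, ∀ᶠ N : ℕ in Filter.atTop, c < N := fun c =>
    tendsto_natCast_atTop_atTop.eventually_gt_atTop c
  obtain ⟨q, hqpos, hqne⟩ : ∃ q, (∀ i, 0 < ratForm (σ i) q) ∧ ∀ j, ratForm (g j) q ≠ 0 := by
    have h1 : ∀ᶠ N : ℕ in Filter.atTop, ∀ i, -ratForm (σ i) u < N :=
      Filter.eventually_all.2 fun i => hlarge _
    have h2 : ∀ᶠ N : ℕ in Filter.atTop, ∀ j,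
        -ratForm (g j) u / ratForm (g j) (ratVec v₀) < N :=
      Filter.eventually_all.2 fun j => hlarge _
    obtain ⟨N, hN1, hN2⟩ := (h1.and h2).exists
    refine ⟨u + (N : ℚ) • ratVec v₀, fun i => ?_, fun j hj => ?_⟩
    · rw [map_add, map_smul, ratForm_ratVec, smul_eq_mul]
      have h3 : (1 : ℚ) ≤ lin (σ i) v₀ := by exact_mod_cast hv₀ i
      have h4 := hN1 i
      have h5 : (0 : ℚ) ≤ N := Nat.cast_nonneg N
      nlinarith
    · rw [map_add, map_smul, smul_eq_mul] at hj
      by_cases h0 : ratForm (g j) (ratVec v₀) = 0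
      · rw [h0, mul_zero, add_zero] at hj
        exact hu j hj
      · refine (hN2 j).ne ?_
        rw [div_eq_iff h0]
        linarith
  have h1 : ∀ᶠ N : ℕ in Filter.atTop, ∀ i, ratForm (σ i) q < N :=
    Filter.eventually_all.2 fun i => hlarge _
  have h2 : ∀ᶠ N : ℕ in Filter.atTop, ∀ j, |m * ratForm (g j) q| < N :=
    Filter.eventually_all.2 fun j => hlarge _
  obtain ⟨N, ⟨hN1, hN2⟩, hN0⟩ := ((h1.and h2).and (hlarge 0)).exists
  have hm' : (m : ℚ) ≠ 0 := by positivity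
  have hform : ∀ (f : Fin r → ℤ) (z : Fin r → ℤ), ratForm f
      (ratVec z - ((m : ℚ)⁻¹ • ratVec x - (N : ℚ)⁻¹ • q)) =
      lin f z - (m : ℚ)⁻¹ * lin f x + (N : ℚ)⁻¹ * ratForm f q := by
    intro f z
    simp only [map_sub, map_smul, ratForm_ratVec, smul_eq_mul]
    ring
  refine ⟨(m : ℚ)⁻¹ • ratVec x - (N : ℚ)⁻¹ • q, fun z => forall_congr' fun i => ?_,
    fun z j hz => ?_⟩
  · have hxi : (lin (σ i) x : ℚ) = m * a i := by
      have := congrFun hx i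
      simp only [Pi.smul_apply, nsmul_eq_mul] at this
      rw [show lin (σ i) x = formsHom σ x i from rfl, ← this]
      push_cast
      rfl
    have hε : 0 < (N : ℚ)⁻¹ * ratForm (σ i) q := mul_pos (inv_pos.2 hN0) (hqpos i)
    have hε1 : (N : ℚ)⁻¹ * ratForm (σ i) q < 1 := by
      rw [inv_mul_lt_iff₀ hN0, mul_one]; exact hN1 i
    rw [hform, hxi, inv_mul_cancel_left₀ hm']
    constructor
    · intro h
      have : (a i : ℚ) ≤ lin (σ i) z := by exact_mod_cast h
      linarith
    · intro h
      by_contra hlt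
      have : lin (σ i) z + 1 ≤ a i := by omega
      have : (lin (σ i) z : ℚ) + 1 ≤ a i := by exact_mod_cast this
      linarith
  · have h3 := hgW j hz
    rw [LinearMap.mem_ker, hform] at h3
    have h4 : ((m * lin (g j) z - lin (g j) x : ℤ) : ℚ) = -((N : ℚ)⁻¹ * (m * ratForm (g j) q)) := by
      push_cast
      have := congrArg (fun y => (m : ℚ) * y) h3
      simp only [mul_zero, mul_add, mul_sub, mul_inv_cancel_left₀ hm'] at this
      linarith
    have h5 : |((m * lin (g j) z - lin (g j) x : ℤ) : ℚ)| < 1 := by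
      rw [h4, abs_neg, abs_mul, abs_inv, abs_of_pos hN0, inv_mul_lt_iff₀ hN0, mul_one]
      exact hN2 j
    have h6 : m * lin (g j) z - lin (g j) x = 0 := by
      rw [← Int.abs_lt_one_iff]; exact_mod_cast h5
    rw [h6, Int.cast_zero] at h4
    refine hqne j ?_
    have h7 : (N : ℚ)⁻¹ ≠ 0 := inv_ne_zero hN0.ne'
    have := neg_eq_zero.1 h4.symm
    simpa [h7, hm'] using this

open Module in
theorem isCohenMacaulayMod_of_basis {K R M B : Type*} [Field K] [CommRing R] [Algebra K R]
    [AddCommGroup M] [Module K M] [Module R M] [IsScalarTower K R M] {r : ℕ} [Finite B] [Nonempty B]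
    (β : Basis (B × (Fin r →₀ ℕ)) K M) (θ : Fin r → R)
    (hβ : ∀ j b n, θ j • β (b, n) = β (b, n + Finsupp.single j 1))
    (I : Ideal R) (hθ : ∀ j, θ j ∈ I) (hdim : ringKrullDim R = r)
    (hann : Module.annihilator R M = ⊥) : IsCohenMacaulayMod R I M := by
  refine ⟨List.ofFn θ, ?_, isRegular_ofFn_of_basis β θ hβ,
    fun y _ => not_isRegular_append_of_basis β θ hβ y, ?_⟩
  · intro x hx
    obtain ⟨j, rfl⟩ := List.mem_ofFn.1 hx
    exact hθ j
  · rw [hann, ringKrullDim_eq_of_ringEquiv (RingEquiv.quotientBot R), hdim, List.length_ofFn]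

theorem finite_setOf_mem_Tset_degree_le {r s : ℕ} (σ : Fin s → Fin r → ℤ)
    (hσ : ∀ x : Fin r → ℤ, (∀ i, lin (σ i) x = 0) → x = 0) (a : Fin s → ℤ) (c : ℚ) :
    {z ∈ Tset σ a | (∑ i, ratForm (σ i)) (ratVec z) ≤ c}.Finite := by
  have hinj : Function.Injective (formsHom σ) :=
    (injective_iff_map_eq_zero _).2 fun x hx => hσ x fun i => congrFun hx i
  refine Set.Finite.of_finite_image (f := formsHom σ) ?_ hinj.injOn
  refine (Set.finite_Icc a fun i => ⌊c⌋ - ∑ j, a j + a i).subset ?_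
  rintro _ ⟨z, ⟨hz, hzc⟩, rfl⟩
  refine ⟨hz, fun i => ?_⟩
  change lin (σ i) z ≤ _
  rw [LinearMap.sum_apply] at hzc
  simp_rw [ratForm_ratVec] at hzc
  have h1 : ∑ j, lin (σ j) z ≤ ⌊c⌋ := Int.le_floor.2 (by exact_mod_cast hzc)
  have h2 : lin (σ i) z - a i ≤ ∑ j, (lin (σ j) z - a j) :=
    Finset.single_le_sum (f := fun j => lin (σ j) z - a j) (fun j _ => sub_nonneg.2 (hz j))
      (Finset.mem_univ i)
  rw [Finset.sum_sub_distrib] at h2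
  linarith

theorem Tset_nonempty {r s : ℕ} (σ : Fin s → Fin r → ℤ) (a : Fin s → ℤ) (v₀ : Fin r → ℤ)
    (hv₀ : ∀ i, 0 < lin (σ i) v₀) : (Tset σ a).Nonempty := by
  refine ⟨(∑ j, (a j).natAbs) • v₀, fun i => ?_⟩
  have h1 : lin (σ i) ((∑ j, (a j).natAbs) • v₀) = (∑ j, (a j).natAbs : ℕ) * lin (σ i) v₀ := by
    have := congrFun (map_nsmul (formsHom σ) (∑ j, (a j).natAbs) v₀) i
    rwa [Pi.smul_apply, nsmul_eq_mul] at this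
  have h2 : (a i).natAbs ≤ ∑ j, (a j).natAbs :=
    Finset.single_le_sum (f := fun j => (a j).natAbs) (fun j _ => Nat.zero_le _)
      (Finset.mem_univ i)
  have h3 : a i ≤ ((∑ j, (a j).natAbs : ℕ) : ℤ) := by omega
  rw [h1]
  have := hv₀ i
  have h4 : (0 : ℤ) ≤ ((∑ j, (a j).natAbs : ℕ) : ℤ) := Int.natCast_nonneg _
  nlinarith

theorem exists_triangularSystem_of_torsion {r s : ℕ} (σ : Fin s → Fin r → ℤ)
    (hσ : ∀ x : Fin r → ℤ, (∀ i, lin (σ i) x = 0) → x = 0)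
    (v₀ : Fin r → ℤ) (hv₀ : ∀ i, 0 < lin (σ i) v₀) :
    ∃ (ι : Type) (_ : Fintype ι) (v : ι → Fin r → ℤ) (color : ι → Fin r),
      (∀ I, v I ≠ 0) ∧ (∀ I, ∀ i, 0 ≤ lin (σ i) (v I)) ∧
      ∀ a : Fin s → ℤ, (∃ m : ℕ, 0 < m ∧ ∃ x : Fin r → ℤ, m • a = formsHom σ x) →
        Nonempty (TriangularSystem (Tset σ a) v color) := by
  classical
  obtain ⟨ι, _, Φ, v, d, hd, hv, hform, hdeg⟩ := exists_faceSystem σ hσ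
  refine ⟨ι, inferInstance, v, Φ.color, fun I h => ?_, fun I i => ?_, ?_⟩
  · exact Φ.ne_zero I (by rw [← hv, h, map_zero])
  · have := Φ.nonneg i I
    rw [hform, ← hv, ratForm_ratVec] at this
    exact_mod_cast this
  · rintro a ⟨m, hm, x, hx⟩
    obtain ⟨p, hp, hgen⟩ := exists_generic_shift σ a v₀ hv₀ m hm x hx
      (fun X : {X : Finset ι // X.card < r} => Submodule.span ℚ (Φ.ray '' X.1)) (by
        rintro ⟨X, hX⟩ htop
        have h1 := finrank_span_finset_le_card (R := ℚ) (X.image Φ.ray)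
        rw [Finset.coe_image] at h1
        dsimp only at htop
        rw [Set.finrank, htop, finrank_top, Module.finrank_fin_fun] at h1
        exact absurd (h1.trans Finset.card_image_le) (not_le.2 hX))
    refine Φ.exists_triangularSystem ratVec v hv (Tset σ a) (Tset_nonempty σ a v₀ hv₀) p ?_
      (fun z _ X hX => hgen z ⟨X, hX⟩) (∑ i, ratForm (σ i)) d hd hdeg
      (finite_setOf_mem_Tset_degree_le σ hσ a)
    simpa only [hform] using hp

open Module in
theorem TriangularSystem.exists_basis {K R M L ι : Type*} [Field K] [CommRing R] [Algebra K R]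
    [AddCommGroup M] [Module K M] [Module R M] [IsScalarTower K R M] [AddCommGroup L] [Fintype ι]
    {r : ℕ} {T : Set L} {v : ι → L} {color : ι → Fin r} (A : TriangularSystem T v color)
    (hadd : ∀ (t : T) I, (t : L) + v I ∈ T) (e : Basis T K M) (θ : Fin r → R)
    (hθ : ∀ j t, θ j • e t = ∑ I with color I = j, e ⟨t + v I, hadd t I⟩) :
    ∃ β : Basis (A.base × (Fin r →₀ ℕ)) K M, ∀ b n, β (b, n) = monomialEval θ n • e b := by
  classical
  have hlead : ∀ j t, θ j • e t - e (A.act (Finsupp.single j 1) t) ∈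
      Submodule.span K (e '' {y | A.lt y (A.act (Finsupp.single j 1) t)}) := by
    intro j t
    obtain ⟨I₀, hI₀, hact, hI⟩ := A.exists_leading j t
    have h1 : A.act (Finsupp.single j 1) t = ⟨t + v I₀, hadd t I₀⟩ := Subtype.ext hact
    rw [hθ, ← Finset.add_sum_erase _ _ (show I₀ ∈ Finset.univ.filter (fun I => color I = j) by
      simp [hI₀]), ← h1, add_sub_cancel_left]
    refine Submodule.sum_mem _ fun I hI' => Submodule.subset_span ⟨_, ?_, rfl⟩
    rw [Finset.mem_erase, Finset.mem_filter] at hI'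
    exact hI I hI'.2.2 hI'.1 _ rfl
  obtain ⟨β, hβ⟩ := exists_basis_of_unitriangular e
    (fun t => monomialEval θ (A.expansion.symm t).2 • e (A.expansion.symm t).1) A.height A.lt A.wf
    A.height_lt (fun t => by
      have h1 := monomialEval_smul_sub_mem e θ A.act A.lt A.trans A.act_zero A.act_add A.act_mono
        hlead (A.expansion.symm t).2 (A.expansion.symm t).1
      rwa [← A.expansion_apply, Prod.mk.eta, Equiv.apply_symm_apply] at h1)
  refine ⟨β.reindex A.expansion.symm, fun b n => ?_⟩
  simp [hβ]

section MonomialModules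

variable (K : Type*) [Field K] {r : ℕ}

theorem mono_mul_mono (x y : Fin r → ℤ) : mono K x * mono K y = mono K (x + y) := by
  simp [mono, AddMonoidAlgebra.single_mul_single]

theorem mono_zero : mono K (0 : Fin r → ℤ) = 1 := rfl

theorem linearIndependent_mono : LinearIndependent K (mono K : (Fin r → ℤ) → _) := by
  have h := (AddMonoidAlgebra.basis (Fin r → ℤ) K).linearIndependent
  rwa [show mono K = ⇑(AddMonoidAlgebra.basis (Fin r → ℤ) K) from
    funext fun x => (AddMonoidAlgebra.basis_apply ..).symm]

variable {K}

theorem mono_mem_semigroupRing {S : AddSubmonoid (Fin r → ℤ)} {x : Fin r → ℤ} (hx : x ∈ S) :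
    mono K x ∈ semigroupRing K S :=
  Algebra.subset_adjoin ⟨x, hx, rfl⟩

theorem toSubmodule_semigroupRing (S : AddSubmonoid (Fin r → ℤ)) :
    Subalgebra.toSubmodule (semigroupRing K S) =
      Submodule.span K (Set.range fun x : S => mono K (x : Fin r → ℤ)) := by
  rw [semigroupRing, Algebra.adjoin_eq_span]
  apply le_antisymm
  · refine Submodule.span_mono fun f hf => ?_
    induction hf using Submonoid.closure_induction with
    | mem f hf =>
      obtain ⟨x, hx, rfl⟩ := hf
      exact ⟨⟨x, hx⟩, rfl⟩
    | one => exact ⟨0, mono_zero K⟩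
    | mul f g _ _ hf hg =>
      obtain ⟨x, rfl⟩ := hf
      obtain ⟨y, rfl⟩ := hg
      exact ⟨x + y, (mono_mul_mono K _ _).symm⟩
  · refine Submodule.span_mono ?_
    rintro _ ⟨x, rfl⟩
    exact Submonoid.subset_closure ⟨x, x.2, rfl⟩

theorem restrictScalars_monIdeal (S : AddSubmonoid (Fin r → ℤ)) (T : Set (Fin r → ℤ))
    (hT : ∀ x ∈ S, ∀ y ∈ T, x + y ∈ T) :
    (monIdeal K S T).restrictScalars K =
      Submodule.span K (Set.range fun x : T => mono K (x : Fin r → ℤ)) := by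
  apply le_antisymm
  · intro f hf
    change f ∈ monIdeal K S T at hf
    induction hf using Submodule.span_induction with
    | mem f hf =>
      obtain ⟨x, hx, rfl⟩ := hf
      exact Submodule.subset_span ⟨⟨x, hx⟩, rfl⟩
    | zero => exact zero_mem _
    | add f g _ _ hf hg => exact add_mem hf hg
    | smul c f _ hf =>
      have hc : (c : AddMonoidAlgebra K (Fin r → ℤ)) ∈
          Subalgebra.toSubmodule (semigroupRing K S) := c.2
      rw [toSubmodule_semigroupRing] at hc
      have h1 := Submodule.mul_mem_mul hc hf
      rw [Submodule.span_mul_span] at h1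
      refine Submodule.span_mono ?_ h1
      rintro _ ⟨_, ⟨x, rfl⟩, _, ⟨y, rfl⟩, rfl⟩
      exact ⟨⟨x + y, hT x x.2 y y.2⟩, (mono_mul_mono K _ _).symm⟩
  · rw [Submodule.span_le]
    rintro _ ⟨x, rfl⟩
    exact Submodule.subset_span ⟨x, x.2, rfl⟩

open Module in
theorem exists_basis_semigroupRing (S : AddSubmonoid (Fin r → ℤ)) :
    ∃ e : Basis S K ↥(semigroupRing K S), ∀ x : S, (e x : AddMonoidAlgebra K (Fin r → ℤ)) =
      mono K (x : Fin r → ℤ) := by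
  have hli := (linearIndependent_mono K (r := r)).comp (Subtype.val : S → _)
    Subtype.val_injective
  refine ⟨((Basis.span hli).map (LinearEquiv.ofEq _ _ (toSubmodule_semigroupRing S).symm)).map
    (Subalgebra.toSubmoduleEquiv (semigroupRing K S)), fun x => ?_⟩
  simp only [Basis.map_apply, Basis.span_apply]
  rfl

open Module in
theorem exists_basis_monIdeal (S : AddSubmonoid (Fin r → ℤ)) (T : Set (Fin r → ℤ))
    (hT : ∀ x ∈ S, ∀ y ∈ T, x + y ∈ T) :
    ∃ e : Basis T K ↥(monIdeal K S T), ∀ x : T, (e x : AddMonoidAlgebra K (Fin r → ℤ)) =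
      mono K (x : Fin r → ℤ) := by
  have hli := (linearIndependent_mono K (r := r)).comp (Subtype.val : T → _)
    Subtype.val_injective
  refine ⟨((Basis.span hli).map (LinearEquiv.ofEq _ _
    (restrictScalars_monIdeal S T hT).symm)).map
    ((Submodule.restrictScalarsEquiv K _ _ (monIdeal K S T)).restrictScalars K), fun x => ?_⟩
  simp only [Basis.map_apply, Basis.span_apply]
  rfl

theorem annihilator_monIdeal (S : AddSubmonoid (Fin r → ℤ)) {T : Set (Fin r → ℤ)}
    (hT : T.Nonempty) :
    Module.annihilator ↥(semigroupRing K S) ↥(monIdeal K S T) = ⊥ := by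
  obtain ⟨x, hx⟩ := hT
  rw [eq_bot_iff]
  intro c hc
  have h1 := congrArg Subtype.val
    (Module.mem_annihilator.1 hc ⟨mono K x, Submodule.subset_span ⟨x, hx, rfl⟩⟩)
  have h2 : (c : AddMonoidAlgebra K (Fin r → ℤ)) * mono K x = 0 := h1
  have h3 := congrArg (· * mono K (-x)) h2
  simp only [mul_assoc, mono_mul_mono, add_neg_cancel, mono_zero, mul_one, zero_mul] at h3
  exact Subtype.ext h3

end MonomialModules

/-- Theorem: divisorial ideals of torsion class are Cohen–Macaulay.
If the class of `a ∈ ℤ^s` is a torsion element of `Cl(R) = ℤ^s/σ(ℤ^r)`, i.e. `m•a ∈ σ(ℤ^r)`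
for some `m ≥ 1`, then the divisorial ideal `D(a) = K·T(a)` is a Cohen–Macaulay module over
`R = K[S]`. -/
theorem torsion_class_divisorial_isCM
    {r s : ℕ} (K : Type*) [Field K]
    (S : AddSubmonoid (Fin r → ℤ)) (σ : Fin s → Fin r → ℤ)
    (hSfg : S.FG)
    (hSpos : ∀ x ∈ S, -x ∈ S → x = 0)
    (hSgp : ∀ x : Fin r → ℤ, ∃ a ∈ S, ∃ b ∈ S, x = a - b)
    (hrep : ∀ x : Fin r → ℤ, x ∈ S ↔ ∀ i, 0 ≤ lin (σ i) x)
    (hirr : ∀ j, ∃ x : Fin r → ℤ, lin (σ j) x < 0 ∧ ∀ i, i ≠ j → 0 ≤ lin (σ i) x)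
    (hprim : ∀ i, Finset.univ.gcd (σ i) = 1)
    (a : Fin s → ℤ)
    (htor : ∃ m : ℕ, 0 < m ∧ ∃ x : Fin r → ℤ, m • a = formsHom σ x) :
    IsCohenMacaulayMod ↥(semigroupRing K S) (irrelevantIdeal K S)
      ↥(monIdeal K S (Tset σ a)) := by
  have hσ : ∀ x : Fin r → ℤ, (∀ i, lin (σ i) x = 0) → x = 0 := by
    intro x hx
    have hneg : ∀ i, lin (σ i) (-x) = 0 := by
      intro i
      have h1 := lin_add (σ i) x (-x)
      rw [add_neg_cancel, lin_zero, hx, zero_add] at h1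
      exact h1.symm
    exact hSpos x ((hrep x).2 fun i => (hx i).ge) ((hrep _).2 fun i => (hneg i).ge)
  obtain ⟨v₀, hv₀⟩ : ∃ v₀ : Fin r → ℤ, ∀ i, 0 < lin (σ i) v₀ := by
    have hex : ∀ j, ∃ b ∈ S, 0 < lin (σ j) b := by
      intro j
      obtain ⟨x, hx, -⟩ := hirr j
      obtain ⟨b, hb, c, hc, rfl⟩ := hSgp x
      have h1 := lin_add (σ j) (b - c) c
      rw [sub_add_cancel] at h1
      have := (hrep b).1 hb j
      exact ⟨c, hc, by omega⟩
    choose b hb hbpos using hex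
    refine ⟨∑ j, b j, fun i => ?_⟩
    have h1 : lin (σ i) (∑ j, b j) = ∑ j, lin (σ i) (b j) := by
      have := congrFun (map_sum (formsHom σ) b Finset.univ) i
      rwa [Finset.sum_apply] at this
    rw [h1]
    exact Finset.sum_pos' (fun j _ => (hrep _).1 (hb j) i) ⟨i, Finset.mem_univ i, hbpos i⟩
  obtain ⟨ι, _, v, color, hvne, hvpos, hsys⟩ := exists_triangularSystem_of_torsion σ hσ v₀ hv₀
  have hvS : ∀ I, v I ∈ S := fun I => (hrep _).2 (hvpos I)
  have hS0 : (S : Set (Fin r → ℤ)) = Tset σ 0 := Set.ext fun x => hrep x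
  have hadd : ∀ x ∈ S, ∀ y ∈ Tset σ a, x + y ∈ Tset σ a := by
    intro x hx y hy i
    rw [lin_add]
    have := (hrep x).1 hx i
    have := hy i
    omega
  let X : ι → ↥(semigroupRing K S) := fun I => ⟨mono K (v I), mono_mem_semigroupRing (hvS I)⟩
  let θ : Fin r → ↥(semigroupRing K S) := fun j => ∑ I with color I = j, X I
  have hX : ∀ I, X I ∈ irrelevantIdeal K S := fun I =>
    Ideal.subset_span ⟨v I, hvS I, hvne I, rfl⟩
  have hTne : (Tset σ a).Nonempty := Tset_nonempty σ a v₀ hv₀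
  obtain ⟨A⟩ := hsys a htor
  obtain ⟨e, he⟩ := exists_basis_monIdeal (K := K) S (Tset σ a) hadd
  obtain ⟨β, hβ⟩ := A.exists_basis (M := ↥(monIdeal K S (Tset σ a))) (fun t I => by
      rw [add_comm]; exact hadd _ (hvS I) _ t.2) e θ (fun j t => by
    rw [Finset.sum_smul]
    refine Finset.sum_congr rfl fun I _ => Subtype.ext ?_
    rw [he]
    change mono K (v I) * (e t : AddMonoidAlgebra K (Fin r → ℤ)) = _
    rw [he, mono_mul_mono]
    exact congrArg (mono K) (add_comm _ _))
  have hβθ : ∀ j b n, θ j • β (b, n) = β (b, n + Finsupp.single j 1) := by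
    intro j b n
    rw [hβ, hβ, smul_smul, add_comm n, monomialEval_add, monomialEval_single, pow_one]
  have hdim : ringKrullDim ↥(semigroupRing K S) = r := by
    have hA₀ : Nonempty (TriangularSystem (S : Set (Fin r → ℤ)) v color) := by
      rw [hS0]
      exact hsys 0 ⟨1, one_pos, 0, by simp⟩
    obtain ⟨A₀⟩ := hA₀
    obtain ⟨e₀, he₀⟩ := exists_basis_semigroupRing (K := K) S
    obtain ⟨β₀, hβ₀⟩ := A₀.exists_basis (fun t I => S.add_mem t.2 (hvS I)) e₀ θ (fun j t => by
      rw [Finset.sum_smul]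
      refine Finset.sum_congr rfl fun I _ => Subtype.ext ?_
      rw [he₀]
      change mono K (v I) * (e₀ t : AddMonoidAlgebra K (Fin r → ℤ)) = _
      rw [he₀, mono_mul_mono]
      exact congrArg (mono K) (add_comm _ _))
    have := A₀.base_finite.to_subtype
    have := A₀.base_nonempty.to_subtype
    refine ringKrullDim_eq_of_basis β₀ θ fun b n => ?_
    rw [hβ₀, hβ₀, monomialEval_zero, one_smul, smul_eq_mul]
  have := A.base_finite.to_subtype
  have := A.base_nonempty.to_subtype
  exact isCohenMacaulayMod_of_basis (M := ↥(monIdeal K S (Tset σ a))) β θ hβθ _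
    (fun j => Ideal.sum_mem _ fun I _ => hX I) hdim (annihilator_monIdeal S hTne)
end
end

section
/- Let K be a field and S a positive normal affine semigroup with gp(S) = ℤ^r, support forms σ_1,…,σ_s and R = K[S]. For every β ∈ ℝ^r the set T = ℤ^r ∩ (β + C(S)) equals T(a) where a_i = ⌈σ_i(β)⌉ for i = 1,…,s; hence the R-module K·T is a (monomial) divisorial ideal, and it is a Cohen–Macaulay R-module. -/
set_option synthInstance.maxHeartbeats 1000000
set_option maxHeartbeats 1000000

open scoped BigOperators

noncomputable section

/-- The cone `C(S) ⊆ ℝ^r` generated by a set `Sset ⊆ ℤ^r`: all finite linear combinations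
of elements of `Sset` with nonnegative real coefficients. -/
def coneOf {r : ℕ} (Sset : Set (Fin r → ℤ)) : Set (Fin r → ℝ) :=
  {x | ∃ (t : Finset (Fin r → ℤ)) (c : (Fin r → ℤ) → ℝ),
    (↑t : Set (Fin r → ℤ)) ⊆ Sset ∧ (∀ v, 0 ≤ c v) ∧
    x = ∑ v ∈ t, c v • (fun k => (v k : ℝ))}

namespace ConicDivisorial

open AddMonoidAlgebra

section Supported

variable {k G : Type*} [CommRing k]

lemma single_mem_supported {A : Set G} {x : G} (hx : x ∈ A) (c : k) :
    single x c ∈ supported k k A := by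
  classical
  rw [mem_supported']
  intro m hm
  rw [coeff_single, Finsupp.single_apply, if_neg]
  rintro rfl
  exact hm hx

variable [AddCommGroup G]

lemma mul_mem_supported {A B C : Set G} (h : ∀ x ∈ A, ∀ y ∈ B, x + y ∈ C)
    {f g : AddMonoidAlgebra k G} (hf : f ∈ supported k k A) (hg : g ∈ supported k k B) :
    f * g ∈ supported k k C := by
  have : supported k k A * supported k k B ≤ supported k k C := by
    rw [supported_eq_span_single, supported_eq_span_single, supported_eq_span_single,
      Submodule.span_mul_span]
    refine Submodule.span_mono ?_
    rintro _ ⟨_, ⟨x, hx, rfl⟩, _, ⟨y, hy, rfl⟩, rfl⟩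
    exact ⟨x + y, h x hx y hy, by simp [single_mul_single]⟩
  exact this (Submodule.mul_mem_mul hf hg)

/-- The sum of the monomials with exponents in `V`. -/
def monomialSum (k : Type*) [CommRing k] {G : Type*} [AddCommGroup G] (V : Finset G) :
    AddMonoidAlgebra k G := ∑ u ∈ V, single u 1

lemma monomialSum_mem_supported {A : Set G} {V : Finset G} (hV : ∀ u ∈ V, u ∈ A) :
    monomialSum k V ∈ supported k k A :=
  Submodule.sum_mem _ fun u hu => single_mem_supported (hV u hu) 1

end Supported

section SemigroupRing

variable {r : ℕ} (K : Type*) [Field K] (S : AddSubmonoid (Fin r → ℤ))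

lemma mem_semigroupRing_iff {f : AddMonoidAlgebra K (Fin r → ℤ)} :
    f ∈ semigroupRing K S ↔ f ∈ supported K K (S : Set (Fin r → ℤ)) := by
  constructor
  · intro hf
    induction hf using Algebra.adjoin_induction with
    | mem x hx =>
      obtain ⟨y, hy, rfl⟩ := hx
      exact single_mem_supported hy 1
    | algebraMap c => exact single_mem_supported S.zero_mem c
    | add x y _ _ hx hy => exact Submodule.add_mem _ hx hy
    | mul x y _ _ hx hy =>
      exact mul_mem_supported (fun a ha b hb => S.add_mem ha hb) hx hy
  · intro hf
    have : supported K K (S : Set (Fin r → ℤ)) ≤ Subalgebra.toSubmodule (semigroupRing K S) := by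
      rw [supported_eq_span_single, Submodule.span_le]
      rintro _ ⟨x, hx, rfl⟩
      exact Algebra.subset_adjoin ⟨x, hx, rfl⟩
    exact this hf

lemma mem_monIdeal_iff {T : Set (Fin r → ℤ)} (hT : ∀ x ∈ S, ∀ y ∈ T, x + y ∈ T)
    {f : AddMonoidAlgebra K (Fin r → ℤ)} :
    f ∈ monIdeal K S T ↔ f ∈ supported K K T := by
  constructor
  · intro hf
    induction hf using Submodule.span_induction with
    | mem x hx =>
      obtain ⟨y, hy, rfl⟩ := hx
      exact single_mem_supported hy 1
    | zero => exact Submodule.zero_mem _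
    | add x y _ _ hx hy => exact Submodule.add_mem _ hx hy
    | smul a x _ hx =>
      exact mul_mem_supported hT ((mem_semigroupRing_iff K S).1 a.2) hx
  · intro hf
    have : supported K K T ≤ (monIdeal K S T).restrictScalars K := by
      rw [supported_eq_span_single, Submodule.span_le]
      rintro _ ⟨x, hx, rfl⟩
      exact Submodule.subset_span ⟨x, hx, rfl⟩
    exact this hf

end SemigroupRing

section Frobenius

variable {k G : Type*} [CommRing k] [AddCommGroup G]

/-- The ring endomorphism of the group algebra that multiplies all exponents by `n`. -/
def powMap (k G : Type*) [CommRing k] [AddCommGroup G] (n : ℕ) :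
    AddMonoidAlgebra k G →+* AddMonoidAlgebra k G :=
  mapDomainRingHom k (nsmulAddMonoidHom n)

lemma powMap_single (n : ℕ) (u : G) (c : k) :
    powMap k G n (single u c) = single (n • u) c := by
  simp [powMap]

lemma powMap_monomialSum (p e : ℕ) [Fact p.Prime] [CharP k p] (V : Finset G) :
    powMap k G (p ^ e) (monomialSum k V) = monomialSum k V ^ p ^ e := by
  have : ExpChar (AddMonoidAlgebra k G) p := by
    have : CharP (AddMonoidAlgebra k G) p :=
      charP_of_injective_ringHom (f := (singleZeroRingHom : k →+* AddMonoidAlgebra k G))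
        (fun a b h => by
          simpa using congrArg (fun f : AddMonoidAlgebra k G => f.coeff 0) h) p
    exact ExpChar.prime Fact.out
  rw [monomialSum, map_sum, sum_pow_char_pow]
  refine Finset.sum_congr rfl fun u _ => ?_
  rw [powMap_single, single_pow, one_pow]

lemma powMap_mem_supported {n : ℕ} {A B : Set G} (h : ∀ x ∈ A, n • x ∈ B)
    {f : AddMonoidAlgebra k G} (hf : f ∈ supported k k A) :
    powMap k G n f ∈ supported k k B := by
  rw [supported_eq_span_single] at hf
  induction hf using Submodule.span_induction with
  | mem x hx =>
    obtain ⟨y, hy, rfl⟩ := hx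
    simp only [powMap_single]
    exact single_mem_supported (h y hy) 1
  | zero => simp
  | add x y _ _ hx hy => rw [map_add]; exact Submodule.add_mem _ hx hy
  | smul a x _ hx =>
    have : powMap k G n (a • x) = a • powMap k G n x := by
      have h1 : a • x = single 0 a * x := by
        ext m; simp
      have h2 : a • powMap k G n x = single 0 a * powMap k G n x := by
        ext m; simp
      rw [h1, h2, map_mul, powMap_single, smul_zero]
    rw [this]
    exact Submodule.smul_mem _ _ hx

variable [IsAddTorsionFree G]

lemma nsmul_add_injective {n : ℕ} (hn : n ≠ 0) (w : G) :
    Function.Injective fun t : G => n • t + w := fun _ _ h =>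
  nsmul_right_injective hn (add_right_cancel h)

/-- The additive map sending the monomial with exponent `n • t + w` to the one with exponent `t`,
and all monomials with exponents not of this form to `0`. -/
def rootMap (k : Type*) [CommRing k] {n : ℕ} (hn : n ≠ 0) (w : G) :
    AddMonoidAlgebra k G →+ AddMonoidAlgebra k G :=
  comapDomainAddMonoidHom _ (nsmul_add_injective hn w)

lemma coeff_rootMap {n : ℕ} (hn : n ≠ 0) (w : G) (f : AddMonoidAlgebra k G) (t : G) :
    (rootMap k hn w f).coeff t = f.coeff (n • t + w) := rfl

lemma rootMap_powMap_mul {n : ℕ} (hn : n ≠ 0) (w : G) (g f : AddMonoidAlgebra k G) :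
    rootMap k hn w (powMap k G n g * f) = g * rootMap k hn w f := by
  induction g using AddMonoidAlgebra.induction_linear with
  | zero => simp
  | add g₁ g₂ h₁ h₂ => rw [map_add, add_mul, map_add, h₁, h₂, add_mul]
  | single u c =>
    ext t
    rw [powMap_single, coeff_rootMap, coeff_single_mul_apply, coeff_single_mul_apply,
      coeff_rootMap]
    congr 2
    rw [smul_add, smul_neg]
    abel

end Frobenius

section Grading

variable {k G : Type*} [CommRing k] [AddCommGroup G]

/-- The homogeneous component of degree `d` with respect to the grading induced by `deg`. -/
def degComp (k : Type*) [CommRing k] {G : Type*} [AddCommGroup G] (deg : G →+ ℤ) (d : ℤ) :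
    AddMonoidAlgebra k G →+ AddMonoidAlgebra k G where
  toFun f := ofCoeff (f.coeff.filter fun x => deg x = d)
  map_zero' := by ext; simp [Finsupp.filter_apply]
  map_add' f g := by ext; simp [Finsupp.filter_add]

lemma coeff_degComp (deg : G →+ ℤ) (d : ℤ) (f : AddMonoidAlgebra k G) (x : G) :
    (degComp k deg d f).coeff x = if deg x = d then f.coeff x else 0 := by
  simp [degComp, Finsupp.filter_apply]

lemma degComp_mem_supported {deg : G →+ ℤ} {d : ℤ} {A : Set G} {f : AddMonoidAlgebra k G}
    (hf : f ∈ supported k k A) : degComp k deg d f ∈ supported k k (A ∩ {x | deg x = d}) := by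
  rw [mem_supported'] at hf ⊢
  intro m hm
  rw [coeff_degComp]
  split_ifs with h
  · exact hf m fun hA => hm ⟨hA, h⟩
  · rfl

lemma degComp_of_mem {deg : G →+ ℤ} {d : ℤ} {f : AddMonoidAlgebra k G}
    (hf : f ∈ supported k k {x | deg x = d}) : degComp k deg d f = f := by
  rw [mem_supported'] at hf
  ext m
  rw [coeff_degComp]
  split_ifs with h
  · rfl
  · exact (hf m h).symm

lemma degComp_mul {deg : G →+ ℤ} {d e : ℤ} {f : AddMonoidAlgebra k G}
    (hf : f ∈ supported k k {x | deg x = e}) (g : AddMonoidAlgebra k G) :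
    degComp k deg d (f * g) = f * degComp k deg (d - e) g := by
  rw [supported_eq_span_single] at hf
  induction hf using Submodule.span_induction with
  | mem x hx =>
    obtain ⟨u, hu, rfl⟩ := hx
    ext t
    simp only [coeff_degComp, coeff_single_mul_apply, one_mul, map_add, map_neg]
    have hu' : deg u = e := hu
    have : deg t = d ↔ -deg u + deg t = d - e := by omega
    simp only [this]
  | zero => simp
  | add x y _ _ hx hy => rw [add_mul, map_add, hx, hy, add_mul]
  | smul a x _ hx =>
    have h1 : ∀ z : AddMonoidAlgebra k G, degComp k deg d (a • z) = a • degComp k deg d z := by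
      intro z; ext m; simp [coeff_degComp]
    rw [smul_mul_assoc, h1, hx, smul_mul_assoc]

lemma exists_degComp_ne {deg : G →+ ℤ} (N : AddSubgroup (AddMonoidAlgebra k G))
    {f : AddMonoidAlgebra k G} (hf : f ∉ N) : ∃ d, degComp k deg d f ∉ N := by
  classical
  by_contra! h
  apply hf
  have : f = ∑ d ∈ f.coeff.support.image deg, degComp k deg d f := by
    ext m
    rw [coeff_sum, Finsupp.finsetSum_apply]
    simp only [coeff_degComp]
    rw [Finset.sum_ite_eq]
    split_ifs with hm
    · rfl
    · by_contra hne
      exact hm (Finset.mem_image_of_mem _ (Finsupp.mem_support_iff.2 hne))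
  rw [this]
  exact AddSubgroup.sum_mem _ fun d _ => h d

end Grading

section Flats

variable {r : ℕ}

/-- The inclusion of the integral lattice in the rational vector space. -/
def toRat (r : ℕ) : (Fin r → ℤ) →+ (Fin r → ℚ) where
  toFun x i := (x i : ℚ)
  map_zero' := by ext; simp
  map_add' x y := by ext; simp

lemma toRat_injective (r : ℕ) : Function.Injective (toRat r) := fun x y h => by
  ext i
  have := congrFun h i
  simpa [toRat] using this

lemma exists_nsmul_add_mem_closure {F : Set (Fin r → ℤ)} {y : Fin r → ℚ}
    (hy : y ∈ Submodule.span ℚ (toRat r '' F)) :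
    ∃ k : ℕ, 0 < k ∧ ∃ a ∈ AddSubmonoid.closure F, ∃ b ∈ AddSubmonoid.closure F,
      k • y + toRat r b = toRat r a := by
  induction hy using Submodule.span_induction with
  | mem x hx =>
    obtain ⟨y, hy, rfl⟩ := hx
    exact ⟨1, one_pos, y, AddSubmonoid.subset_closure hy, 0, zero_mem _, by simp⟩
  | zero => exact ⟨1, one_pos, 0, zero_mem _, 0, zero_mem _, by simp⟩
  | add x y _ _ hx hy =>
    obtain ⟨k, hk, a, ha, b, hb, h⟩ := hx
    obtain ⟨l, hl, c, hc, d, hd, h'⟩ := hy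
    refine ⟨k * l, Nat.mul_pos hk hl, l • a + k • c, add_mem (nsmul_mem ha _) (nsmul_mem hc _),
      l • b + k • d, add_mem (nsmul_mem hb _) (nsmul_mem hd _), ?_⟩
    simp only [map_add, map_nsmul, ← h, ← h']
    module
  | smul q x _ hx =>
    obtain ⟨k, hk, a, ha, b, hb, h⟩ := hx
    refine ⟨k * q.den, Nat.mul_pos hk q.den_pos, ?_⟩
    have hq : (q.den : ℚ) * q = q.num := Rat.den_mul_eq_num q
    have key : (k * q.den) • q • x = (q.num : ℚ) • (k • x) := by
      rw [← hq]; module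
    obtain ⟨n, hn | hn⟩ := q.num.eq_nat_or_neg
    · refine ⟨n • a, nsmul_mem ha _, n • b, nsmul_mem hb _, ?_⟩
      rw [key, hn, map_nsmul, map_nsmul, ← h]
      push_cast
      module
    · refine ⟨n • b, nsmul_mem hb _, n • a, nsmul_mem ha _, ?_⟩
      rw [key, hn, map_nsmul, map_nsmul, ← h]
      push_cast
      module

/-- `F` contains every element of `Γ` some positive multiple of which is a difference of
elements of the monoid generated by `F`. -/
def IsFlat (Γ F : Finset (Fin r → ℤ)) : Prop :=
  F ⊆ Γ ∧ ∀ g ∈ Γ, ∀ k : ℕ, 0 < k → ∀ a ∈ AddSubmonoid.closure (F : Set (Fin r → ℤ)),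
    ∀ b ∈ AddSubmonoid.closure (F : Set (Fin r → ℤ)), k • g + b = a → g ∈ F

/-- The dimension of the rational span. -/
def spanRank (F : Finset (Fin r → ℤ)) : ℕ :=
  Module.finrank ℚ (Submodule.span ℚ (toRat r '' (F : Set (Fin r → ℤ))))

lemma IsFlat.eq_of_subset {Γ E F : Finset (Fin r → ℤ)} (hE : IsFlat Γ E) (hF : F ⊆ Γ)
    (hEF : E ⊆ F) (h : spanRank E = spanRank F) : E = F := by
  refine hEF.antisymm fun g hg => ?_
  have hspan := Submodule.eq_of_le_of_finrank_eq
    (Submodule.span_mono (R := ℚ) (Set.image_mono (f := toRat r) (Finset.coe_subset.2 hEF))) h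
  have hmem : toRat r g ∈ Submodule.span ℚ (toRat r '' (E : Set (Fin r → ℤ))) := by
    rw [hspan]
    exact Submodule.subset_span ⟨g, hg, rfl⟩
  obtain ⟨k, hk, a, ha, b, hb, hab⟩ := exists_nsmul_add_mem_closure hmem
  refine hE.2 g (hF hg) k hk a ha b hb (toRat_injective r ?_)
  rw [map_add, map_nsmul, hab]

lemma spanRank_le (F : Finset (Fin r → ℤ)) : spanRank F ≤ r := by
  simpa [spanRank] using Submodule.finrank_le (Submodule.span ℚ (toRat r '' (F : Set (Fin r → ℤ))))

lemma spanRank_pos {F : Finset (Fin r → ℤ)} (hF : ∃ g ∈ F, g ≠ 0) : 0 < spanRank F := by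
  obtain ⟨g, hg, h0⟩ := hF
  rw [spanRank, Module.finrank_pos_iff_exists_ne_zero]
  refine ⟨⟨toRat r g, Submodule.subset_span ⟨g, hg, rfl⟩⟩, fun h => h0 (toRat_injective r ?_)⟩
  simpa using congrArg Subtype.val h

/-- Finite sets of lattice points, homogeneous of positive degrees `e i`, whose monomial sums
form a system of parameters of the semigroup ring generated by `Γ`. -/
structure IsParamSystem (deg : (Fin r → ℤ) →+ ℤ) (Γ : Finset (Fin r → ℤ))
    (U : Fin r → Finset (Fin r → ℤ)) (e : Fin r → ℤ) : Prop where
  mem : ∀ i, ∀ u ∈ U i, u ∈ AddSubmonoid.closure (Γ : Set (Fin r → ℤ))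
  deg_eq : ∀ i, ∀ u ∈ U i, deg u = e i
  deg_pos : ∀ i, 0 < e i
  exists_dominant : ∀ F, IsFlat Γ F → F.Nonempty → ∃ j, ∃ u ∈ U j,
    u ∈ AddSubmonoid.closure (F : Set (Fin r → ℤ)) ∧ ∀ v ∈ U j, v ≠ u →
      ∃ g ∈ Γ, g ∉ F ∧ v - g ∈ AddSubmonoid.closure (Γ : Set (Fin r → ℤ))

theorem exists_isParamSystem (deg : (Fin r → ℤ) →+ ℤ) (Γ : Finset (Fin r → ℤ))
    (hΓ : ∀ g ∈ Γ, 0 < deg g) : ∃ U e, IsParamSystem deg Γ U e := by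
  classical
  let d : Finset (Fin r → ℤ) → ℕ := fun E => (deg (∑ g ∈ E, g)).toNat
  have hd : ∀ E ⊆ Γ, E.Nonempty → 0 < d E ∧ deg (∑ g ∈ E, g) = d E := by
    intro E hE hne
    have : 0 < deg (∑ g ∈ E, g) := by
      rw [map_sum]
      exact Finset.sum_pos (fun g hg => hΓ g (hE hg)) hne
    simp only [d]
    omega
  let 𝓔 := Γ.powerset.filter fun E => E.Nonempty ∧ IsFlat Γ E
  let c : ℕ := ∏ E ∈ 𝓔, d E
  have hmem : ∀ E ∈ 𝓔, E ⊆ Γ ∧ E.Nonempty ∧ IsFlat Γ E := by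
    intro E hE
    simpa [𝓔] using hE
  have hc : 0 < c := Finset.prod_pos fun E hE => (hd E (hmem E hE).1 (hmem E hE).2.1).1
  let m : Finset (Fin r → ℤ) → Fin r → ℤ := fun E => (c / d E) • ∑ g ∈ E, g
  have hcd : ∀ E ∈ 𝓔, d E ∣ c := fun E hE => Finset.dvd_prod_of_mem d hE
  have hcl : ∀ E : Finset (Fin r → ℤ), ∑ g ∈ E, g ∈ AddSubmonoid.closure (E : Set (Fin r → ℤ)) :=
    fun E => sum_mem fun g hg => AddSubmonoid.subset_closure hg
  refine ⟨fun j => (𝓔.filter fun E => spanRank E = j + 1).image m, fun _ => c, ?_, ?_, ?_, ?_⟩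
  · intro i u hu
    obtain ⟨E, hE, rfl⟩ := Finset.mem_image.1 hu
    have hE' := hmem E (Finset.mem_filter.1 hE).1
    exact nsmul_mem (AddSubmonoid.closure_mono (Finset.coe_subset.2 hE'.1) (hcl E)) _
  · intro i u hu
    obtain ⟨E, hE, rfl⟩ := Finset.mem_image.1 hu
    have hE1 := (Finset.mem_filter.1 hE).1
    have hE' := hmem E hE1
    simp only [m]
    rw [map_nsmul, (hd E hE'.1 hE'.2.1).2, nsmul_eq_mul]
    exact_mod_cast Nat.div_mul_cancel (hcd E hE1)
  · intro i
    exact_mod_cast hc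
  · intro F hF hne
    have hF𝓔 : F ∈ 𝓔 := by simp [𝓔, hF, hne, hF.1]
    have hpos : 0 < spanRank F := by
      obtain ⟨g, hg⟩ := hne
      refine spanRank_pos ⟨g, hg, ?_⟩
      rintro rfl
      simpa using hΓ 0 (hF.1 hg)
    have hle := spanRank_le F
    refine ⟨⟨spanRank F - 1, by omega⟩, m F, Finset.mem_image_of_mem _ ?_,
      nsmul_mem (hcl F) _, ?_⟩
    · refine Finset.mem_filter.2 ⟨hF𝓔, ?_⟩
      simp only
      omega
    · intro v hv hvF
      obtain ⟨E, hE, rfl⟩ := Finset.mem_image.1 hv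
      have hE1 := (Finset.mem_filter.1 hE).1
      have hE2 := (Finset.mem_filter.1 hE).2
      have hE' := hmem E hE1
      have hnot : ¬ E ⊆ F := by
        intro hEF
        apply hvF
        rw [hE'.2.2.eq_of_subset hF.1 hEF (by simp only at hE2; omega)]
      obtain ⟨g, hg, hgF⟩ := Finset.not_subset.1 hnot
      refine ⟨g, hE'.1 hg, hgF, ?_⟩
      have hq : 0 < c / d E := Nat.div_pos (Nat.le_of_dvd hc (hcd E hE1)) (hd E hE'.1 hE'.2.1).1
      obtain ⟨q, hq⟩ : ∃ q, c / d E = q + 1 := ⟨c / d E - 1, by omega⟩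
      have : m E - g = q • ∑ g ∈ E, g + ∑ h ∈ E.erase g, h := by
        simp only [m]
        rw [hq, ← Finset.add_sum_erase E (fun x => x) hg]
        module
      rw [this]
      have hEΓ := AddSubmonoid.closure_mono (Finset.coe_subset.2 hE'.1)
      refine add_mem (nsmul_mem (hEΓ (hcl E)) _) (hEΓ ?_)
      exact sum_mem fun h hh => AddSubmonoid.subset_closure (Finset.mem_of_mem_erase hh)

end Flats

section FiniteGeneration

variable {r : ℕ} (K : Type*) [Field K] (S : AddSubmonoid (Fin r → ℤ))

/-- An element of `K[S]` given by its support property. -/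
def toRing {f : AddMonoidAlgebra K (Fin r → ℤ)} (hf : f ∈ supported K K (S : Set (Fin r → ℤ))) :
    semigroupRing K S := ⟨f, (mem_semigroupRing_iff K S).2 hf⟩

/-- The monomials of `K[S]`, as a monoid homomorphism. -/
def monoHom : Multiplicative S →* semigroupRing K S where
  toFun x := toRing K S (single_mem_supported (x := ((x.toAdd : S) : Fin r → ℤ)) x.toAdd.2 1)
  map_one' := rfl
  map_mul' x y := Subtype.ext (by simp [toRing, single_mul_single])

/-- The monomial of `K[S]` with exponent `x`. -/
def monoR {x : Fin r → ℤ} (hx : x ∈ S) : semigroupRing K S :=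
  monoHom K S (Multiplicative.ofAdd ⟨x, hx⟩)

lemma coe_monoR {x : Fin r → ℤ} (hx : x ∈ S) :
    (monoR K S hx : AddMonoidAlgebra K (Fin r → ℤ)) = single x 1 := rfl

lemma monoR_add {x y : Fin r → ℤ} (hx : x ∈ S) (hy : y ∈ S) :
    monoR K S (S.add_mem hx hy) = monoR K S hx * monoR K S hy :=
  Subtype.ext (by simp [coe_monoR, single_mul_single])

variable {K S} {deg : (Fin r → ℤ) →+ ℤ} {Γ : Finset (Fin r → ℤ)}
  {U : Fin r → Finset (Fin r → ℤ)} {e : Fin r → ℤ}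

lemma IsParamSystem.mem_of_isPrime (h : IsParamSystem deg Γ U e)
    (hΓS : AddSubmonoid.closure (Γ : Set (Fin r → ℤ)) = S) (P : Ideal (semigroupRing K S))
    [hP : P.IsPrime]
    (hU : ∀ i, ∀ f : semigroupRing K S,
      (f : AddMonoidAlgebra K (Fin r → ℤ)) = monomialSum K (U i) → f ∈ P)
    {g : Fin r → ℤ} (hg : g ∈ Γ) (hgS : g ∈ S) : monoR K S hgS ∈ P := by
  classical
  have hΓS' : ∀ g ∈ Γ, g ∈ S := fun g hg => hΓS ▸ AddSubmonoid.subset_closure hg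
  let F := Γ.filter fun g => ∀ hg : g ∈ S, monoR K S hg ∉ P
  have hFS : ∀ x ∈ AddSubmonoid.closure (F : Set (Fin r → ℤ)), x ∈ S := fun x hx =>
    hΓS ▸ AddSubmonoid.closure_mono (Finset.coe_subset.2 (Finset.filter_subset _ _)) hx
  have hF : ∀ x ∈ AddSubmonoid.closure (F : Set (Fin r → ℤ)),
      ∀ hx : x ∈ S, monoR K S hx ∉ P := by
    intro x hx
    induction hx using AddSubmonoid.closure_induction with
    | mem x hx => exact (Finset.mem_filter.1 hx).2
    | zero =>
      intro h0 hmem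
      apply hP.ne_top
      rw [Ideal.eq_top_iff_one]
      exact hmem
    | add x y hx hy h1 h2 =>
      intro hxy
      have := monoR_add K S (hFS x hx) (hFS y hy)
      rw [this]
      intro hmem
      exact (hP.mem_or_mem hmem).elim (h1 _) (h2 _)
  by_contra hcon
  have hgF : g ∈ F := Finset.mem_filter.2 ⟨hg, fun _ => hcon⟩
  have hflat : IsFlat Γ F := by
    refine ⟨Finset.filter_subset _ _, fun x hx k hk a ha b hb hab => ?_⟩
    refine Finset.mem_filter.2 ⟨hx, fun hxS hmem => ?_⟩
    obtain ⟨l, rfl⟩ : ∃ l, k = l + 1 := ⟨k - 1, by omega⟩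
    subst hab
    refine hF _ ha (hFS _ ha) ?_
    have : monoR K S (hFS _ ha) =
        monoR K S hxS * monoR K S (S.add_mem (S.nsmul_mem hxS l) (hFS b hb)) := by
      rw [← monoR_add]
      apply Subtype.ext
      simp only [coe_monoR]
      congr 1
      module
    rw [this]
    exact P.mul_mem_right _ hmem
  obtain ⟨j, u, hu, huF, hdom⟩ := h.exists_dominant F hflat ⟨g, hgF⟩
  have hUS : ∀ v ∈ U j, v ∈ S := fun v hv => hΓS ▸ h.mem j v hv
  let θ : semigroupRing K S := ∑ v ∈ (U j).attach, monoR K S (hUS v v.2)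
  have hθ : (θ : AddMonoidAlgebra K (Fin r → ℤ)) = monomialSum K (U j) := by
    rw [monomialSum, ← Finset.sum_attach]
    simp [θ, coe_monoR]
  have hθP : θ ∈ P := hU j θ hθ
  have hsplit : θ = monoR K S (hUS u hu) +
      ∑ v ∈ (U j).attach.erase ⟨u, hu⟩, monoR K S (hUS v v.2) := by
    exact (Finset.add_sum_erase _ (fun v : {x // x ∈ U j} => monoR K S (hUS v v.2))
      (Finset.mem_attach _ ⟨u, hu⟩)).symm
  refine hF u huF (hUS u hu) ?_
  rw [← (P.add_mem_iff_left (a := monoR K S (hUS u hu)) (Ideal.sum_mem P ?_)), ← hsplit]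
  · exact hθP
  · intro v hv
    have hne : (v : Fin r → ℤ) ≠ u := fun h => Finset.ne_of_mem_erase hv (Subtype.ext h)
    obtain ⟨x, hx, hxF, hvx⟩ := hdom v v.2 hne
    have hxS := hΓS' x hx
    have hvxS : (v : Fin r → ℤ) - x ∈ S := hΓS ▸ hvx
    have : monoR K S (hUS v v.2) = monoR K S hxS * monoR K S hvxS := by
      rw [← monoR_add]
      apply Subtype.ext
      simp only [coe_monoR]
      congr 1
      abel
    rw [this]
    refine P.mul_mem_right _ ?_
    by_contra hnot
    exact hxF (Finset.mem_filter.2 ⟨hx, fun _ => hnot⟩)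

/-- A parameter of `K[S]`. -/
def paramR (K : Type*) [Field K] {r : ℕ} (S : AddSubmonoid (Fin r → ℤ))
    {V : Finset (Fin r → ℤ)} (hV : ∀ u ∈ V, u ∈ S) : semigroupRing K S :=
  toRing K S (monomialSum_mem_supported hV)

lemma coe_paramR {V : Finset (Fin r → ℤ)} (hV : ∀ u ∈ V, u ∈ S) :
    (paramR K S hV : AddMonoidAlgebra K (Fin r → ℤ)) = monomialSum K V := rfl

lemma IsParamSystem.exists_pow_mem (h : IsParamSystem deg Γ U e)
    (hΓS : AddSubmonoid.closure (Γ : Set (Fin r → ℤ)) = S) (hUS : ∀ i, ∀ u ∈ U i, u ∈ S)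
    {g : Fin r → ℤ} (hg : g ∈ Γ) (hgS : g ∈ S) :
    ∃ n : ℕ, monoR K S hgS ^ n ∈ Ideal.span (Set.range fun i => paramR K S (hUS i)) := by
  change monoR K S hgS ∈ (Ideal.span (Set.range fun i => paramR K S (hUS i))).radical
  rw [Ideal.radical_eq_sInf, Submodule.mem_sInf]
  rintro P ⟨hle, hP⟩
  refine h.mem_of_isPrime hΓS P ?_ hg hgS
  exact fun i f hf => hle (Ideal.subset_span ⟨i, Subtype.ext hf.symm⟩)

end FiniteGeneration

section GradedNakayama

variable {r : ℕ} {K : Type*} [Field K] {S : AddSubmonoid (Fin r → ℤ)}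
  {deg : (Fin r → ℤ) →+ ℤ} {Γ : Finset (Fin r → ℤ)}
  {U : Fin r → Finset (Fin r → ℤ)} {e : Fin r → ℤ}

/-- The subalgebra generated by a family of monomial sums. -/
abbrev paramAlg (K : Type*) [Field K] {r : ℕ} (U : Fin r → Finset (Fin r → ℤ)) :
    Subalgebra K (AddMonoidAlgebra K (Fin r → ℤ)) :=
  Algebra.adjoin K (Set.range fun i => monomialSum K (U i))

lemma supported_le_span_of_forall {A : Set (Fin r → ℤ)}
    {W : Submodule (paramAlg K U) (AddMonoidAlgebra K (Fin r → ℤ))}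
    (h : ∀ x ∈ A, single x 1 ∈ W) {f : AddMonoidAlgebra K (Fin r → ℤ)}
    (hf : f ∈ supported K K A) : f ∈ W := by
  have : supported K K A ≤ W.restrictScalars K := by
    rw [supported_eq_span_single, Submodule.span_le]
    rintro _ ⟨x, hx, rfl⟩
    exact h x hx
  exact this hf

theorem IsParamSystem.exists_finite_span (h : IsParamSystem deg Γ U e)
    (hΓS : AddSubmonoid.closure (Γ : Set (Fin r → ℤ)) = S)
    (hdeg : ∀ x ∈ S, 0 ≤ deg x) :
    ∃ B : Finset (Fin r → ℤ), (∀ b ∈ B, b ∈ S) ∧ ∀ f ∈ supported K K (S : Set (Fin r → ℤ)),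
      f ∈ Submodule.span (paramAlg K U) ((fun b => single b (1 : K)) '' (B : Set (Fin r → ℤ))) := by
  classical
  have hΓS' : ∀ g ∈ Γ, g ∈ S := fun g hg => hΓS ▸ AddSubmonoid.subset_closure hg
  have hUS : ∀ i, ∀ u ∈ U i, u ∈ S := fun i u hu => hΓS ▸ h.mem i u hu
  choose N hN using fun g : Γ => h.exists_pow_mem (K := K) hΓS hUS g.2 (hΓS' g g.2)
  let B : Finset (Fin r → ℤ) :=
    (Fintype.piFinset fun g : Γ => Finset.range (N g)).image fun a => ∑ g : Γ, a g • g.1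
  have hBS : ∀ b ∈ B, b ∈ S := by
    intro b hb
    obtain ⟨a, -, rfl⟩ := Finset.mem_image.1 hb
    exact sum_mem fun g _ => nsmul_mem (hΓS' g g.2) _
  refine ⟨B, hBS, fun f hf => supported_le_span_of_forall ?_ hf⟩
  set W := Submodule.span (paramAlg K U) ((fun b => single b (1 : K)) '' (B : Set (Fin r → ℤ)))
  suffices H : ∀ n : ℕ, ∀ x ∈ S, (deg x).toNat = n → single x (1 : K) ∈ W from
    fun x hx => H _ x hx rfl
  intro n
  induction n using Nat.strong_induction_on with
  | _ n ih =>
  intro x hx hxn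
  rw [← hΓS] at hx
  obtain ⟨a, ha⟩ := AddSubmonoid.mem_closure_finset'.1 hx
  by_cases hall : ∀ g, a g < N g
  · exact Submodule.subset_span ⟨x, Finset.mem_image.2 ⟨a, by simpa using hall, ha.symm⟩, rfl⟩
  push Not at hall
  obtain ⟨g, hg⟩ := hall
  have hx' : x - N g • g.1 ∈ S := by
    have : x - N g • g.1 = (a g - N g) • g.1 + ∑ i ∈ Finset.univ.erase g, a i • i.1 := by
      rw [ha, ← Finset.add_sum_erase _ _ (Finset.mem_univ g)]
      obtain ⟨c, hc⟩ := Nat.exists_eq_add_of_le hg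
      rw [hc, Nat.add_sub_cancel_left]
      module
    rw [this]
    exact add_mem (nsmul_mem (hΓS' g g.2) _) (sum_mem fun i _ => nsmul_mem (hΓS' i i.2) _)
  obtain ⟨c, hc⟩ := Submodule.mem_span_range_iff_exists_fun _ |>.1 (hN g)
  have hc' := congrArg Subtype.val hc
  simp only [AddSubmonoidClass.coe_finsetSum, smul_eq_mul, MulMemClass.coe_mul, coe_paramR,
    SubmonoidClass.coe_pow, coe_monoR, single_pow, one_pow] at hc'
  have hkey : single x (1 : K) = ∑ i, monomialSum K (U i) *
      ((c i : AddMonoidAlgebra K (Fin r → ℤ)) * single (x - N g • g.1) 1) := by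
    calc single x (1 : K) = single (N g • g.1) 1 * single (x - N g • g.1) 1 := by
          rw [single_mul_single, one_mul, add_sub_cancel]
      _ = _ := by
          rw [← hc', Finset.sum_mul]
          exact Finset.sum_congr rfl fun i _ => by ring
  have hdegc : single x (1 : K) = degComp K deg (deg x) (single x 1) :=
    
    (degComp_of_mem (single_mem_supported (A := {y | deg y = deg x}) rfl (1 : K))).symm
  rw [hdegc, hkey, map_sum]
  refine Submodule.sum_mem _ fun i _ => ?_
  rw [degComp_mul (e := e i) (monomialSum_mem_supported fun u hu => h.deg_eq i u hu)]
  refine W.smul_mem (⟨_, Algebra.subset_adjoin ⟨i, rfl⟩⟩ : paramAlg K U) ?_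
  refine supported_le_span_of_forall (A := (S : Set (Fin r → ℤ)) ∩ {y | deg y = deg x - e i}) ?_
    (degComp_mem_supported (mul_mem_supported (fun a ha b hb => S.add_mem ha hb)
      ((mem_semigroupRing_iff K S).1 (c i).2) (single_mem_supported hx' 1)))
  rintro y ⟨hy, hyd⟩
  have hyd' : deg y = deg x - e i := hyd
  have h1 := h.deg_pos i
  have h2 := hdeg y hy
  exact ih (deg y).toNat (by omega) y hy rfl

end GradedNakayama

section KrullDimension

variable {R S : Type*} [CommRing R] [CommRing S] [Algebra R S]

theorem ringKrullDim_eq_of_isIntegral [Algebra.IsIntegral R S]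
    (hinj : Function.Injective (algebraMap R S)) : ringKrullDim S = ringKrullDim R := by
  apply le_antisymm
  · exact Order.krullDim_le_of_strictMono (PrimeSpectrum.comap (algebraMap R S))
      fun I J h => Ideal.IsIntegral.comap_lt_comap h
  · refine iSup_le fun l => ?_
    obtain ⟨Q, -, hQ, hQl⟩ := Ideal.exists_ideal_over_prime_of_isIntegral l.head.asIdeal
      (⊥ : Ideal S) (by rw [← RingHom.ker_eq_comap_bot, (RingHom.injective_iff_ker_eq_bot _).1 hinj]
                        exact bot_le)
    have : Q.LiesOver l.head.asIdeal := ⟨hQl.symm⟩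
    obtain ⟨L, hL, -⟩ := Ideal.exists_ltSeries_of_hasGoingUp l Q
    exact le_iSup_of_le L (by rw [hL])

end KrullDimension

section AlgebraicIndependence

theorem algebraicIndependent_single {ι G : Type*} [Finite ι] [AddCommGroup G] (K : Type*)
    [Field K] (x : ι → G)
    (hx : Function.Injective fun n : ι →₀ ℕ => n.sum fun i m => m • x i) :
    AlgebraicIndependent K fun i => single (x i) (1 : K) := by
  classical
  have := Fintype.ofFinite ι
  rw [algebraicIndependent_iff]
  intro p hp
  ext m
  rw [MvPolynomial.aeval_def, MvPolynomial.eval₂_eq'] at hp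
  have h1 : ∀ d : ι →₀ ℕ, algebraMap K (AddMonoidAlgebra K G) (p.coeff d) *
      ∏ i, single (x i) (1 : K) ^ d i = single (d.sum fun i m => m • x i) (p.coeff d) := by
    intro d
    have : ∏ i, single (x i) (1 : K) ^ d i = single (d.sum fun i m => m • x i) 1 := by
      rw [Finsupp.sum_fintype _ (fun i m => m • x i) (fun i => zero_nsmul (x i))]
      simp only [single_pow, one_pow]
      induction (Finset.univ : Finset ι) using Finset.induction_on with
      | empty => rfl
      | insert a s ha ih => rw [Finset.prod_insert ha, ih, single_mul_single,
          Finset.sum_insert ha, one_mul]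
    rw [this, Algebra.algebraMap_eq_smul_one, smul_mul_assoc, one_mul, smul_single,
      smul_eq_mul, mul_one]
  simp only [h1] at hp
  have h2 := congrArg (fun f : AddMonoidAlgebra K G => f.coeff (m.sum fun i n => n • x i)) hp
  simp only [coeff_sum, Finsupp.finsetSum_apply, coeff_single, Finsupp.single_apply, coeff_zero,
    Finsupp.zero_apply] at h2
  rw [MvPolynomial.coeff_zero]
  rw [Finset.sum_congr rfl (g := fun d => if d = m then p.coeff d else 0)
    (fun d _ => by simp only [hx.eq_iff])] at h2
  rw [Finset.sum_ite_eq'] at h2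
  by_contra hne
  rw [if_pos (MvPolynomial.mem_support_iff.2 hne)] at h2
  exact hne h2

variable {r : ℕ} {K : Type*} [Field K] {S : AddSubmonoid (Fin r → ℤ)}

lemma span_toRat_eq_top (hSgp : ∀ x : Fin r → ℤ, ∃ a ∈ S, ∃ b ∈ S, x = a - b) :
    Submodule.span ℚ (toRat r '' (S : Set (Fin r → ℤ))) = ⊤ := by
  classical
  rw [eq_top_iff, ← (Pi.basisFun ℚ (Fin r)).span_eq, Submodule.span_le]
  rintro _ ⟨i, rfl⟩
  obtain ⟨a, ha, b, hb, hab⟩ := hSgp (Pi.single i 1)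
  have : Pi.basisFun ℚ (Fin r) i = toRat r a - toRat r b := by
    rw [← map_sub, ← hab]
    ext j
    simp [toRat, Pi.single_apply]
  rw [this]
  exact Submodule.sub_mem _ (Submodule.subset_span ⟨a, ha, rfl⟩)
    (Submodule.subset_span ⟨b, hb, rfl⟩)

lemma exists_linearIndependent_mem (hSgp : ∀ x : Fin r → ℤ, ∃ a ∈ S, ∃ b ∈ S, x = a - b) :
    ∃ x : Fin r → Fin r → ℤ, (∀ i, x i ∈ S) ∧ LinearIndependent ℚ fun i => toRat r (x i) := by
  have hrank : Module.finrank ℚ (Submodule.span ℚ (toRat r '' (S : Set (Fin r → ℤ)))) = r := by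
    rw [span_toRat_eq_top hSgp, finrank_top]
    simp
  obtain ⟨f, hf, -, hlin⟩ :=
    Submodule.exists_fun_fin_finrank_span_eq ℚ (toRat r '' (S : Set (Fin r → ℤ)))
  choose x hx hxf using hf
  refine ⟨fun i => x (Fin.cast hrank.symm i), fun i => hx _, ?_⟩
  simp only [hxf]
  exact hlin.comp _ (Fin.cast_injective _)

lemma le_trdeg_semigroupRing (hSgp : ∀ x : Fin r → ℤ, ∃ a ∈ S, ∃ b ∈ S, x = a - b) :
    Cardinal.lift (Cardinal.mk (Fin r)) ≤ Cardinal.lift.{0} (Algebra.trdeg K (semigroupRing K S)) := by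
  obtain ⟨x, hxS, hx⟩ := exists_linearIndependent_mem hSgp
  have hinj : Function.Injective fun n : Fin r →₀ ℕ => n.sum fun i m => m • x i := by
    intro n m hnm
    have h1 : ∀ n : Fin r →₀ ℕ, toRat r (n.sum fun i m => m • x i) =
        ∑ i, (n i : ℚ) • toRat r (x i) := by
      intro n
      rw [Finsupp.sum_fintype _ (fun i m => m • x i) (fun i => zero_nsmul (x i)), map_sum]
      exact Finset.sum_congr rfl fun i _ => by rw [map_nsmul, Nat.cast_smul_eq_nsmul]
    have h2 := congrArg (toRat r) hnm
    simp only [h1] at h2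
    have h3 := Fintype.linearIndependent_iff.1 hx (fun i => (n i : ℚ) - m i) (by
      simp only [sub_smul, Finset.sum_sub_distrib, h2, sub_self])
    ext i
    exact_mod_cast sub_eq_zero.1 (h3 i)
  have h := algebraicIndependent_single K x hinj
  have h' : AlgebraicIndependent K fun i => monoR K S (hxS i) :=
    AlgebraicIndependent.of_comp (semigroupRing K S).val h
  exact h'.lift_cardinalMk_le_trdeg

end AlgebraicIndependence

section Parameters

variable {r : ℕ} {K : Type*} [Field K] {S : AddSubmonoid (Fin r → ℤ)}
  {deg : (Fin r → ℤ) →+ ℤ} {Γ : Finset (Fin r → ℤ)}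
  {U : Fin r → Finset (Fin r → ℤ)} {e : Fin r → ℤ}

lemma exists_mem_adjoin_paramR (hUS : ∀ i, ∀ u ∈ U i, u ∈ S)
    {f : AddMonoidAlgebra K (Fin r → ℤ)} (hf : f ∈ paramAlg K U) :
    ∃ f' ∈ Algebra.adjoin K (Set.range fun i => paramR K S (hUS i)),
      (f' : AddMonoidAlgebra K (Fin r → ℤ)) = f := by
  have : paramAlg K U = (Algebra.adjoin K (Set.range fun i => paramR K S (hUS i))).map
      (semigroupRing K S).val := by
    rw [AlgHom.map_adjoin, ← Set.range_comp]
    rfl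
  rw [this] at hf
  exact hf

theorem IsParamSystem.finite (h : IsParamSystem deg Γ U e)
    (hΓS : AddSubmonoid.closure (Γ : Set (Fin r → ℤ)) = S)
    (hdeg : ∀ x ∈ S, 0 ≤ deg x) (hUS : ∀ i, ∀ u ∈ U i, u ∈ S) :
    Module.Finite (Algebra.adjoin K (Set.range fun i => paramR K S (hUS i)))
      (semigroupRing K S) := by
  classical
  obtain ⟨B, hBS, hB⟩ := h.exists_finite_span (K := K) hΓS hdeg
  let B' : Finset (semigroupRing K S) :=
    B.attach.image fun b : {b // b ∈ B} => monoR K S (hBS b b.2)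
  refine ⟨B', ?_⟩
  rw [eq_top_iff]
  rintro f -
  have hf := hB f ((mem_semigroupRing_iff K S).1 f.2)
  suffices H : ∀ g ∈ Submodule.span (paramAlg K U)
      ((fun b => single b (1 : K)) '' (B : Set (Fin r → ℤ))), ∃ g' : semigroupRing K S,
      (g' : AddMonoidAlgebra K (Fin r → ℤ)) = g ∧ g' ∈ Submodule.span
        (Algebra.adjoin K (Set.range fun i => paramR K S (hUS i))) (B' : Set (semigroupRing K S)) by
    obtain ⟨g', hg', hmem⟩ := H f hf
    rwa [← Subtype.ext hg']
  intro g hg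
  induction hg using Submodule.span_induction with
  | mem x hx =>
    obtain ⟨b, hb, rfl⟩ := hx
    refine ⟨monoR K S (hBS b hb), rfl, Submodule.subset_span ?_⟩
    exact Finset.mem_image.2 ⟨⟨b, hb⟩, Finset.mem_attach _ _, rfl⟩
  | zero => exact ⟨0, rfl, zero_mem _⟩
  | add x y _ _ hx hy =>
    obtain ⟨x', hx', hx''⟩ := hx
    obtain ⟨y', hy', hy''⟩ := hy
    exact ⟨x' + y', by simp [hx', hy'], add_mem hx'' hy''⟩
  | smul a x _ hx =>
    obtain ⟨x', hx', hx''⟩ := hx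
    obtain ⟨a', ha', haa⟩ := exists_mem_adjoin_paramR hUS a.2
    refine ⟨a' * x', ?_, Submodule.smul_mem _ (⟨a', ha'⟩ :
      Algebra.adjoin K (Set.range fun i => paramR K S (hUS i))) hx''⟩
    rw [MulMemClass.coe_mul, haa, hx']
    rfl

theorem IsParamSystem.algebraicIndependent_paramR (h : IsParamSystem deg Γ U e)
    (hΓS : AddSubmonoid.closure (Γ : Set (Fin r → ℤ)) = S)
    (hdeg : ∀ x ∈ S, 0 ≤ deg x) (hUS : ∀ i, ∀ u ∈ U i, u ∈ S)
    (hSgp : ∀ x : Fin r → ℤ, ∃ a ∈ S, ∃ b ∈ S, x = a - b) :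
    AlgebraicIndependent K fun i => paramR K S (hUS i) := by
  have := h.finite (K := K) hΓS hdeg hUS
  have : Algebra.IsAlgebraic (Algebra.adjoin K (Set.range fun i => paramR K S (hUS i)))
    (semigroupRing K S) := inferInstance
  exact (Algebra.IsAlgebraic.isTranscendenceBasis_of_lift_le_trdeg_of_finite K
    (fun i => paramR K S (hUS i)) (le_trdeg_semigroupRing hSgp)).1

theorem IsParamSystem.algebraicIndependent (h : IsParamSystem deg Γ U e)
    (hΓS : AddSubmonoid.closure (Γ : Set (Fin r → ℤ)) = S)
    (hdeg : ∀ x ∈ S, 0 ≤ deg x)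
    (hSgp : ∀ x : Fin r → ℤ, ∃ a ∈ S, ∃ b ∈ S, x = a - b) :
    AlgebraicIndependent K fun i => monomialSum K (U i) :=
  (h.algebraicIndependent_paramR hΓS hdeg (fun i u hu => hΓS ▸ h.mem i u hu) hSgp).map'
    (f := (semigroupRing K S).val) Subtype.val_injective

theorem IsParamSystem.ringKrullDim_semigroupRing (h : IsParamSystem deg Γ U e)
    (hΓS : AddSubmonoid.closure (Γ : Set (Fin r → ℤ)) = S)
    (hdeg : ∀ x ∈ S, 0 ≤ deg x) (hUS : ∀ i, ∀ u ∈ U i, u ∈ S)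
    (hSgp : ∀ x : Fin r → ℤ, ∃ a ∈ S, ∃ b ∈ S, x = a - b) :
    ringKrullDim (semigroupRing K S) = r := by
  have := h.finite (K := K) hΓS hdeg hUS
  rw [ringKrullDim_eq_of_isIntegral
    (R := Algebra.adjoin K (Set.range fun i => paramR K S (hUS i))) Subtype.val_injective,
    ← ringKrullDim_eq_of_ringEquiv
      (h.algebraicIndependent_paramR hΓS hdeg hUS hSgp).aevalEquiv.toRingEquiv,
    MvPolynomial.ringKrullDim_of_isNoetherianRing]
  simp

end Parameters

section PowerRegular

/-- For every exponent `n`, the powers `θ i ^ n` form a weakly regular sequence. -/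
def IsPowerRegular {r : ℕ} {A : Type*} [CommRing A] (θ : Fin r → A) : Prop :=
  ∀ (n : ℕ) (j : Fin r) (a : A) (b : Fin r → A),
    a * θ j ^ n = ∑ i ∈ Finset.Iio j, b i * θ i ^ n →
    ∃ c : Fin r → A, a = ∑ i ∈ Finset.Iio j, c i * θ i ^ n

lemma isPowerRegular_X (r : ℕ) (K : Type*) [Field K] :
    IsPowerRegular fun i : Fin r => (MvPolynomial.X i : MvPolynomial (Fin r) K) := by
  classical
  intro n j a b hab
  let s : Set (Fin r →₀ ℕ) := (fun i => Finsupp.single i n) '' (Finset.Iio j : Set (Fin r))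
  have hI : Ideal.span ((fun t => MvPolynomial.monomial t (1 : K)) '' s) =
      Ideal.span ((fun i : Fin r => (MvPolynomial.X i : MvPolynomial (Fin r) K) ^ n) ''
        (Finset.Iio j : Set (Fin r))) := by
    rw [Set.image_image]
    simp only [MvPolynomial.X_pow_eq_monomial]
  have hmem : a * MvPolynomial.X j ^ n ∈
      Ideal.span ((fun t => MvPolynomial.monomial t (1 : K)) '' s) := by
    rw [hab, hI]
    exact sum_mem fun i hi => Ideal.mul_mem_left _ _ (Ideal.subset_span ⟨i, hi, rfl⟩)
  have ha : a ∈ Ideal.span ((fun t => MvPolynomial.monomial t (1 : K)) '' s) := by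
    rw [MvPolynomial.mem_ideal_span_monomial_image] at hmem ⊢
    intro m hm
    obtain ⟨_, ⟨i, hi, rfl⟩, hle⟩ := hmem (m + Finsupp.single j n) (by
      rw [MvPolynomial.mem_support_iff, MvPolynomial.X_pow_eq_monomial,
        MvPolynomial.coeff_mul_monomial, mul_one]
      exact MvPolynomial.mem_support_iff.1 hm)
    refine ⟨_, ⟨i, hi, rfl⟩, ?_⟩
    rw [Finsupp.single_le_iff] at hle ⊢
    have hij : j ≠ i := fun h => by simp [h] at hi
    simpa [Finsupp.single_apply, hij] using hle
  rw [hI, Ideal.span, Submodule.mem_span_image_finset_iff_exists_fun'] at ha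
  obtain ⟨c, hc⟩ := ha
  exact ⟨c, hc.symm⟩

lemma IsPowerRegular.map {r : ℕ} {A B : Type*} [CommRing A] [CommRing B] {θ : Fin r → A}
    (h : IsPowerRegular θ) (f : A ≃+* B) : IsPowerRegular fun i => f (θ i) := by
  intro n j a b hab
  obtain ⟨c, hc⟩ := h n j (f.symm a) (fun i => f.symm (b i)) (by
    apply f.injective
    simpa using hab)
  refine ⟨fun i => f (c i), ?_⟩
  simpa using congrArg f hc

lemma IsPowerRegular.exists_of_linearIndependent {r : ℕ} {A M ι : Type*} [CommRing A]
    [AddCommGroup M] [Module A M] {θ : Fin r → A} (h : IsPowerRegular θ) {v : ι → M}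
    (hv : LinearIndependent A v) (n : ℕ) (j : Fin r) {f : M}
    (hf : f ∈ Submodule.span A (Set.range v)) {g : Fin r → M}
    (hg : ∀ i, g i ∈ Submodule.span A (Set.range v))
    (hfg : θ j ^ n • f = ∑ i ∈ Finset.Iio j, θ i ^ n • g i) :
    ∃ q : Fin r → M, (∀ i, q i ∈ Submodule.span A (Set.range v)) ∧
      f = ∑ i ∈ Finset.Iio j, θ i ^ n • q i := by
  classical
  let b := Module.Basis.span hv
  let f' : Submodule.span A (Set.range v) := ⟨f, hf⟩
  have hfg' : θ j ^ n • f' = ∑ i ∈ Finset.Iio j,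
      θ i ^ n • (⟨g i, hg i⟩ : Submodule.span A (Set.range v)) := by
    apply Subtype.ext
    simpa [f'] using hfg
  have hcoord : ∀ k, ∃ c : Fin r → A, b.repr f' k = ∑ i ∈ Finset.Iio j, c i * θ i ^ n := by
    intro k
    apply h n j _ (fun i => b.repr ⟨g i, hg i⟩ k)
    have := congrArg (fun z => b.repr z k) hfg'
    simp only [map_smul, map_sum, Finsupp.smul_apply, Finsupp.finsetSum_apply,
      smul_eq_mul] at this
    rw [mul_comm, this]
    exact Finset.sum_congr rfl fun i _ => mul_comm _ _
  choose c hc using hcoord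
  refine ⟨fun i => (∑ k ∈ (b.repr f').support, c k i • b k : Submodule.span A (Set.range v)),
    fun i => Subtype.property _, ?_⟩
  have key : f' = ∑ i ∈ Finset.Iio j, θ i ^ n • ∑ k ∈ (b.repr f').support, c k i • b k := by
    conv_lhs => rw [← b.linearCombination_repr f', Finsupp.linearCombination_apply, Finsupp.sum]
    simp only [hc, Finset.smul_sum, Finset.sum_smul]
    rw [Finset.sum_comm]
    refine Finset.sum_congr rfl fun i _ => Finset.sum_congr rfl fun k _ => ?_
    rw [smul_smul, mul_comm]
  have := congrArg Subtype.val key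
  simpa [f'] using this

/-- A finite family can be replaced by a linearly independent subfamily, up to multiplication by
a nonzero scalar. -/
lemma exists_smul_mem_span_linearIndependent {A M ι : Type*} [CommRing A] [IsDomain A]
    [AddCommGroup M] [Module A M] [Finite ι] (v : ι → M) :
    ∃ (s : Set ι) (c : A), c ≠ 0 ∧ LinearIndependent A (fun i : s => v i) ∧
      ∀ f ∈ Submodule.span A (Set.range v), c • f ∈ Submodule.span A (v '' s) := by
  classical
  have := Fintype.ofFinite ι
  obtain ⟨s, hs, hmax⟩ := exists_maximal_linearIndepOn A v
  have : ∀ i, ∃ a : A, a ≠ 0 ∧ a • v i ∈ Submodule.span A (v '' s) := by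
    intro i
    by_cases hi : i ∈ s
    · exact ⟨1, one_ne_zero, by rw [one_smul]; exact Submodule.subset_span ⟨i, hi, rfl⟩⟩
    · exact hmax i hi
  choose a ha ha' using this
  refine ⟨s, ∏ i, a i, Finset.prod_ne_zero_iff.2 fun i _ => ha i, hs, fun f hf => ?_⟩
  induction hf using Submodule.span_induction with
  | mem x hx =>
    obtain ⟨i, rfl⟩ := hx
    rw [← Finset.prod_erase_mul _ _ (Finset.mem_univ i), mul_smul]
    exact Submodule.smul_mem _ _ (ha' i)
  | zero => simp
  | add x y _ _ hx hy => rw [smul_add]; exact add_mem hx hy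
  | smul b x _ hx => rw [smul_comm]; exact Submodule.smul_mem _ _ hx

end PowerRegular

section Frobenius

variable {r : ℕ}

/-- The colon condition saying that the `monomialSum k (U i)` form a weakly regular sequence on the
module spanned by the monomials with exponents in `T`. -/
def ColonProp (k : Type*) [CommRing k] (U : Fin r → Finset (Fin r → ℤ)) (T : Set (Fin r → ℤ)) :
    Prop :=
  ∀ (j : Fin r), ∀ a ∈ supported k k T, ∀ b : Fin r → AddMonoidAlgebra k (Fin r → ℤ),
    (∀ i, b i ∈ supported k k T) →
    monomialSum k (U j) * a = ∑ i ∈ Finset.Iio j, monomialSum k (U i) * b i →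
    ∃ c : Fin r → AddMonoidAlgebra k (Fin r → ℤ), (∀ i, c i ∈ supported k k T) ∧
      a = ∑ i ∈ Finset.Iio j, monomialSum k (U i) * c i

variable {K : Type*} [Field K] {S : AddSubmonoid (Fin r → ℤ)} {U : Fin r → Finset (Fin r → ℤ)}

lemma isPowerRegular_paramAlg (h : AlgebraicIndependent K fun i => monomialSum K (U i)) :
    IsPowerRegular fun i => (⟨monomialSum K (U i), Algebra.subset_adjoin ⟨i, rfl⟩⟩ :
      paramAlg K U) := by
  have := (isPowerRegular_X r K).map h.aevalEquiv.toRingEquiv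
  convert this using 2 with i
  apply Subtype.ext
  simp

lemma exists_mul_eq_sum_pow_mul (h : AlgebraicIndependent K fun i => monomialSum K (U i))
    (hUS : ∀ i, ∀ u ∈ U i, u ∈ S) {B : Finset (Fin r → ℤ)} (hBS : ∀ b ∈ B, b ∈ S)
    (hB : ∀ f ∈ supported K K (S : Set (Fin r → ℤ)),
      f ∈ Submodule.span (paramAlg K U) ((fun b => single b (1 : K)) '' (B : Set (Fin r → ℤ)))) :
    ∃ C : AddMonoidAlgebra K (Fin r → ℤ), C ≠ 0 ∧ ∀ (n : ℕ) (j : Fin r),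
      ∀ f ∈ supported K K (S : Set (Fin r → ℤ)), ∀ g : Fin r → AddMonoidAlgebra K (Fin r → ℤ),
      (∀ i, g i ∈ supported K K (S : Set (Fin r → ℤ))) →
      monomialSum K (U j) ^ n * f = ∑ i ∈ Finset.Iio j, monomialSum K (U i) ^ n * g i →
      ∃ q : Fin r → AddMonoidAlgebra K (Fin r → ℤ),
        (∀ i, q i ∈ supported K K (S : Set (Fin r → ℤ))) ∧
        C * f = ∑ i ∈ Finset.Iio j, monomialSum K (U i) ^ n * q i := by
  have hA : ∀ a ∈ paramAlg K U, a ∈ supported K K (S : Set (Fin r → ℤ)) := by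
    intro a ha
    rw [← mem_semigroupRing_iff]
    refine Algebra.adjoin_le ?_ ha
    rintro _ ⟨i, rfl⟩
    exact (mem_semigroupRing_iff K S).2 (monomialSum_mem_supported (hUS i))
  let v : {b // b ∈ (B : Set (Fin r → ℤ))} → AddMonoidAlgebra K (Fin r → ℤ) := fun b => single b.1 1
  have hv : (fun b => single b (1 : K)) '' (B : Set (Fin r → ℤ)) = Set.range v :=
    Set.image_eq_range _ _
  rw [hv] at hB
  obtain ⟨s, c, hc, hs, hspan⟩ :=
    exists_smul_mem_span_linearIndependent (A := paramAlg K U) v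
  have hr : v '' s = Set.range fun i : s => v i := Set.image_eq_range _ _
  rw [hr] at hspan
  have hsup : ∀ f ∈ Submodule.span (paramAlg K U) (Set.range fun i : s => v i),
      f ∈ supported K K (S : Set (Fin r → ℤ)) := by
    intro f hf
    induction hf using Submodule.span_induction with
    | mem x hx =>
      obtain ⟨b, rfl⟩ := hx
      exact single_mem_supported (hBS _ b.1.2) 1
    | zero => exact zero_mem _
    | add x y _ _ hx hy => exact add_mem hx hy
    | smul a x _ hx => exact mul_mem_supported (fun x hx y hy => S.add_mem hx hy) (hA a a.2) hx
  refine ⟨c, fun h0 => hc (Subtype.ext h0), fun n j f hf g hg hfg => ?_⟩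
  obtain ⟨q, hq, hfq⟩ := (isPowerRegular_paramAlg h).exists_of_linearIndependent hs n j
    (hspan f (hB f hf)) (fun i => hspan (g i) (hB (g i) (hg i))) (by
      change monomialSum K (U j) ^ n * (↑c * f) = ∑ i ∈ Finset.Iio j,
        monomialSum K (U i) ^ n * (↑c * g i)
      rw [mul_left_comm, hfg, Finset.mul_sum]
      exact Finset.sum_congr rfl fun i _ => mul_left_comm _ _ _)
  exact ⟨q, fun i => hsup _ (hq i), hfq⟩

lemma exists_mul_eq_sum_pow_mul_of_translates
    {C : AddMonoidAlgebra K (Fin r → ℤ)} (hC : C ≠ 0)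
    (h : ∀ (n : ℕ) (j : Fin r),
      ∀ f ∈ supported K K (S : Set (Fin r → ℤ)), ∀ g : Fin r → AddMonoidAlgebra K (Fin r → ℤ),
      (∀ i, g i ∈ supported K K (S : Set (Fin r → ℤ))) →
      monomialSum K (U j) ^ n * f = ∑ i ∈ Finset.Iio j, monomialSum K (U i) ^ n * g i →
      ∃ q : Fin r → AddMonoidAlgebra K (Fin r → ℤ),
        (∀ i, q i ∈ supported K K (S : Set (Fin r → ℤ))) ∧
        C * f = ∑ i ∈ Finset.Iio j, monomialSum K (U i) ^ n * q i)
    {T : ℕ → Set (Fin r → ℤ)} {v : Fin r → ℤ}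
    (hT : ∀ n, ∃ u, (∀ x ∈ T n, x - u ∈ S) ∧ ∀ y ∈ S, u + v + y ∈ T n) :
    ∃ C : AddMonoidAlgebra K (Fin r → ℤ), C ≠ 0 ∧ ∀ (n : ℕ) (j : Fin r),
      ∀ f ∈ supported K K (T n), ∀ g : Fin r → AddMonoidAlgebra K (Fin r → ℤ),
      (∀ i, g i ∈ supported K K (T n)) →
      monomialSum K (U j) ^ n * f = ∑ i ∈ Finset.Iio j, monomialSum K (U i) ^ n * g i →
      ∃ q : Fin r → AddMonoidAlgebra K (Fin r → ℤ), (∀ i, q i ∈ supported K K (T n)) ∧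
        C * f = ∑ i ∈ Finset.Iio j, monomialSum K (U i) ^ n * q i := by
  refine ⟨single v 1 * C, fun h0 => hC ?_, fun n j f hf g hg hfg => ?_⟩
  · have := congrArg (fun z => single (-v) (1 : K) * z) h0
    simpa [← mul_assoc, single_mul_single, ← one_def] using this
  · obtain ⟨u, hu, hu'⟩ := hT n
    have hshift : ∀ f ∈ supported K K (T n),
        single (-u) (1 : K) * f ∈ supported K K (S : Set (Fin r → ℤ)) := fun f hf =>
      mul_mem_supported (A := {-u}) (fun x hx y hy => by
        rw [Set.mem_singleton_iff] at hx
        rw [hx, neg_add_eq_sub]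
        exact hu y hy) (single_mem_supported (A := {-u}) (Set.mem_singleton _) 1) hf
    obtain ⟨q, hq, hfq⟩ := h n j _ (hshift f hf) (fun i => single (-u) 1 * g i)
      (fun i => hshift _ (hg i)) (by
        rw [mul_left_comm, hfg, Finset.mul_sum]
        exact Finset.sum_congr rfl fun i _ => mul_left_comm _ _ _)
    refine ⟨fun i => single (u + v) 1 * q i, fun i => ?_, ?_⟩
    · exact mul_mem_supported (A := {u + v}) (fun x hx y hy => by
        rw [Set.mem_singleton_iff] at hx
        rw [hx]
        exact hu' y hy) (single_mem_supported (A := {u + v}) (Set.mem_singleton _) 1) (hq i)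
    · calc single v 1 * C * f = single (u + v) 1 * (C * (single (-u) 1 * f)) := by
            have : single v (1 : K) = single (u + v) 1 * single (-u) 1 := by
              rw [single_mul_single, one_mul]
              congr 1
              abel
            rw [this]
            ring
        _ = _ := by
            rw [hfq, Finset.mul_sum]
            exact Finset.sum_congr rfl fun i _ => mul_left_comm _ _ _

lemma exists_rootMap_eq_single (C : AddMonoidAlgebra K (Fin r → ℤ)) (w : Fin r → ℤ) :
    ∃ n₀ : ℕ, ∀ n ≥ n₀, ∀ hn : n ≠ 0, rootMap K hn w C = single 0 (C.coeff w) := by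
  refine ⟨∑ x ∈ C.coeff.support, ∑ k, (x k - w k).natAbs + 1, fun n hn hn0 => ?_⟩
  ext t
  rw [coeff_rootMap, coeff_single]
  by_cases ht : t = 0
  · subst ht
    simp
  rw [Finsupp.single_apply, if_neg (Ne.symm ht)]
  by_contra hne
  obtain ⟨k, hk⟩ := Function.ne_iff.1 ht
  have h1 : ((n • t + w) k - w k).natAbs ≤ ∑ k, ((n • t + w) k - w k).natAbs :=
    Finset.single_le_sum (f := fun k => ((n • t + w) k - w k).natAbs) (fun _ _ => Nat.zero_le _)
      (Finset.mem_univ k)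
  have h2 := Finset.single_le_sum (f := fun x : Fin r → ℤ => ∑ k, (x k - w k).natAbs)
    (fun _ _ => Nat.zero_le _) (Finsupp.mem_support_iff.2 hne)
  have h3 : n ≤ ((n • t + w) k - w k).natAbs := by
    have : (n • t + w) k - w k = n * t k := by simp
    rw [this, Int.natAbs_mul, Int.natAbs_natCast]
    exact Nat.le_mul_of_pos_right n (Int.natAbs_pos.2 hk)
  omega

theorem colonProp_of_charP (p : ℕ) [Fact p.Prime] [CharP K p]
    {T : ℕ → Set (Fin r → ℤ)} {T₁ : Set (Fin r → ℤ)}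
    (hdil : ∀ n, ∀ x ∈ T₁, n • x ∈ T n)
    (hroot : ∀ w : Fin r → ℤ, ∃ n₀ : ℕ, ∀ n ≥ n₀, ∀ t, n • t + w ∈ T n → t ∈ T₁)
    {C : AddMonoidAlgebra K (Fin r → ℤ)} (hC : C ≠ 0)
    (h : ∀ (n : ℕ) (j : Fin r),
      ∀ f ∈ supported K K (T n), ∀ g : Fin r → AddMonoidAlgebra K (Fin r → ℤ),
      (∀ i, g i ∈ supported K K (T n)) →
      monomialSum K (U j) ^ n * f = ∑ i ∈ Finset.Iio j, monomialSum K (U i) ^ n * g i →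
      ∃ q : Fin r → AddMonoidAlgebra K (Fin r → ℤ), (∀ i, q i ∈ supported K K (T n)) ∧
        C * f = ∑ i ∈ Finset.Iio j, monomialSum K (U i) ^ n * q i) :
    ColonProp K U T₁ := by
  intro j a ha b hb hab
  obtain ⟨w, hw⟩ : ∃ w, C.coeff w ≠ 0 := by
    by_contra! hcon
    exact hC (by ext w; simp [hcon w])
  obtain ⟨n₁, hn₁⟩ := hroot w
  obtain ⟨n₂, hn₂⟩ := exists_rootMap_eq_single C w
  have hp : 1 < p := (Fact.out : p.Prime).one_lt
  obtain ⟨e, he⟩ : ∃ e : ℕ, max n₁ n₂ ≤ p ^ e := ⟨max n₁ n₂, (Nat.lt_pow_self hp).le⟩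
  have hn0 : p ^ e ≠ 0 := pow_ne_zero _ (by omega)
  have hdil' : ∀ f ∈ supported K K T₁, powMap K _ (p ^ e) f ∈ supported K K (T (p ^ e)) :=
    fun f hf => powMap_mem_supported (hdil _) hf
  obtain ⟨q, hq, haq⟩ := h (p ^ e) j _ (hdil' a ha) (fun i => powMap K _ (p ^ e) (b i))
    (fun i => hdil' _ (hb i)) (by
      have := congrArg (powMap K _ (p ^ e)) hab
      simpa only [map_mul, map_sum, powMap_monomialSum] using this)
  refine ⟨fun i => single 0 (C.coeff w)⁻¹ * rootMap K hn0 w (q i), fun i => ?_, ?_⟩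
  · refine mul_mem_supported (A := {0}) (B := T₁) (fun x hx y hy => ?_)
      (single_mem_supported (A := {0}) (Set.mem_singleton _) _) ?_
    · rw [Set.mem_singleton_iff] at hx
      rwa [hx, zero_add]
    · rw [mem_supported']
      intro t ht
      rw [coeff_rootMap]
      exact mem_supported'.1 (hq i) _ fun hmem => ht (hn₁ _ (le_trans (le_max_left _ _) he) t hmem)
  · have h1 := congrArg (rootMap K hn0 w) haq
    rw [mul_comm, rootMap_powMap_mul, hn₂ _ (le_trans (le_max_right _ _) he) hn0, map_sum] at h1
    have h2 : ∀ i, rootMap K hn0 w (monomialSum K (U i) ^ p ^ e * q i) =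
        monomialSum K (U i) * rootMap K hn0 w (q i) := by
      intro i
      rw [← powMap_monomialSum, rootMap_powMap_mul]
    simp only [h2] at h1
    calc a = single 0 (C.coeff w)⁻¹ * (a * single 0 (C.coeff w)) := by
          rw [mul_left_comm, single_mul_single, add_zero, inv_mul_cancel₀ hw, ← one_def, mul_one]
      _ = _ := by
          rw [h1, Finset.mul_sum]
          exact Finset.sum_congr rfl fun i _ => mul_left_comm _ _ _

end Frobenius

section Forms

variable {r s : ℕ} {S : AddSubmonoid (Fin r → ℤ)} {σ : Fin s → Fin r → ℤ}

lemma lin_sub (f x y : Fin r → ℤ) : lin f (x - y) = lin f x - lin f y := by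
  simp [lin, mul_sub, Finset.sum_sub_distrib]

lemma lin_nsmul (f : Fin r → ℤ) (n : ℕ) (x : Fin r → ℤ) : lin f (n • x) = n * lin f x := by
  simp only [lin, Pi.smul_apply, nsmul_eq_mul, Finset.mul_sum]
  exact Finset.sum_congr rfl fun i _ => mul_left_comm _ _ _

/-- The sum of a family of linear forms, as an additive homomorphism. -/
def formSum (σ : Fin s → Fin r → ℤ) : (Fin r → ℤ) →+ ℤ where
  toFun x := ∑ i, lin (σ i) x
  map_zero' := by simp [lin_zero]
  map_add' x y := by simp [lin_add, Finset.sum_add_distrib]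

lemma formSum_apply (σ : Fin s → Fin r → ℤ) (x : Fin r → ℤ) :
    formSum σ x = ∑ i, lin (σ i) x := rfl

lemma formSum_nonneg (hrep : ∀ x : Fin r → ℤ, x ∈ S ↔ ∀ i, 0 ≤ lin (σ i) x) {x : Fin r → ℤ}
    (hx : x ∈ S) : 0 ≤ formSum σ x := by
  rw [formSum_apply]
  exact Finset.sum_nonneg fun i _ => (hrep x).1 hx i

lemma eq_zero_of_forall_lin_eq_zero (hSpos : ∀ x ∈ S, -x ∈ S → x = 0)
    (hrep : ∀ x : Fin r → ℤ, x ∈ S ↔ ∀ i, 0 ≤ lin (σ i) x) {x : Fin r → ℤ}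
    (hx : ∀ i, lin (σ i) x = 0) : x = 0 := by
  refine hSpos x ((hrep x).2 fun i => (hx i).ge) ((hrep _).2 fun i => ?_)
  rw [← zero_sub, lin_sub, lin_zero, hx, sub_zero]

lemma formSum_pos (hSpos : ∀ x ∈ S, -x ∈ S → x = 0)
    (hrep : ∀ x : Fin r → ℤ, x ∈ S ↔ ∀ i, 0 ≤ lin (σ i) x) {x : Fin r → ℤ}
    (hx : x ∈ S) (h0 : x ≠ 0) : 0 < formSum σ x := by
  refine (formSum_nonneg hrep hx).lt_of_ne fun h => h0 ?_
  refine eq_zero_of_forall_lin_eq_zero hSpos hrep fun i => ?_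
  rw [formSum_apply, eq_comm, Finset.sum_eq_zero_iff_of_nonneg fun i _ => (hrep x).1 hx i] at h
  exact h i (Finset.mem_univ i)

lemma exists_mem_forall_le_lin (hSgp : ∀ x : Fin r → ℤ, ∃ a ∈ S, ∃ b ∈ S, x = a - b)
    (hrep : ∀ x : Fin r → ℤ, x ∈ S ↔ ∀ i, 0 ≤ lin (σ i) x)
    (hirr : ∀ j, ∃ x : Fin r → ℤ, lin (σ j) x < 0 ∧ ∀ i, i ≠ j → 0 ≤ lin (σ i) x) (M : ℕ) :
    ∃ w ∈ S, ∀ i, (M : ℤ) ≤ lin (σ i) w := by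
  have h1 : ∀ j, ∃ b ∈ S, 0 < lin (σ j) b := by
    intro j
    obtain ⟨x, hx, -⟩ := hirr j
    obtain ⟨a, ha, b, hb, rfl⟩ := hSgp x
    refine ⟨b, hb, ?_⟩
    rw [lin_sub] at hx
    have := (hrep a).1 ha j
    omega
  choose b hb hpos using h1
  refine ⟨M • ∑ j, b j, S.nsmul_mem (S.sum_mem fun j _ => hb j) M, fun i => ?_⟩
  have h2 : lin (σ i) (∑ j, b j) = ∑ j, lin (σ i) (b j) :=
    map_sum (AddMonoidHom.mk' (lin (σ i)) (lin_add (σ i))) b Finset.univ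
  have h3 : lin (σ i) (b i) ≤ ∑ j, lin (σ i) (b j) :=
    Finset.single_le_sum (f := fun j => lin (σ i) (b j)) (fun j _ => (hrep _).1 (hb j) i)
      (Finset.mem_univ i)
  rw [lin_nsmul, h2]
  have := hpos i
  nlinarith

end Forms

section Conic

variable {r s : ℕ} {S : AddSubmonoid (Fin r → ℤ)} {σ : Fin s → Fin r → ℤ}
  {deg : (Fin r → ℤ) →+ ℤ} {Γ : Finset (Fin r → ℤ)} {U : Fin r → Finset (Fin r → ℤ)}
  {e : Fin r → ℤ}

lemma add_mem_Tset (hrep : ∀ x : Fin r → ℤ, x ∈ S ↔ ∀ i, 0 ≤ lin (σ i) x) {a : Fin s → ℤ}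
    {x y : Fin r → ℤ} (hx : x ∈ S) (hy : y ∈ Tset σ a) : x + y ∈ Tset σ a := fun i => by
  have h1 := (hrep x).1 hx i
  have h2 : a i ≤ lin (σ i) y := hy i
  rw [lin_add]
  omega

/-- The lattice points in the `n`-th dilate of a polyhedron with real right hand sides. -/
def dilate (σ : Fin s → Fin r → ℤ) (b : Fin s → ℝ) (n : ℕ) : Set (Fin r → ℤ) :=
  {x | ∀ i, n * b i ≤ lin (σ i) x}

lemma nsmul_mem_dilate {b : Fin s → ℝ} (n : ℕ) {x : Fin r → ℤ}
    (hx : x ∈ Tset σ fun i => ⌈b i⌉) : n • x ∈ dilate σ b n := fun i => by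
  rw [lin_nsmul]
  push_cast
  exact mul_le_mul_of_nonneg_left (Int.ceil_le.1 (hx i)) n.cast_nonneg

lemma exists_forall_mem_Tset_of_mem_dilate (σ : Fin s → Fin r → ℤ) (b : Fin s → ℝ)
    (w : Fin r → ℤ) :
    ∃ n₀ : ℕ, ∀ n ≥ n₀, ∀ t, n • t + w ∈ dilate σ b n → t ∈ Tset σ fun i => ⌈b i⌉ := by
  have hδ : ∀ i, 0 < b i - (⌈b i⌉ - 1) := fun i => by
    have := Int.ceil_lt_add_one (b i)
    linarith
  have h1 : ∀ i, ∃ N : ℕ, ∀ n ≥ N, (lin (σ i) w : ℝ) < n * (b i - (⌈b i⌉ - 1)) := by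
    intro i
    obtain ⟨N, hN⟩ := exists_nat_gt ((lin (σ i) w : ℝ) / (b i - (⌈b i⌉ - 1)))
    refine ⟨N, fun n hn => ?_⟩
    rw [div_lt_iff₀ (hδ i)] at hN
    exact hN.trans_le (mul_le_mul_of_nonneg_right (Nat.cast_le.2 hn) (hδ i).le)
  choose N hN using h1
  refine ⟨∑ i, N i, fun n hn t ht i => ?_⟩
  have h2 := hN i n ((Finset.single_le_sum (f := N) (fun _ _ => Nat.zero_le _)
    (Finset.mem_univ i)).trans hn)
  have h3 : (n * b i : ℝ) ≤ lin (σ i) (n • t + w) := ht i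
  rw [lin_add, lin_nsmul] at h3
  push_cast at h3
  by_contra! hcon
  have h4 : (lin (σ i) t : ℝ) ≤ ⌈b i⌉ - 1 := by
    have : lin (σ i) t ≤ ⌈b i⌉ - 1 := by omega
    exact_mod_cast this
  have h5 := mul_le_mul_of_nonneg_left h4 (n.cast_nonneg (α := ℝ))
  linarith

lemma abs_lin_floor_sub_le (f : Fin r → ℤ) (z : Fin r → ℝ) :
    |(lin f (fun k => ⌊z k⌋) : ℝ) - ∑ k, (f k : ℝ) * z k| ≤ ∑ k, |(f k : ℝ)| := by
  rw [lin]
  push_cast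
  rw [← Finset.sum_sub_distrib]
  refine (Finset.abs_sum_le_sum_abs _ _).trans (Finset.sum_le_sum fun k _ => ?_)
  rw [← mul_sub, abs_mul]
  refine mul_le_of_le_one_right (abs_nonneg _) (abs_le.2 ⟨?_, ?_⟩)
  · have := Int.lt_floor_add_one (z k)
    linarith
  · have := Int.floor_le (z k)
    linarith

lemma exists_mem_forall_sum_abs_le_lin (hSgp : ∀ x : Fin r → ℤ, ∃ a ∈ S, ∃ b ∈ S, x = a - b)
    (hrep : ∀ x : Fin r → ℤ, x ∈ S ↔ ∀ i, 0 ≤ lin (σ i) x)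
    (hirr : ∀ j, ∃ x : Fin r → ℤ, lin (σ j) x < 0 ∧ ∀ i, i ≠ j → 0 ≤ lin (σ i) x) :
    ∃ w ∈ S, ∀ i, ∑ k, |(σ i k : ℝ)| ≤ lin (σ i) w := by
  obtain ⟨w, hwS, hw⟩ := exists_mem_forall_le_lin hSgp hrep hirr (∑ i, ∑ k, (σ i k).natAbs)
  refine ⟨w, hwS, fun i => ?_⟩
  have h1 : ∑ k, (σ i k).natAbs ≤ ∑ i, ∑ k, (σ i k).natAbs :=
    Finset.single_le_sum (f := fun i => ∑ k, (σ i k).natAbs) (fun _ _ => Nat.zero_le _)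
      (Finset.mem_univ i)
  have h2 : ((∑ k, (σ i k).natAbs : ℕ) : ℤ) ≤ lin (σ i) w := (Int.ofNat_le.2 h1).trans (hw i)
  have h3 : (((∑ k, (σ i k).natAbs : ℕ) : ℤ) : ℝ) ≤ lin (σ i) w := Int.cast_le.2 h2
  refine le_trans (le_of_eq ?_) h3
  push_cast
  exact Finset.sum_congr rfl fun k _ => by simp

lemma exists_dilate_between (hSgp : ∀ x : Fin r → ℤ, ∃ a ∈ S, ∃ b ∈ S, x = a - b)
    (hrep : ∀ x : Fin r → ℤ, x ∈ S ↔ ∀ i, 0 ≤ lin (σ i) x)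
    (hirr : ∀ j, ∃ x : Fin r → ℤ, lin (σ j) x < 0 ∧ ∀ i, i ≠ j → 0 ≤ lin (σ i) x)
    (β : Fin r → ℝ) :
    ∃ v, ∀ n, ∃ u, (∀ x ∈ dilate σ (fun i => ∑ k, (σ i k : ℝ) * β k) n, x - u ∈ S) ∧
      ∀ y ∈ S, u + v + y ∈ dilate σ (fun i => ∑ k, (σ i k : ℝ) * β k) n := by
  obtain ⟨w, -, hw⟩ := exists_mem_forall_sum_abs_le_lin hSgp hrep hirr
  refine ⟨w + w, fun n => ?_⟩
  have key : ∀ i, |(lin (σ i) (fun k => ⌊n * β k⌋) : ℝ) - n * ∑ k, (σ i k : ℝ) * β k| ≤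
      lin (σ i) w := by
    intro i
    refine le_trans (le_of_eq ?_) ((abs_lin_floor_sub_le (σ i) fun k => n * β k).trans (hw i))
    rw [Finset.mul_sum]
    congr 2
    exact Finset.sum_congr rfl fun k _ => mul_left_comm _ _ _
  refine ⟨(fun k => ⌊n * β k⌋) - w, fun x hx => (hrep _).2 fun i => ?_, fun y hy i => ?_⟩
  · have h1 : (n * ∑ k, (σ i k : ℝ) * β k : ℝ) ≤ lin (σ i) x := hx i
    have h2 := abs_le.1 (key i)
    have : (0 : ℝ) ≤ lin (σ i) (x - ((fun k => ⌊n * β k⌋) - w)) := by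
      rw [lin_sub, lin_sub]
      push_cast
      linarith [h2.2]
    exact_mod_cast this
  · have h1 : (0 : ℝ) ≤ lin (σ i) y := by exact_mod_cast (hrep y).1 hy i
    have h2 := abs_le.1 (key i)
    simp only [lin_add, lin_sub]
    push_cast
    linarith [h2.1]

theorem colonProp_Tset_of_charP {K : Type*} [Field K] (p : ℕ) [Fact p.Prime] [CharP K p]
    (h : IsParamSystem deg Γ U e)
    (hΓS : AddSubmonoid.closure (Γ : Set (Fin r → ℤ)) = S) (hdeg : ∀ x ∈ S, 0 ≤ deg x)
    (hSgp : ∀ x : Fin r → ℤ, ∃ a ∈ S, ∃ b ∈ S, x = a - b)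
    (hrep : ∀ x : Fin r → ℤ, x ∈ S ↔ ∀ i, 0 ≤ lin (σ i) x)
    (hirr : ∀ j, ∃ x : Fin r → ℤ, lin (σ j) x < 0 ∧ ∀ i, i ≠ j → 0 ≤ lin (σ i) x)
    (β : Fin r → ℝ) :
    ColonProp K U (Tset σ fun i => ⌈∑ k, (σ i k : ℝ) * β k⌉) := by
  obtain ⟨B, hBS, hB⟩ := h.exists_finite_span (K := K) hΓS hdeg
  obtain ⟨C₀, hC₀, hC₀'⟩ := exists_mul_eq_sum_pow_mul (h.algebraicIndependent hΓS hdeg hSgp)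
    (fun i u hu => hΓS ▸ h.mem i u hu) hBS hB
  obtain ⟨v, hv⟩ := exists_dilate_between hSgp hrep hirr β
  obtain ⟨C, hC, hC'⟩ := exists_mul_eq_sum_pow_mul_of_translates hC₀ hC₀' hv
  exact colonProp_of_charP p (fun n x hx => nsmul_mem_dilate n hx)
    (exists_forall_mem_Tset_of_mem_dilate σ _) hC hC'

end Conic

section Pairing

variable {k G : Type*} [CommRing k]

/-- The linear functional on the group algebra whose value on the monomial with exponent `x`
is `ℓ x`. -/
def pairing (ℓ : G → k) : AddMonoidAlgebra k G →ₗ[k] k :=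
  Finsupp.linearCombination k ℓ ∘ₗ (coeffLinearEquiv k).toLinearMap

lemma pairing_single (ℓ : G → k) (x : G) (c : k) : pairing ℓ (single x c) = c * ℓ x := by
  simp [pairing]

variable [AddCommGroup G]

lemma pairing_mapRingHom {k' : Type*} [CommRing k'] (φ : k →+* k') (ℓ : G → k)
    (f : AddMonoidAlgebra k G) :
    pairing (fun x => φ (ℓ x)) (mapRingHom G φ f) = φ (pairing ℓ f) := by
  induction f using AddMonoidAlgebra.induction_linear with
  | zero => simp
  | add f g hf hg => simp only [map_add, hf, hg]
  | single x c => rw [mapRingHom_single, pairing_single, pairing_single, map_mul]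

lemma mapRingHom_monomialSum {k' : Type*} [CommRing k'] (φ : k →+* k') (V : Finset G) :
    mapRingHom G φ (monomialSum k V) = monomialSum k' V := by
  simp [monomialSum, mapRingHom_single]

lemma mapRingHom_mem_supported {k' : Type*} [CommRing k'] (φ : k →+* k') {T : Set G}
    {f : AddMonoidAlgebra k G} (hf : f ∈ supported k k T) :
    mapRingHom G φ f ∈ supported k' k' T := by
  rw [mem_supported'] at hf ⊢
  intro m hm
  rw [coeff_mapRingHom, hf m hm, map_zero]

lemma pairing_monomialSum_mul_eq_zero {ℓ : G → k} {V : Finset G} {T : Set G}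
    (h : ∀ t ∈ T, ∑ u ∈ V, ℓ (u + t) = 0) {f : AddMonoidAlgebra k G}
    (hf : f ∈ supported k k T) : pairing ℓ (monomialSum k V * f) = 0 := by
  rw [supported_eq_span_single] at hf
  induction hf using Submodule.span_induction with
  | mem x hx =>
    obtain ⟨t, ht, rfl⟩ := hx
    simp only [monomialSum, Finset.sum_mul, single_mul_single, map_sum, pairing_single, one_mul]
    exact h t ht
  | zero => simp
  | add x y _ _ hx hy => rw [mul_add, map_add, hx, hy, add_zero]
  | smul c x _ hx => rw [mul_smul_comm, map_smul, hx, smul_zero]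

lemma exists_mapRingHom_subtype_eq {R k : Type*} [CommRing R] [CommRing k] [Algebra R k]
    (D : Subalgebra R k) {f : AddMonoidAlgebra k G} (hf : ∀ x, f.coeff x ∈ D) :
    ∃ g : AddMonoidAlgebra D G, mapRingHom G (D.val : D →+* k) g = f := by
  classical
  refine ⟨∑ x ∈ f.coeff.support, single x ⟨f.coeff x, hf x⟩, ?_⟩
  ext y
  simp only [map_sum, mapRingHom_single, coeff_sum, Finsupp.finsetSum_apply, coeff_single,
    Finsupp.single_apply]
  rw [Finset.sum_ite_eq']
  split_ifs with h
  · rfl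
  · exact (Finsupp.notMem_support_iff.1 h).symm

end Pairing

section Residue

instance isJacobsonRing_int : IsJacobsonRing ℤ := by
  refine isJacobsonRing_iff_prime_eq.2 fun P hP => ?_
  by_cases h : P = ⊥
  · subst h
    refine le_antisymm (fun x hx => ?_) Ideal.le_jacobson
    have := Ideal.mem_jacobson_bot.1 hx x
    rw [Int.isUnit_iff] at this
    rw [Ideal.mem_bot]
    rcases this with h | h <;> nlinarith
  · have : P.IsMaximal := hP.isMaximal h
    exact Ideal.jacobson_eq_self_of_isMaximal

lemma exists_charP_of_finiteType (D : Type*) [CommRing D] [Nontrivial D]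
    [Algebra.FiniteType ℤ D] :
    ∃ (m : Ideal D) (p : ℕ), m.IsMaximal ∧ p.Prime ∧ CharP (D ⧸ m) p := by
  obtain ⟨m, hm⟩ := Ideal.exists_maximal D
  let := Ideal.Quotient.field m
  obtain ⟨p, hp⟩ := CharP.exists (D ⧸ m)
  refine ⟨m, p, hm, (CharP.char_is_prime_or_zero (D ⧸ m) p).resolve_right ?_, hp⟩
  rintro rfl
  have := CharP.charP_to_charZero (D ⧸ m)
  have : Algebra.FiniteType ℤ (D ⧸ m) := inferInstance
  have := finite_of_finite_type_of_isJacobsonRing ℤ (D ⧸ m)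
  have : Algebra.IsIntegral ℤ (D ⧸ m) := inferInstance
  exact Int.not_isField (isField_of_isIntegral_of_isField
    (FaithfulSMul.algebraMap_injective ℤ (D ⧸ m)) (Field.toIsField (D ⧸ m)))

variable {r : ℕ} {deg : (Fin r → ℤ) →+ ℤ} {U : Fin r → Finset (Fin r → ℤ)} {e : Fin r → ℤ}
  {T : Set (Fin r → ℤ)}

lemma exists_pairing_ne_zero {K : Type*} [Field K] (hU : ∀ i, ∀ u ∈ U i, deg u = e i)
    (hUT : ∀ i, ∀ u ∈ U i, ∀ t ∈ T, u + t ∈ T)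
    (hfin : ∀ d, (T ∩ {t | deg t = d}).Finite) (j : Fin r)
    {a : AddMonoidAlgebra K (Fin r → ℤ)} (ha : a ∈ supported K K T)
    (hne : ∀ c : Fin r → AddMonoidAlgebra K (Fin r → ℤ), (∀ i, c i ∈ supported K K T) →
      a ≠ ∑ i ∈ Finset.Iio j, monomialSum K (U i) * c i) :
    ∃ ℓ : (Fin r → ℤ) → K, ℓ.support.Finite ∧ pairing ℓ a ≠ 0 ∧
      ∀ i ∈ Finset.Iio j, ∀ t ∈ T, ∑ u ∈ U i, ℓ (u + t) = 0 := by
  classical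
  let Φ : (Fin r → supported K K T) →ₗ[K] AddMonoidAlgebra K (Fin r → ℤ) :=
    ∑ i ∈ Finset.Iio j, LinearMap.mulLeft K (monomialSum K (U i)) ∘ₗ
      (supported K K T).subtype ∘ₗ LinearMap.proj i
  have hΦ : ∀ c, Φ c = ∑ i ∈ Finset.Iio j, monomialSum K (U i) * c i := fun c => by
    simp [Φ, LinearMap.sum_apply]
  have haN : a ∉ (LinearMap.range Φ).toAddSubgroup := by
    rintro ⟨c, hc⟩
    exact hne (fun i => c i) (fun i => (c i).2) (by rw [← hΦ, hc])
  obtain ⟨d, hd⟩ := exists_degComp_ne (deg := deg) _ haN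
  obtain ⟨lam, hlam, hker⟩ := Submodule.exists_le_ker_of_notMem
    (p := LinearMap.range Φ) (v := degComp K deg d a) hd
  refine ⟨fun t => if t ∈ T ∧ deg t = d then lam (single t 1) else 0,
    (hfin d).subset fun t ht => ?_, ?_, fun i hi t ht => ?_⟩
  · by_contra hcon
    exact ht (if_neg hcon)
  · have key : ∀ f ∈ supported K K T,
        pairing (fun t => if t ∈ T ∧ deg t = d then lam (single t 1) else 0) f =
          lam (degComp K deg d f) := by
      intro f hf
      have hdeg : ∀ c : K, ∀ g : AddMonoidAlgebra K (Fin r → ℤ),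
          degComp K deg d (c • g) = c • degComp K deg d g := by
        intro c g; ext m; simp [coeff_degComp]
      rw [supported_eq_span_single] at hf
      induction hf using Submodule.span_induction with
      | mem x hx =>
        obtain ⟨t, ht, rfl⟩ := hx
        simp only [pairing_single, one_mul]
        split_ifs with h
        · rw [degComp_of_mem (single_mem_supported (A := {x | deg x = d}) h.2 1)]
        · have : degComp K deg d (single t 1) = 0 := by
            ext m
            rw [coeff_degComp, coeff_single, Finsupp.single_apply]
            split_ifs with h1 h2
            · exact absurd ⟨ht, h2 ▸ h1⟩ h
            all_goals rfl
          rw [this, map_zero]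
      | zero => simp
      | add x y _ _ hx hy => simp only [map_add, hx, hy]
      | smul c x _ hx => rw [map_smul, hx, hdeg, map_smul]
    rw [key a ha]
    exact hlam
  · by_cases hdt : deg t = d - e i
    · have h1 : ∀ u ∈ U i, (if u + t ∈ T ∧ deg (u + t) = d then lam (single (u + t) 1) else 0) =
          lam (single u 1 * single t 1) := by
        intro u hu
        rw [if_pos ⟨hUT i u hu t ht, by rw [map_add, hU i u hu, hdt]; abel⟩, single_mul_single,
          one_mul]
      rw [Finset.sum_congr rfl h1, ← map_sum, ← Finset.sum_mul]
      refine hker ⟨Pi.single i ⟨single t 1, single_mem_supported ht 1⟩, ?_⟩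
      rw [hΦ, Finset.sum_eq_single_of_mem i hi fun i' _ hne => by simp [Pi.single_eq_of_ne hne]]
      simp [monomialSum]
    · refine Finset.sum_eq_zero fun u hu => if_neg fun h => hdt ?_
      have := h.2
      rw [map_add, hU i u hu] at this
      omega

theorem colonProp_of_forall_charP.{u} (hU : ∀ i, ∀ u ∈ U i, deg u = e i)
    (hUT : ∀ i, ∀ u ∈ U i, ∀ t ∈ T, u + t ∈ T)
    (hfin : ∀ d, (T ∩ {t | deg t = d}).Finite)
    (h : ∀ (k : Type u) [Field k] (p : ℕ) [Fact p.Prime] [CharP k p], ColonProp k U T)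
    (K : Type u) [Field K] : ColonProp K U T := by
  classical
  intro j a ha b hb hab
  by_contra! hcon
  obtain ⟨ℓ, hℓ, hne, hzero⟩ := exists_pairing_ne_zero hU hUT hfin j ha hcon
  let X : Finset K := a.coeff.support.image a.coeff ∪
    (Finset.univ.biUnion fun i => (b i).coeff.support.image (b i).coeff) ∪
    hℓ.toFinset.image ℓ ∪ {(pairing ℓ a)⁻¹}
  let D : Subalgebra ℤ K := Algebra.adjoin ℤ (X : Set K)
  have hX : ∀ x ∈ X, x ∈ D := fun x hx => Algebra.subset_adjoin hx
  have hD : ∀ f : (Fin r → ℤ) → K, (∀ x, f x ≠ 0 → f x ∈ X) → ∀ x, f x ∈ D := by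
    intro f hf x
    by_cases h0 : f x = 0
    · rw [h0]; exact zero_mem _
    · exact hX _ (hf x h0)
  have haD := hD a.coeff fun x hx => by
    simp only [X, Finset.mem_union, Finset.mem_image]
    exact .inl (.inl (.inl ⟨x, Finsupp.mem_support_iff.2 hx, rfl⟩))
  have hbD := fun i => hD (b i).coeff fun x hx => by
    simp only [X, Finset.mem_union, Finset.mem_biUnion, Finset.mem_image]
    exact .inl (.inl (.inr ⟨i, Finset.mem_univ i, x, Finsupp.mem_support_iff.2 hx, rfl⟩))
  have hℓD := hD ℓ fun x hx => by
    simp only [X, Finset.mem_union, Finset.mem_image]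
    exact .inl (.inr ⟨x, hℓ.mem_toFinset.2 hx, rfl⟩)
  have hinv : (pairing ℓ a)⁻¹ ∈ D := hX _ (by simp [X])
  obtain ⟨a', ha'⟩ := exists_mapRingHom_subtype_eq D haD
  choose b' hb' using fun i => exists_mapRingHom_subtype_eq D (hbD i)
  have : Algebra.FiniteType ℤ D :=
    Subalgebra.fg_iff_finiteType D |>.1 ⟨X, rfl⟩
  obtain ⟨m, p, hm, hp, hchar⟩ := exists_charP_of_finiteType D
  let _ := Ideal.Quotient.field m
  have : Fact p.Prime := ⟨hp⟩
  let φ := Ideal.Quotient.mk m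
  let ι : D →+* K := D.val
  have hinj : Function.Injective (mapRingHom (Fin r → ℤ) ι) := by
    intro f g hfg
    ext x
    have := congrArg (fun z : AddMonoidAlgebra K (Fin r → ℤ) => z.coeff x) hfg
    simp only [coeff_mapRingHom] at this
    exact this
  have hsupp : ∀ f : AddMonoidAlgebra D (Fin r → ℤ),
      mapRingHom (Fin r → ℤ) ι f ∈ supported K K T →
        mapRingHom (Fin r → ℤ) φ f ∈ supported (D ⧸ m) (D ⧸ m) T := by
    intro f hf
    apply mapRingHom_mem_supported
    rw [mem_supported'] at hf ⊢
    intro x hx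
    have := hf x hx
    rw [coeff_mapRingHom] at this
    exact Subtype.ext this
  have hrel : monomialSum D (U j) * a' = ∑ i ∈ Finset.Iio j, monomialSum D (U i) * b' i := by
    apply hinj
    simp only [map_mul, map_sum, mapRingHom_monomialSum]
    rw [ha', hab]
    exact Finset.sum_congr rfl fun i _ => by rw [hb']
  obtain ⟨c, hc, hac⟩ := h (D ⧸ m) p j (mapRingHom _ φ a') (hsupp _ (by rwa [ha']))
    (fun i => mapRingHom _ φ (b' i)) (fun i => hsupp _ (by rw [hb']; exact hb i)) (by
      have := congrArg (mapRingHom (Fin r → ℤ) φ) hrel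
      simpa only [map_mul, map_sum, mapRingHom_monomialSum] using this)
  let ℓ' : (Fin r → ℤ) → D := fun x => ⟨ℓ x, hℓD x⟩
  have h0 : φ (pairing ℓ' a') = 0 := by
    rw [← pairing_mapRingHom, hac, map_sum]
    refine Finset.sum_eq_zero fun i hi => pairing_monomialSum_mul_eq_zero (fun t ht => ?_) (hc i)
    rw [← map_sum]
    have : ∑ u ∈ U i, ℓ' (u + t) = 0 := Subtype.ext (by simpa [ℓ'] using hzero i hi t ht)
    rw [this, map_zero]
  have h1 : pairing ℓ' a' * ⟨_, hinv⟩ = 1 := by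
    apply Subtype.ext
    have : ((pairing ℓ' a' : D) : K) = pairing ℓ a := by
      have := pairing_mapRingHom ι ℓ' a'
      rw [ha'] at this
      exact this.symm
    change ((pairing ℓ' a' : D) : K) * (pairing ℓ a)⁻¹ = 1
    rw [this, mul_inv_cancel₀ hne]
  have h2 := congrArg φ h1
  rw [map_mul, h0, zero_mul, map_one] at h2
  exact zero_ne_one h2

end Residue

section RegularSequence

open RingTheory.Sequence

variable {R M : Type*} [CommRing R] [AddCommGroup M] [Module R M]

lemma mem_span_image_smul_top_iff {ι : Type*} (θ : ι → R) (s : Finset ι) (m : M) :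
    m ∈ Ideal.span (θ '' s) • (⊤ : Submodule R M) ↔ ∃ c : ι → M, m = ∑ i ∈ s, θ i • c i := by
  classical
  induction s using Finset.induction_on generalizing m with
  | empty => simp
  | insert i s hi ih =>
    rw [Finset.coe_insert, Set.image_insert_eq, Ideal.span_insert, Submodule.sup_smul,
      Submodule.mem_sup, Submodule.ideal_span_singleton_smul]
    constructor
    · rintro ⟨x, hx, y, hy, rfl⟩
      obtain ⟨z, -, rfl⟩ := (Submodule.mem_smul_pointwise_iff_exists _ _ _).1 hx
      obtain ⟨c, rfl⟩ := (ih y).1 hy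
      refine ⟨Function.update c i z, ?_⟩
      rw [Finset.sum_insert hi, Function.update_self]
      congr 1
      refine Finset.sum_congr rfl fun k hk => ?_
      rw [Function.update_of_ne (ne_of_mem_of_not_mem hk hi)]
    · rintro ⟨c, rfl⟩
      rw [Finset.sum_insert hi]
      exact ⟨_, Submodule.smul_mem_pointwise_smul _ _ _ trivial, _, (ih _).2 ⟨c, rfl⟩, rfl⟩

lemma ofList_take_ofFn {n : ℕ} (θ : Fin n → R) (j : Fin n) :
    Ideal.ofList ((List.ofFn θ).take j) = Ideal.span (θ '' (Finset.Iio j : Finset (Fin n))) := by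
  rw [Ideal.ofList]
  congr 1
  ext x
  simp only [Set.mem_ofPred_eq, List.mem_take_iff_getElem, List.getElem_ofFn, Set.mem_image,
    Finset.mem_coe, Finset.mem_Iio]
  constructor
  · rintro ⟨i, hi, rfl⟩
    exact ⟨_, Fin.mk_lt_of_lt_val (by omega), rfl⟩
  · rintro ⟨i, hi, rfl⟩
    exact ⟨i, by simpa using hi, rfl⟩

lemma ofList_ofFn {n : ℕ} (θ : Fin n → R) :
    Ideal.ofList (List.ofFn θ) = Ideal.span (Set.range θ) := by
  rw [Ideal.ofList]
  congr 1
  ext x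
  simp [List.mem_ofFn']

lemma isWeaklyRegular_ofFn {n : ℕ} (θ : Fin n → R)
    (h : ∀ (j : Fin n) (a : M) (b : Fin n → M), θ j • a = ∑ i ∈ Finset.Iio j, θ i • b i →
      ∃ c : Fin n → M, a = ∑ i ∈ Finset.Iio j, θ i • c i) :
    IsWeaklyRegular M (List.ofFn θ) := by
  refine ⟨fun i hi => ?_⟩
  have hin : i < n := by simpa using hi
  rw [List.getElem_ofFn, isSMulRegular_iff_right_eq_zero_of_smul]
  intro x hx
  induction x using Submodule.Quotient.induction_on with
  | H a =>
    rw [← Submodule.Quotient.mk_smul, Submodule.Quotient.mk_eq_zero,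
      ofList_take_ofFn θ ⟨i, hin⟩, mem_span_image_smul_top_iff] at hx
    rw [Submodule.Quotient.mk_eq_zero, ofList_take_ofFn θ ⟨i, hin⟩, mem_span_image_smul_top_iff]
    obtain ⟨b, hb⟩ := hx
    exact h _ a b hb

lemma not_isRegular_append {rs : List R} (hrs : IsRegular M rs) {y : R}
    (hy : y ∈ (Ideal.ofList rs).radical) : ¬ IsRegular M (rs ++ [y]) := by
  intro h
  have h1 := ((isWeaklyRegular_append_iff M rs [y]).1 h.toIsWeaklyRegular).2
  rw [isWeaklyRegular_singleton_iff] at h1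
  obtain ⟨n, hn⟩ := hy
  refine hrs.top_ne_smul (top_le_iff.1 fun m _ => ?_).symm
  rw [← Submodule.Quotient.mk_eq_zero]
  refine isSMulRegular_iff_right_eq_zero_of_smul.1 (h1.pow n) _ ?_
  rw [← Submodule.Quotient.mk_smul, Submodule.Quotient.mk_eq_zero]
  exact Submodule.smul_mem_smul hn trivial

end RegularSequence

section CohenMacaulay

open RingTheory.Sequence

variable {r : ℕ} {K : Type*} [Field K] {S : AddSubmonoid (Fin r → ℤ)}
  {deg : (Fin r → ℤ) →+ ℤ} {Γ : Finset (Fin r → ℤ)}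
  {U : Fin r → Finset (Fin r → ℤ)} {e : Fin r → ℤ} {T : Set (Fin r → ℤ)}

lemma IsParamSystem.irrelevantIdeal_le_radical (h : IsParamSystem deg Γ U e)
    (hΓS : AddSubmonoid.closure (Γ : Set (Fin r → ℤ)) = S) (hUS : ∀ i, ∀ u ∈ U i, u ∈ S) :
    irrelevantIdeal K S ≤ (Ideal.span (Set.range fun i => paramR K S (hUS i))).radical := by
  have key : ∀ x ∈ AddSubmonoid.closure (Γ : Set (Fin r → ℤ)), x = 0 ∨ ∀ hx : x ∈ S,
      monoR K S hx ∈ (Ideal.span (Set.range fun i => paramR K S (hUS i))).radical := by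
    intro x hx
    induction hx using AddSubmonoid.closure_induction with
    | mem x hx => exact .inr fun hxS => h.exists_pow_mem hΓS hUS hx hxS
    | zero => exact .inl rfl
    | add x y hx hy h1 h2 =>
      rcases h1 with rfl | h1
      · simpa using h2
      · refine .inr fun hxy => ?_
        rw [monoR_add K S (hΓS ▸ hx) (hΓS ▸ hy)]
        exact Ideal.mul_mem_right _ _ (h1 _)
  refine Ideal.span_le.2 ?_
  rintro f ⟨x, hx, h0, hf⟩
  have : f = monoR K S hx := Subtype.ext hf
  rw [this]
  exact (key x (hΓS ▸ hx)).resolve_left h0 hx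

lemma IsParamSystem.paramR_mem_irrelevantIdeal (h : IsParamSystem deg Γ U e)
    (hUS : ∀ i, ∀ u ∈ U i, u ∈ S) (i : Fin r) : paramR K S (hUS i) ∈ irrelevantIdeal K S := by
  have : paramR K S (hUS i) = ∑ u ∈ (U i).attach, monoR K S (hUS i u u.2) := by
    apply Subtype.ext
    rw [coe_paramR, monomialSum, ← Finset.sum_attach]
    simp [coe_monoR]
  rw [this]
  refine Ideal.sum_mem _ fun u _ => Ideal.subset_span ⟨u, hUS i u u.2, fun h0 => ?_, rfl⟩
  have h1 := h.deg_eq i u u.2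
  have h2 := h.deg_pos i
  rw [h0, map_zero] at h1
  omega

lemma single_mem_monIdeal {t : Fin r → ℤ} (ht : t ∈ T) : single t 1 ∈ monIdeal K S T :=
  Submodule.subset_span ⟨t, ht, rfl⟩

lemma annihilator_monIdeal (hne : T.Nonempty) :
    Module.annihilator (semigroupRing K S) (monIdeal K S T) = ⊥ := by
  obtain ⟨t, ht⟩ := hne
  refine (Submodule.eq_bot_iff _).2 fun x hx => ?_
  have h1 := Module.mem_annihilator.1 hx ⟨single t 1, single_mem_monIdeal ht⟩
  have h2 : (x : AddMonoidAlgebra K (Fin r → ℤ)) * single t 1 = 0 := congrArg Subtype.val h1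
  have h3 := congrArg (fun z => z * single (-t) (1 : K)) h2
  apply Subtype.ext
  simpa [mul_assoc, single_mul_single, ← one_def] using h3

theorem isCohenMacaulayMod_monIdeal (h : IsParamSystem deg Γ U e)
    (hΓS : AddSubmonoid.closure (Γ : Set (Fin r → ℤ)) = S) (hdeg : ∀ x ∈ S, 0 ≤ deg x)
    (hSgp : ∀ x : Fin r → ℤ, ∃ a ∈ S, ∃ b ∈ S, x = a - b)
    (hST : ∀ x ∈ S, ∀ y ∈ T, x + y ∈ T) (hne : T.Nonempty) {d₀ : ℤ}
    (hd₀ : ∀ t ∈ T, d₀ ≤ deg t) (hcol : ColonProp K U T) :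
    IsCohenMacaulayMod (semigroupRing K S) (irrelevantIdeal K S) (monIdeal K S T) := by
  classical
  have hUS : ∀ i, ∀ u ∈ U i, u ∈ S := fun i u hu => hΓS ▸ h.mem i u hu
  let θ : Fin r → semigroupRing K S := fun i => paramR K S (hUS i)
  have hcoe : ∀ (s : Finset (Fin r)) (c : Fin r → monIdeal K S T),
      ((∑ i ∈ s, θ i • c i : monIdeal K S T) : AddMonoidAlgebra K (Fin r → ℤ)) =
        ∑ i ∈ s, monomialSum K (U i) * c i := fun s c => by
    rw [Submodule.coe_sum]
    rfl
  have hweak : IsWeaklyRegular (monIdeal K S T) (List.ofFn θ) := by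
    refine isWeaklyRegular_ofFn θ fun j a b hab => ?_
    have hab' := congrArg Subtype.val hab
    rw [hcoe] at hab'
    obtain ⟨c, hc, hac⟩ := hcol j a ((mem_monIdeal_iff K S hST).1 a.2) (fun i => b i)
      (fun i => (mem_monIdeal_iff K S hST).1 (b i).2) hab'
    refine ⟨fun i => ⟨c i, (mem_monIdeal_iff K S hST).2 (hc i)⟩, Subtype.ext ?_⟩
    rw [hcoe]
    exact hac
  have hreg : IsRegular (monIdeal K S T) (List.ofFn θ) := by
    refine ⟨hweak, fun htop => ?_⟩
    obtain ⟨d, ⟨t, ht, rfl⟩, hmin⟩ := Int.exists_least_of_bdd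
      (P := fun d => ∃ t ∈ T, deg t = d) ⟨d₀, by rintro _ ⟨t, ht, rfl⟩; exact hd₀ t ht⟩
      (hne.elim fun t ht => ⟨deg t, t, ht, rfl⟩)
    rw [ofList_ofFn, ← Set.image_univ, ← Finset.coe_univ] at htop
    obtain ⟨c, hc⟩ := (mem_span_image_smul_top_iff θ Finset.univ
      (⟨single t 1, single_mem_monIdeal ht⟩ : monIdeal K S T)).1 (htop ▸ trivial)
    have hc' := congrArg Subtype.val hc
    rw [hcoe] at hc'
    have := congrArg (fun f : AddMonoidAlgebra K (Fin r → ℤ) => f.coeff t) hc'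
    simp only [coeff_single, Finsupp.single_eq_same, coeff_sum, Finsupp.finsetSum_apply] at this
    refine one_ne_zero (this.trans (Finset.sum_eq_zero fun i _ => ?_))
    rw [monomialSum, Finset.sum_mul, coeff_sum, Finsupp.finsetSum_apply]
    refine Finset.sum_eq_zero fun u hu => ?_
    rw [coeff_single_mul_apply, one_mul]
    refine mem_supported'.1 ((mem_monIdeal_iff K S hST).1 (c i).2) _ fun hmem => ?_
    have h1 := hmin _ ⟨_, hmem, rfl⟩
    rw [map_add, map_neg, h.deg_eq i u hu] at h1
    have := h.deg_pos i
    omega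
  refine ⟨List.ofFn θ, fun x hx => ?_, hreg, fun y hy => ?_, ?_⟩
  · obtain ⟨i, rfl⟩ := List.mem_ofFn' θ x |>.1 hx
    exact h.paramR_mem_irrelevantIdeal hUS i
  · refine not_isRegular_append hreg ?_
    rw [ofList_ofFn]
    exact h.irrelevantIdeal_le_radical hΓS hUS hy
  · rw [annihilator_monIdeal hne,
      ringKrullDim_eq_of_ringEquiv (RingEquiv.quotientBot (semigroupRing K S)),
      h.ringKrullDim_semigroupRing hΓS hdeg hUS hSgp, List.length_ofFn]

end CohenMacaulay

section Cone

open Filter Topology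

variable {r s : ℕ} {S : AddSubmonoid (Fin r → ℤ)} {σ : Fin s → Fin r → ℤ}
  {Γ : Finset (Fin r → ℤ)}

lemma exists_nat_combination_near (hSpos : ∀ x ∈ S, -x ∈ S → x = 0)
    (hSgp : ∀ x : Fin r → ℤ, ∃ a ∈ S, ∃ b ∈ S, x = a - b)
    (hrep : ∀ x : Fin r → ℤ, x ∈ S ↔ ∀ i, 0 ≤ lin (σ i) x)
    (hirr : ∀ j, ∃ x : Fin r → ℤ, lin (σ j) x < 0 ∧ ∀ i, i ≠ j → 0 ≤ lin (σ i) x)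
    (hΓS : AddSubmonoid.closure (Γ : Set (Fin r → ℤ)) = S) (hΓ0 : 0 ∉ Γ)
    {y : Fin r → ℝ} (hy : ∀ i, 0 ≤ ∑ k, (σ i k : ℝ) * y k) :
    ∃ (B : ℝ) (w : Fin r → ℤ), ∀ n : ℕ, ∃ m : (Fin r → ℤ) → ℕ,
      (∀ g ∈ Γ, (m g : ℝ) ≤ (n + 1) * B) ∧
      ∀ k, ∑ g ∈ Γ, m g * g k = ⌊(n + 1) * y k⌋ + w k := by
  obtain ⟨w, hwS, hw⟩ := exists_mem_forall_sum_abs_le_lin hSgp hrep hirr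
  refine ⟨∑ i, (∑ k, (σ i k : ℝ) * y k + 2 * lin (σ i) w), w, fun n => ?_⟩
  have key : ∀ i, |(lin (σ i) (fun k => ⌊(n + 1) * y k⌋) : ℝ) -
      (n + 1) * ∑ k, (σ i k : ℝ) * y k| ≤ lin (σ i) w := by
    intro i
    refine le_trans (le_of_eq ?_)
      ((abs_lin_floor_sub_le (σ i) fun k => (n + 1) * y k).trans (hw i))
    rw [Finset.mul_sum]
    congr 2
    exact Finset.sum_congr rfl fun k _ => mul_left_comm _ _ _
  have hxS : (fun k => ⌊(n + 1) * y k⌋) + w ∈ S := by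
    refine (hrep _).2 fun i => ?_
    have h1 := (abs_le.1 (key i)).1
    have h2 : (0 : ℝ) ≤ (n + 1) * ∑ k, (σ i k : ℝ) * y k := mul_nonneg (by positivity) (hy i)
    have h3 : (0 : ℝ) ≤ lin (σ i) ((fun k => ⌊(n + 1) * y k⌋) + w) := by
      rw [lin_add]
      push_cast
      linarith
    exact_mod_cast h3
  obtain ⟨m, -, hm⟩ := AddSubmonoid.mem_closure_finset.1 (hΓS.symm ▸ hxS)
  refine ⟨m, fun g hg => ?_, fun k => ?_⟩
  · have h1 : (m g : ℤ) ≤ formSum σ ((fun k => ⌊(n + 1) * y k⌋) + w) := by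
      rw [← hm, map_sum]
      have hpos : ∀ g ∈ Γ, 0 < formSum σ g := fun g hg =>
        formSum_pos hSpos hrep (hΓS ▸ AddSubmonoid.subset_closure hg)
          fun h => hΓ0 (h ▸ hg)
      have h2 := Finset.single_le_sum (f := fun g => formSum σ (m g • g))
        (fun g hg => by rw [map_nsmul]; exact nsmul_nonneg (hpos g hg).le _) hg
      refine le_trans ?_ h2
      rw [map_nsmul, nsmul_eq_mul]
      exact le_mul_of_one_le_right (Int.natCast_nonneg _) (hpos g hg)
    have h2 : (m g : ℝ) ≤ ∑ i, (lin (σ i) ((fun k => ⌊(n + 1) * y k⌋) + w) : ℝ) := by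
      rw [formSum_apply] at h1
      exact_mod_cast h1
    rw [Finset.mul_sum]
    refine h2.trans (Finset.sum_le_sum fun i _ => ?_)
    have h3 := (abs_le.1 (key i)).2
    have h4 : (0 : ℝ) ≤ lin (σ i) w := by exact_mod_cast (hrep w).1 hwS i
    have h5 : (0 : ℝ) ≤ n * lin (σ i) w := mul_nonneg n.cast_nonneg h4
    rw [lin_add]
    push_cast
    linarith
  · have := congrFun hm k
    simpa [Finset.sum_apply] using this

lemma mem_coneOf_of_forall_nonneg (hSpos : ∀ x ∈ S, -x ∈ S → x = 0)
    (hSgp : ∀ x : Fin r → ℤ, ∃ a ∈ S, ∃ b ∈ S, x = a - b)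
    (hrep : ∀ x : Fin r → ℤ, x ∈ S ↔ ∀ i, 0 ≤ lin (σ i) x)
    (hirr : ∀ j, ∃ x : Fin r → ℤ, lin (σ j) x < 0 ∧ ∀ i, i ≠ j → 0 ≤ lin (σ i) x)
    (hΓS : AddSubmonoid.closure (Γ : Set (Fin r → ℤ)) = S) (hΓ0 : 0 ∉ Γ)
    {y : Fin r → ℝ} (hy : ∀ i, 0 ≤ ∑ k, (σ i k : ℝ) * y k) :
    y ∈ coneOf (S : Set (Fin r → ℤ)) := by
  classical
  obtain ⟨B, w, hBw⟩ := exists_nat_combination_near hSpos hSgp hrep hirr hΓS hΓ0 hy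
  choose m hmB hm using hBw
  let C : ℕ → Γ → ℝ := fun n g => m n g / (n + 1)
  have hC : ∀ n, C n ∈ Set.Icc (0 : Γ → ℝ) fun _ => B := fun n =>
    ⟨fun g => by positivity, fun g => by
      change (m n g : ℝ) / (n + 1) ≤ B
      rw [div_le_iff₀ (by positivity), mul_comm]
      exact hmB n g g.2⟩
  obtain ⟨c, hc, φ, hφ, hlim⟩ := isCompact_Icc.tendsto_subseq hC
  refine ⟨Γ, fun g => if hg : g ∈ Γ then c ⟨g, hg⟩ else 0,
    fun g hg => hΓS ▸ AddSubmonoid.subset_closure hg, fun g => ?_, ?_⟩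
  · dsimp only
    split_ifs
    · exact hc.1 _
    · rfl
  ext k
  have h1 : Tendsto (fun n => ∑ g : Γ, C (φ n) g * (g : Fin r → ℤ) k) atTop
      (𝓝 (∑ g : Γ, c g * (g : Fin r → ℤ) k)) :=
    tendsto_finsetSum _ fun g _ => (tendsto_pi_nhds.1 hlim g).mul_const _
  have h2 : ∀ n, ∑ g : Γ, C n g * (g : Fin r → ℤ) k =
      y k + (w k - Int.fract ((n + 1) * y k)) / (n + 1) := by
    intro n
    have h3 : ∑ g : Γ, (m n g : ℝ) * (g : Fin r → ℤ) k = ⌊(n + 1) * y k⌋ + w k := by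
      rw [Finset.sum_coe_sort Γ fun g => (m n g : ℝ) * g k]
      exact_mod_cast hm n k
    have h4 : ∑ g : Γ, C n g * (g : Fin r → ℤ) k =
        (∑ g : Γ, (m n g : ℝ) * (g : Fin r → ℤ) k) / (n + 1) := by
      rw [Finset.sum_div]
      exact Finset.sum_congr rfl fun g _ => div_mul_eq_mul_div _ _ _
    rw [h4, h3, ← Int.self_sub_floor]
    have : (n + 1 : ℝ) ≠ 0 := by positivity
    field_simp
    ring
  have h5 : Tendsto (fun n : ℕ => (w k - Int.fract ((n + 1) * y k)) / ((n : ℝ) + 1)) atTop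
      (𝓝 0) := by
    refine squeeze_zero_norm (a := fun n : ℕ => (|(w k : ℝ)| + 1) * (1 / ((n : ℝ) + 1)))
      (fun n => ?_) ?_
    · rw [Real.norm_eq_abs, abs_div, abs_of_pos (by positivity : (0 : ℝ) < n + 1), div_eq_mul_one_div]
      refine mul_le_mul_of_nonneg_right ((abs_sub _ _).trans ?_) (by positivity)
      rw [abs_of_nonneg (Int.fract_nonneg (((n : ℝ) + 1) * y k))]
      linarith [Int.fract_lt_one (((n : ℝ) + 1) * y k)]
    · simpa using tendsto_one_div_add_atTop_nhds_zero_nat.const_mul (|(w k : ℝ)| + 1)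
  have h6 : Tendsto (fun n => ∑ g : Γ, C (φ n) g * (g : Fin r → ℤ) k) atTop (𝓝 (y k)) := by
    simp only [h2]
    simpa using (h5.comp hφ.tendsto_atTop).const_add (y k)
  rw [tendsto_nhds_unique h6 h1, Finset.sum_apply, ← Finset.sum_coe_sort Γ]
  exact Finset.sum_congr rfl fun g _ => by simp

lemma sum_mul_nonneg_of_mem_coneOf (hrep : ∀ x : Fin r → ℤ, x ∈ S ↔ ∀ i, 0 ≤ lin (σ i) x)
    {y : Fin r → ℝ} (hy : y ∈ coneOf (S : Set (Fin r → ℤ))) (i : Fin s) :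
    0 ≤ ∑ k, (σ i k : ℝ) * y k := by
  obtain ⟨t, c, ht, hc, rfl⟩ := hy
  have : ∑ k, (σ i k : ℝ) * (∑ v ∈ t, c v • (fun k => (v k : ℝ)) : Fin r → ℝ) k =
      ∑ v ∈ t, c v * (lin (σ i) v : ℝ) := by
    simp only [Finset.sum_apply, Pi.smul_apply, smul_eq_mul, Finset.mul_sum, lin, Int.cast_sum,
      Int.cast_mul]
    rw [Finset.sum_comm]
    exact Finset.sum_congr rfl fun v _ => Finset.sum_congr rfl fun k _ => mul_left_comm _ _ _
  rw [this]
  refine Finset.sum_nonneg fun v hv => mul_nonneg (hc v) ?_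
  exact_mod_cast (hrep v).1 (ht hv) i

theorem setOf_mem_add_coneOf_eq_Tset (hSpos : ∀ x ∈ S, -x ∈ S → x = 0)
    (hSgp : ∀ x : Fin r → ℤ, ∃ a ∈ S, ∃ b ∈ S, x = a - b)
    (hrep : ∀ x : Fin r → ℤ, x ∈ S ↔ ∀ i, 0 ≤ lin (σ i) x)
    (hirr : ∀ j, ∃ x : Fin r → ℤ, lin (σ j) x < 0 ∧ ∀ i, i ≠ j → 0 ≤ lin (σ i) x)
    (hΓS : AddSubmonoid.closure (Γ : Set (Fin r → ℤ)) = S) (hΓ0 : 0 ∉ Γ) (β : Fin r → ℝ) :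
    {x : Fin r → ℤ | ∃ y ∈ coneOf (S : Set (Fin r → ℤ)), (fun k => (x k : ℝ)) = β + y} =
      Tset σ (fun i => ⌈∑ k, (σ i k : ℝ) * β k⌉) := by
  ext x
  have hlin : ∀ i, (lin (σ i) x : ℝ) = ∑ k, (σ i k : ℝ) * x k := fun i => by simp [lin]
  constructor
  · rintro ⟨y, hy, hxy⟩ i
    rw [Int.ceil_le, hlin]
    have h1 := sum_mul_nonneg_of_mem_coneOf hrep hy i
    have h2 : ∀ k, (x k : ℝ) = β k + y k := fun k => congrFun hxy k
    simp only [h2, mul_add, Finset.sum_add_distrib]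
    linarith
  · intro hx
    refine ⟨(fun k => (x k : ℝ)) - β,
      mem_coneOf_of_forall_nonneg hSpos hSgp hrep hirr hΓS hΓ0 fun i => ?_, by abel⟩
    have h1 := Int.ceil_le.1 (hx i)
    rw [hlin] at h1
    simp only [Pi.sub_apply, mul_sub, Finset.sum_sub_distrib]
    linarith

end Cone

section Finiteness

variable {r s : ℕ} {S : AddSubmonoid (Fin r → ℤ)} {σ : Fin s → Fin r → ℤ}

lemma finite_Tset_inter_formSum_eq (hSpos : ∀ x ∈ S, -x ∈ S → x = 0)
    (hrep : ∀ x : Fin r → ℤ, x ∈ S ↔ ∀ i, 0 ≤ lin (σ i) x) (a : Fin s → ℤ) (d : ℤ) :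
    (Tset σ a ∩ {t | formSum σ t = d}).Finite := by
  have hinj : Function.Injective (formsHom σ) := by
    refine (injective_iff_map_eq_zero _).2 fun x hx => ?_
    exact eq_zero_of_forall_lin_eq_zero hSpos hrep fun i => congrFun hx i
  refine Set.Finite.of_finite_image
    ((Set.finite_Icc a fun i => d - ∑ j, a j + a i).subset ?_) hinj.injOn
  rintro _ ⟨t, ⟨ht, htd⟩, rfl⟩
  refine ⟨fun i => ht i, fun i => ?_⟩
  change lin (σ i) t ≤ d - ∑ j, a j + a i
  have h1 : lin (σ i) t - a i ≤ ∑ j, (lin (σ j) t - a j) :=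
    Finset.single_le_sum (f := fun j => lin (σ j) t - a j)
      (fun j _ => sub_nonneg.2 (ht j)) (Finset.mem_univ i)
  rw [Finset.sum_sub_distrib, ← formSum_apply, show formSum σ t = d from htd] at h1
  omega

lemma Tset_nonempty (hSgp : ∀ x : Fin r → ℤ, ∃ a ∈ S, ∃ b ∈ S, x = a - b)
    (hrep : ∀ x : Fin r → ℤ, x ∈ S ↔ ∀ i, 0 ≤ lin (σ i) x)
    (hirr : ∀ j, ∃ x : Fin r → ℤ, lin (σ j) x < 0 ∧ ∀ i, i ≠ j → 0 ≤ lin (σ i) x)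
    (a : Fin s → ℤ) : (Tset σ a).Nonempty := by
  obtain ⟨w, -, hw⟩ := exists_mem_forall_le_lin hSgp hrep hirr (∑ i, (a i).natAbs)
  refine ⟨w, fun i => le_trans ?_ (hw i)⟩
  have : (a i).natAbs ≤ ∑ i, (a i).natAbs :=
    Finset.single_le_sum (f := fun i => (a i).natAbs) (fun _ _ => Nat.zero_le _)
      (Finset.mem_univ i)
  omega

end Finiteness

end ConicDivisorial

/-- Corollary: conic divisorial ideals are Cohen–Macaulay.
For every `β ∈ ℝ^r` the set `T = ℤ^r ∩ (β + C(S))` equals `T(a)` with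
`a_i = ⌈σ_i(β)⌉`; hence `K·T` is a monomial divisorial ideal of `R = K[S]`, and it is a
Cohen–Macaulay `R`-module. -/
theorem conic_divisorial_isCM
    {r s : ℕ} (K : Type*) [Field K]
    (S : AddSubmonoid (Fin r → ℤ)) (σ : Fin s → Fin r → ℤ)
    (hSfg : S.FG)
    (hSpos : ∀ x ∈ S, -x ∈ S → x = 0)
    (hSgp : ∀ x : Fin r → ℤ, ∃ a ∈ S, ∃ b ∈ S, x = a - b)
    (hrep : ∀ x : Fin r → ℤ, x ∈ S ↔ ∀ i, 0 ≤ lin (σ i) x)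
    (hirr : ∀ j, ∃ x : Fin r → ℤ, lin (σ j) x < 0 ∧ ∀ i, i ≠ j → 0 ≤ lin (σ i) x)
    (hprim : ∀ i, Finset.univ.gcd (σ i) = 1)
    (β : Fin r → ℝ) :
    {x : Fin r → ℤ | ∃ y ∈ coneOf (S : Set (Fin r → ℤ)), (fun k => (x k : ℝ)) = β + y} =
        Tset σ (fun i => ⌈∑ k, (σ i k : ℝ) * β k⌉) ∧
    IsCohenMacaulayMod ↥(semigroupRing K S) (irrelevantIdeal K S)
      ↥(monIdeal K S (Tset σ (fun i => ⌈∑ k, (σ i k : ℝ) * β k⌉))) := by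
  classical
  obtain ⟨Γ₀, hΓ₀⟩ := hSfg
  have hΓS : AddSubmonoid.closure ((Γ₀.erase 0 : Finset (Fin r → ℤ)) : Set (Fin r → ℤ)) = S := by
    rw [Finset.coe_erase, AddSubmonoid.closure_sdiff_singleton_zero, hΓ₀]
  have hΓ0 : (0 : Fin r → ℤ) ∉ Γ₀.erase 0 := Finset.notMem_erase 0 Γ₀
  have hdeg : ∀ x ∈ S, 0 ≤ ConicDivisorial.formSum σ x := fun x hx =>
    ConicDivisorial.formSum_nonneg hrep hx
  obtain ⟨U, e, h⟩ := ConicDivisorial.exists_isParamSystem (ConicDivisorial.formSum σ) (Γ₀.erase 0)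
    fun g hg => ConicDivisorial.formSum_pos hSpos hrep (hΓS ▸ AddSubmonoid.subset_closure hg)
      (Finset.ne_of_mem_erase hg)
  have hST : ∀ x ∈ S, ∀ y ∈ Tset σ (fun i => ⌈∑ k, (σ i k : ℝ) * β k⌉),
      x + y ∈ Tset σ (fun i => ⌈∑ k, (σ i k : ℝ) * β k⌉) := fun x hx y hy =>
    ConicDivisorial.add_mem_Tset hrep hx hy
  have hcol := ConicDivisorial.colonProp_of_forall_charP h.deg_eq
    (fun i u hu t ht => hST u (hΓS ▸ h.mem i u hu) t ht)
    (ConicDivisorial.finite_Tset_inter_formSum_eq hSpos hrep _)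
    (fun k _ p _ _ =>
      ConicDivisorial.colonProp_Tset_of_charP (K := k) p h hΓS hdeg hSgp hrep hirr β) K
  exact ⟨ConicDivisorial.setOf_mem_add_coneOf_eq_Tset hSpos hSgp hrep hirr hΓS hΓ0 β,
    ConicDivisorial.isCohenMacaulayMod_monIdeal h hΓS hdeg hSgp hST
      (ConicDivisorial.Tset_nonempty hSgp hrep hirr _)
      (d₀ := ∑ i, ⌈∑ k, (σ i k : ℝ) * β k⌉)
      (fun t ht => (Finset.sum_le_sum fun i _ => ht i).trans_eq
        (ConicDivisorial.formSum_apply σ t).symm) hcol⟩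
end
end
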